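/- Let 𝕂 be a number field. There exists a constant C > 0 such that for every s = σ + it with σ ∈ [−1/2, 3/2], t ≥ 2, and ζ_𝕂(s) ≠ 0, one has |ζ_𝕂′(s)/ζ_𝕂(s) − ∑_{ρ : |t − Im ρ| ≤ 1} 1/(s − ρ)| ≤ C log t, where the sum runs over the non-trivial zeros ρ of ζ_𝕂 (counted with multiplicity) whose imaginary part γ = Im ρ satisfies |t − γ| ≤ 1. -/

import Mathlib

open Complex NumberField Filter Topology
open nonZeroDivisors

/-- The product `∏ i, f (k i)` is summable over integer vectors `k` when `f` is summable. -/
theorem summable_pi_prod_of_summable {ι α : Type*} [Fintype ι] {f : α → ℝ} (hf0 : ∀ a, 0 ≤ f a)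
    (hf : Summable f) : Summable fun k : ι → α => ∏ i, f (k i) := by
  classical
  refine summable_of_sum_le (c := ∏ _i : ι, ∑' a, f a)
    (fun k => Finset.prod_nonneg fun i _ => hf0 _) fun s => ?_
  calc ∑ k ∈ s, ∏ i, f (k i)
      ≤ ∑ k ∈ Fintype.piFinset (fun i => s.image fun k => k i), ∏ i, f (k i) := by
        refine Finset.sum_le_sum_of_subset_of_nonneg (fun k hk => ?_)
          fun k _ _ => Finset.prod_nonneg fun i _ => hf0 _
        simp only [Fintype.mem_piFinset, Finset.mem_image]
        exact fun i => ⟨k, hk, rfl⟩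
    _ = ∏ i, ∑ a ∈ s.image (fun k => k i), f a := (Finset.prod_univ_sum _ _).symm
    _ ≤ ∏ _i : ι, ∑' a, f a :=
        Finset.prod_le_prod (fun i _ => Finset.sum_nonneg fun _ _ => hf0 _)
          fun i _ => hf.sum_le_tsum _ fun _ _ => hf0 _

theorem summable_exp_neg_mul_int_sq {c : ℝ} (hc : 0 < c) :
    Summable fun k : ℤ => Real.exp (-c * (k : ℝ) ^ 2) := by
  have h := summable_pow_mul_jacobiTheta₂_term_bound (0 : ℝ) (T := c / Real.pi)
    (by positivity) 0
  refine h.congr fun k => ?_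
  simp only [pow_zero, one_mul, mul_zero, zero_mul, sub_zero]
  congr 1
  field_simp

theorem summable_exp_neg_mul_sum_sq {ι : Type*} [Fintype ι] {c : ℝ} (hc : 0 < c) :
    Summable fun k : ι → ℤ => Real.exp (-c * ∑ i, (k i : ℝ) ^ 2) := by
  refine (summable_pi_prod_of_summable (ι := ι) (fun _ => (Real.exp_pos _).le)
    (summable_exp_neg_mul_int_sq hc)).congr fun k => ?_
  rw [← Real.exp_sum, Finset.mul_sum]

/-- The unit cube `(0, 1]^ι`. -/
def unitCube (ι : Type*) : Set (ι → ℝ) := {y | ∀ i, y i ∈ Set.Ioc (0 : ℝ) 1}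

theorem measurableSet_unitCube (ι : Type*) [Fintype ι] : MeasurableSet (unitCube ι) := by
  have : unitCube ι = Set.univ.pi fun _ => Set.Ioc (0 : ℝ) 1 := by
    ext; simp [unitCube]
  rw [this]
  exact MeasurableSet.univ_pi fun _ => measurableSet_Ioc

theorem volume_unitCube (ι : Type*) [Fintype ι] : MeasureTheory.volume (unitCube ι) = 1 := by
  have : unitCube ι = Set.univ.pi fun _ => Set.Ioc (0 : ℝ) 1 := by
    ext; simp [unitCube]
  rw [this, Real.volume_pi_Ioc]
  simp

def cubeShift {ι : Type*} (k : ι → ℤ) : Set (ι → ℝ) := (fun y i => y i - (k i : ℝ)) ⁻¹' unitCube ι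

theorem measurableSet_cubeShift {ι : Type*} [Fintype ι] (k : ι → ℤ) : MeasurableSet (cubeShift k) :=
  (measurableSet_unitCube ι).preimage (by fun_prop)

theorem iUnion_cubeShift {ι : Type*} : ⋃ k, cubeShift (ι := ι) k = Set.univ := by
  refine Set.eq_univ_of_forall fun y => Set.mem_iUnion.2 ⟨fun i => ⌈y i⌉ - 1, fun i => ?_⟩
  have h1 := Int.le_ceil (y i)
  have h2 := Int.ceil_lt_add_one (y i)
  simp only [Set.mem_Ioc]
  push_cast
  constructor <;> linarith

theorem pairwise_disjoint_cubeShift {ι : Type*} :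
    Pairwise (Function.onFun Disjoint (cubeShift (ι := ι))) := by
  intro k l hkl
  refine Set.disjoint_left.2 fun y hk hl => hkl (funext fun i => ?_)
  have h1 := hk i
  have h2 := hl i
  simp only [Set.mem_Ioc] at h1 h2
  have h3 : (k i : ℝ) < l i + 1 := by linarith
  have h4 : (l i : ℝ) < k i + 1 := by linarith
  norm_cast at h3 h4
  omega

theorem measurePreserving_shift {ι : Type*} [Fintype ι] (k : ι → ℤ) :
    MeasureTheory.MeasurePreserving (fun (y : ι → ℝ) i => y i - (k i : ℝ)) := by
  have := MeasureTheory.measurePreserving_sub_right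
    (MeasureTheory.volume : MeasureTheory.Measure (ι → ℝ)) (fun i => (k i : ℝ))
  exact this

theorem measurableEmbedding_shift {ι : Type*} (k : ι → ℤ) :
    MeasurableEmbedding (fun (y : ι → ℝ) i => y i - (k i : ℝ)) :=
  (MeasurableEquiv.subRight (fun i => (k i : ℝ) : ι → ℝ)).measurableEmbedding

/-- Unfolding of an integral over `ℝ^ι` as a sum of integrals over the unit cube. -/
theorem hasSum_integral_unitCube {ι : Type*} [Fintype ι] {E : Type*}
    [NormedAddCommGroup E] [NormedSpace ℝ E]
    {g : (ι → ℝ) → E} (hg : MeasureTheory.Integrable g) :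
    HasSum (fun k : ι → ℤ => ∫ y in unitCube ι, g (fun i => y i + k i)) (∫ y, g y) := by
  have h := MeasureTheory.hasSum_integral_iUnion (μ := MeasureTheory.volume) (f := g)
    (measurableSet_cubeShift (ι := ι)) pairwise_disjoint_cubeShift hg.integrableOn
  rw [iUnion_cubeShift, MeasureTheory.setIntegral_univ] at h
  refine h.congr_fun fun k => ?_
  simpa [cubeShift] using ((measurePreserving_shift k).setIntegral_preimage_emb
    (measurableEmbedding_shift k) (fun y => g (fun i => y i + k i)) (unitCube ι)).symm

/-- Unfolding of a Lebesgue integral over `ℝ^ι` as a sum of integrals over the unit cube. -/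
theorem lintegral_eq_tsum_unitCube {ι : Type*} [Fintype ι] (g : (ι → ℝ) → ENNReal) :
    ∫⁻ y, g y = ∑' k : ι → ℤ, ∫⁻ y in unitCube ι, g (fun i => y i + k i) := by
  rw [← MeasureTheory.setLIntegral_univ, ← iUnion_cubeShift, MeasureTheory.lintegral_iUnion
    measurableSet_cubeShift pairwise_disjoint_cubeShift]
  refine tsum_congr fun k => ?_
  simpa [cubeShift] using (measurePreserving_shift k).setLIntegral_comp_preimage_emb
    (measurableEmbedding_shift k) (fun y => g (fun i => y i + k i)) (unitCube ι)

/-- The quadratic form `y ↦ ‖M y‖²` attached to a real matrix. -/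
noncomputable def sqForm {ι : Type*} [Fintype ι] (M : Matrix ι ι ℝ) (y : ι → ℝ) : ℝ :=
  ∑ i, (M.mulVec y i) ^ 2

theorem sqForm_nonneg {ι : Type*} [Fintype ι] (M : Matrix ι ι ℝ) (y : ι → ℝ) : 0 ≤ sqForm M y :=
  Finset.sum_nonneg fun _ _ => sq_nonneg _

theorem continuous_sqForm {ι : Type*} [Fintype ι] (M : Matrix ι ι ℝ) : Continuous (sqForm M) := by
  unfold sqForm Matrix.mulVec dotProduct
  fun_prop

theorem exists_mul_sum_sq_le_sqForm {ι : Type*} [Fintype ι] [DecidableEq ι] {M N : Matrix ι ι ℝ}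
    (hN : N * M = 1) : ∃ c > 0, ∀ y, c * ∑ i, y i ^ 2 ≤ sqForm M y := by
  set B : ℝ := ∑ i, ∑ j, N i j ^ 2 with hB
  have hB0 : 0 ≤ B := Finset.sum_nonneg fun i _ => Finset.sum_nonneg fun j _ => sq_nonneg _
  refine ⟨(B + 1)⁻¹, by positivity, fun y => ?_⟩
  rw [inv_mul_le_iff₀ (by positivity)]
  have h1 : ∑ i, y i ^ 2 ≤ B * sqForm M y := by
    rw [hB, Finset.sum_mul]
    refine Finset.sum_le_sum fun i _ => ?_
    have h2 : y i = ∑ j, N i j * M.mulVec y j := by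
      have : N.mulVec (M.mulVec y) = y := by rw [Matrix.mulVec_mulVec, hN, Matrix.one_mulVec]
      exact (congrFun this i).symm
    rw [h2]
    exact Finset.sum_mul_sq_le_sq_mul_sq _ _ _
  linarith [sqForm_nonneg M y]

theorem summable_exp_neg_sqForm_add {ι : Type*} [Fintype ι] [DecidableEq ι] {M N : Matrix ι ι ℝ}
    (hN : N * M = 1) (B : ℝ) : ∃ u : (ι → ℤ) → ℝ, Summable u ∧
      ∀ y : ι → ℝ, ∑ i, y i ^ 2 ≤ B → ∀ k : ι → ℤ,
        Real.exp (-Real.pi * sqForm M (fun i => y i + k i)) ≤ u k := by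
  obtain ⟨c, hc, h⟩ := exists_mul_sum_sq_le_sqForm hN
  refine ⟨fun k => Real.exp (Real.pi * c * B) *
    Real.exp (-(Real.pi * c / 2) * ∑ i, (k i : ℝ) ^ 2),
    (summable_exp_neg_mul_sum_sq (by positivity)).mul_left _, fun y hy k => ?_⟩
  beta_reduce
  rw [← Real.exp_add, Real.exp_le_exp]
  have h1 := h (fun i => y i + k i)
  have h2 : ∑ i, ((k i : ℝ) ^ 2 / 2 - y i ^ 2) ≤ ∑ i, (y i + k i) ^ 2 :=
    Finset.sum_le_sum fun i _ => by nlinarith [sq_nonneg (2 * y i + k i)]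
  rw [Finset.sum_sub_distrib, ← Finset.sum_div] at h2
  have h3 : c * ((∑ i, (k i : ℝ) ^ 2) / 2 - B) ≤ sqForm M (fun i => y i + k i) :=
    le_trans (mul_le_mul_of_nonneg_left (by linarith) hc.le) h1
  nlinarith [Real.pi_pos, mul_le_mul_of_nonneg_left h3 Real.pi_pos.le]

theorem summable_exp_neg_sqForm {ι : Type*} [Fintype ι] [DecidableEq ι] {M N : Matrix ι ι ℝ}
    (hN : N * M = 1) : Summable fun k : ι → ℤ => Real.exp (-Real.pi * sqForm M (fun i => k i)) := by
  obtain ⟨u, hu, h⟩ := summable_exp_neg_sqForm_add hN 0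
  refine Summable.of_nonneg_of_le (fun _ => (Real.exp_pos _).le) (fun k => ?_) hu
  simpa using h 0 (by simp) k

theorem integral_comp_mulVec {ι : Type*} [Fintype ι] [DecidableEq ι] {M N : Matrix ι ι ℝ}
    (hN : N * M = 1) (g : (ι → ℝ) → ℂ) :
    ∫ y, g (M.mulVec y) = |M.det|⁻¹ * ∫ y, g y := by
  have hdet : M.det ≠ 0 := fun h => by
    have := congrArg Matrix.det hN
    rw [Matrix.det_mul, h] at this
    simp at this
  have h := Real.map_matrix_volume_pi_eq_smul_volume_pi hdet
  have hinj : Function.Injective (Matrix.toLin' M) := fun x y hxy => by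
    have := congrArg (N.mulVec) hxy
    simpa [Matrix.mulVec_mulVec, hN] using this
  have hemb : MeasurableEmbedding (Matrix.toLin' M) :=
    (LinearMap.isClosedEmbedding_of_injective
      (LinearMap.ker_eq_bot.2 hinj)).measurableEmbedding
  have h2 := hemb.integral_map (μ := MeasureTheory.volume) g
  rw [h, MeasureTheory.integral_smul_measure, ENNReal.toReal_ofReal (abs_nonneg _)] at h2
  rw [abs_inv] at h2
  simpa using h2.symm

/-- The Fourier transform of the Gaussian `exp (-π ‖M y‖²)`. -/
theorem integral_cexp_neg_sqForm {ι : Type*} [Fintype ι] [DecidableEq ι] {M N : Matrix ι ι ℝ}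
    (hN : N.transpose * M = 1) (m : ι → ℝ) :
    ∫ y : ι → ℝ, cexp (-2 * Real.pi * I * ∑ i, m i * y i) * (Real.exp (-Real.pi * sqForm M y) : ℂ)
      = |M.det|⁻¹ * (Real.exp (-Real.pi * sqForm N m) : ℂ) := by
  have hdot : ∀ y, ∑ i, (N.mulVec m i) * (M.mulVec y i) = ∑ i, m i * y i := fun y => by
    change (N.mulVec m) ⬝ᵥ (M.mulVec y) = m ⬝ᵥ y
    rw [Matrix.dotProduct_mulVec, ← Matrix.mulVec_transpose, Matrix.mulVec_mulVec,
      ← Matrix.transpose_transpose (M.transpose * N), Matrix.transpose_mul,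
      Matrix.transpose_transpose, hN]
    simp
  have h1 := integral_comp_mulVec hN (fun z => cexp (-∑ i, (Real.pi : ℂ) * (z i : ℂ) ^ 2 +
    ∑ i, (-2 * Real.pi * I * N.mulVec m i) * z i))
  rw [GaussianFourier.integral_cexp_neg_sum_mul_add (fun i => by simpa using Real.pi_pos)] at h1
  have hpi : (Real.pi : ℂ) ≠ 0 := by exact_mod_cast Real.pi_ne_zero
  convert h1 using 1
  · congr 1
    funext y
    rw [Complex.ofReal_exp, ← Complex.exp_add]
    congr 1
    rw [← hdot y, sqForm]
    push_cast
    simp only [Finset.mul_sum, ← Finset.sum_neg_distrib, ← Finset.sum_add_distrib]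
    exact Finset.sum_congr rfl fun i _ => by ring
  · congr 1
    simp only [div_self hpi, one_cpow, one_mul]
    rw [← Complex.exp_sum, Complex.ofReal_exp, sqForm]
    congr 1
    push_cast
    rw [Finset.mul_sum]
    refine Finset.sum_congr rfl fun i _ => ?_
    field_simp
    ring_nf
    rw [I_sq]
    ring

/-- The coordinatewise projection `ℝ^ι → (ℝ/ℤ)^ι` as a continuous map. -/
def toTorus (ι : Type*) : C(ι → ℝ, UnitAddTorus ι) where
  toFun y i := (y i : UnitAddCircle)
  continuous_toFun := continuous_pi fun i =>
    (AddCircle.continuous_mk' (1 : ℝ)).comp (continuous_apply i)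

theorem isQuotientMap_toTorus (ι : Type*) [Finite ι] : IsQuotientMap (toTorus ι) := by
  have h : IsOpenQuotientMap (Pi.map fun (_ : ι) (x : ℝ) => (x : UnitAddCircle)) :=
    IsOpenQuotientMap.piMap fun _ => QuotientAddGroup.isOpenQuotientMap_mk
  exact h.isQuotientMap

theorem toTorus_add_int {ι : Type*} (y : ι → ℝ) (k : ι → ℤ) :
    toTorus ι (fun i => y i + k i) = toTorus ι y := by
  funext i
  change ((y i + k i : ℝ) : UnitAddCircle) = (y i : ℝ)
  rw [AddCircle.coe_add]
  simp

theorem exists_int_of_toTorus_eq {ι : Type*} {y z : ι → ℝ} (h : toTorus ι y = toTorus ι z) :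
    ∃ k : ι → ℤ, ∀ i, z i = y i + k i := by
  have h1 : ∀ i, ∃ n : ℤ, z i = y i + n := fun i => by
    have h2 : ((y i : ℝ) : UnitAddCircle) = (z i : ℝ) := congrFun h i
    have h3 : ((z i - y i : ℝ) : UnitAddCircle) = 0 := by
      rw [AddCircle.coe_sub, h2, sub_self]
    obtain ⟨n, hn⟩ := (AddCircle.coe_eq_zero_iff (1 : ℝ)).1 h3
    exact ⟨n, by simp at hn; linarith⟩
  choose k hk using h1
  exact ⟨k, hk⟩

theorem mFourier_toTorus {ι : Type*} [Fintype ι] (m : ι → ℤ) (y : ι → ℝ) :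
    UnitAddTorus.mFourier m (toTorus ι y) = cexp (2 * Real.pi * I * ∑ i, (m i : ℂ) * y i) := by
  simp only [UnitAddTorus.mFourier, toTorus, ContinuousMap.coe_mk, fourier_coe_apply]
  rw [← Complex.exp_sum, Finset.mul_sum]
  congr 1
  exact Finset.sum_congr rfl fun i _ => by push_cast; ring

/-- The sum `∑ k, exp (-π ‖M (y + k)‖²)` as a function of `y`. -/
noncomputable def periodicGaussian {ι : Type*} [Fintype ι] (M : Matrix ι ι ℝ) (y : ι → ℝ) : ℂ :=
  ∑' k : ι → ℤ, (Real.exp (-Real.pi * sqForm M (fun i => y i + k i)) : ℂ)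

theorem continuous_periodicGaussian {ι : Type*} [Fintype ι] [DecidableEq ι] {M N : Matrix ι ι ℝ}
    (hN : N * M = 1) : Continuous (periodicGaussian M) := by
  refine continuous_iff_continuousAt.2 fun y₀ => ?_
  obtain ⟨u, hu, h⟩ := summable_exp_neg_sqForm_add hN (∑ i, y₀ i ^ 2 + 1)
  have hs : {y : ι → ℝ | ∑ i, y i ^ 2 < ∑ i, y₀ i ^ 2 + 1} ∈ 𝓝 y₀ :=
    (isOpen_lt (by fun_prop) (by fun_prop)).mem_nhds (by simp)
  refine ContinuousOn.continuousAt (s := {y : ι → ℝ | ∑ i, y i ^ 2 < ∑ i, y₀ i ^ 2 + 1}) ?_ hs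
  refine continuousOn_tsum (fun k => Continuous.continuousOn ?_) hu fun k y hy => ?_
  · have := continuous_sqForm M
    fun_prop
  · rw [Complex.norm_real, Real.norm_of_nonneg (Real.exp_pos _).le]
    exact h y (le_of_lt hy) k

theorem periodicGaussian_add_int {ι : Type*} [Fintype ι] (M : Matrix ι ι ℝ) (y : ι → ℝ)
    (k : ι → ℤ) : periodicGaussian M (fun i => y i + k i) = periodicGaussian M y := by
  unfold periodicGaussian
  rw [← (Equiv.addLeft k).tsum_eq fun l : ι → ℤ =>
    (Real.exp (-Real.pi * sqForm M (fun i => y i + l i)) : ℂ)]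
  refine tsum_congr fun l => ?_
  simp [add_assoc]

theorem integrable_exp_neg_sqForm {ι : Type*} [Fintype ι] [DecidableEq ι] {M N : Matrix ι ι ℝ}
    (hN : N.transpose * M = 1) :
    MeasureTheory.Integrable fun y : ι → ℝ => (Real.exp (-Real.pi * sqForm M y) : ℂ) := by
  by_contra h
  have h1 := integral_cexp_neg_sqForm hN 0
  have hdet : M.det ≠ 0 := fun h => by
    have := congrArg Matrix.det hN
    rw [Matrix.det_mul, h] at this
    simp at this
  simp only [Pi.zero_apply, ofReal_zero, zero_mul, Finset.sum_const_zero, mul_zero,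
    Complex.exp_zero,
    one_mul] at h1
  rw [MeasureTheory.integral_undef h] at h1
  have h2 : (|M.det|⁻¹ : ℝ) * (Real.exp (-Real.pi * sqForm N 0)) ≠ 0 := by positivity
  exact h2 (by exact_mod_cast h1.symm)

theorem integral_unitCube_mul_periodicGaussian {ι : Type*} [Fintype ι] [DecidableEq ι]
    {M N : Matrix ι ι ℝ} (hN : N.transpose * M = 1) (m : ι → ℤ) :
    ∫ y in unitCube ι, UnitAddTorus.mFourier (-m) (toTorus ι y) * periodicGaussian M y =
      |M.det|⁻¹ * (Real.exp (-Real.pi * sqForm N (fun i => m i)) : ℂ) := by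
  set φ : (ι → ℝ) → ℂ := fun y => UnitAddTorus.mFourier (-m) (toTorus ι y) *
    (Real.exp (-Real.pi * sqForm M y) : ℂ) with hφ
  have hn : ∀ y, ‖UnitAddTorus.mFourier (-m) (toTorus ι y)‖ ≤ 1 := fun y =>
    ((UnitAddTorus.mFourier (-m)).norm_coe_le_norm _).trans_eq UnitAddTorus.mFourier_norm
  have hc1 : Continuous fun y => UnitAddTorus.mFourier (-m) (toTorus ι y) :=
    (UnitAddTorus.mFourier (-m)).continuous.comp (toTorus ι).continuous
  have hcs := continuous_sqForm M
  have hφi : MeasureTheory.Integrable φ := by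
    refine (integrable_exp_neg_sqForm hN).bdd_mul (c := 1) hc1.aestronglyMeasurable ?_
    exact Filter.Eventually.of_forall hn
  have h1 := hasSum_integral_unitCube hφi
  have h2 : ∫ y, φ y = |M.det|⁻¹ * (Real.exp (-Real.pi * sqForm N (fun i => m i)) : ℂ) := by
    rw [← integral_cexp_neg_sqForm hN]
    congr 1
    funext y
    rw [hφ]
    beta_reduce
    rw [mFourier_toTorus]
    congr 2
    simp
  rw [h2] at h1
  refine HasSum.unique ?_ h1
  obtain ⟨u, hu, h⟩ := summable_exp_neg_sqForm_add hN (Fintype.card ι)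
  have hcube : ∀ y ∈ unitCube ι, ∑ i, y i ^ 2 ≤ Fintype.card ι := fun y hy => by
    have : ∑ i, y i ^ 2 ≤ ∑ _i : ι, (1 : ℝ) := Finset.sum_le_sum fun i _ => by
      have := hy i
      simp only [Set.mem_Ioc] at this
      nlinarith
    simpa using this
  have hm : ∀ᵐ y ∂(MeasureTheory.volume.restrict (unitCube ι)), y ∈ unitCube ι :=
    MeasureTheory.ae_restrict_mem (measurableSet_unitCube ι)
  have hfin : MeasureTheory.IsFiniteMeasure (MeasureTheory.volume.restrict (unitCube ι)) :=
    ⟨by simp [volume_unitCube]⟩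
  refine MeasureTheory.hasSum_integral_of_dominated_convergence (bound := fun k _ => u k)
    (fun k => ?_) (fun k => ?_) ?_ ?_ ?_
  · refine Continuous.aestronglyMeasurable ?_
    simp only [hφ]
    have h3 : Continuous fun (y : ι → ℝ) (i : ι) => y i + (k i : ℝ) := by fun_prop
    exact (hc1.comp h3).mul (by fun_prop)
  · filter_upwards [hm] with y hy
    rw [hφ]
    beta_reduce
    rw [norm_mul, Complex.norm_real, Real.norm_of_nonneg (Real.exp_pos _).le]
    refine (mul_le_of_le_one_left (Real.exp_pos _).le (hn _)).trans (h y (hcube y hy) k)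
  · exact Filter.Eventually.of_forall fun _ => hu
  · exact MeasureTheory.integrable_const _
  · filter_upwards [hm] with y hy
    simp only [hφ, toTorus_add_int]
    refine HasSum.mul_left _ (Summable.hasSum ?_)
    refine Summable.of_norm_bounded hu fun k => ?_
    rw [Complex.norm_real, Real.norm_of_nonneg (Real.exp_pos _).le]
    exact h y (hcube y hy) k

/-- Poisson summation for the Gaussian `exp (-π ‖M y‖²)` over `ℤ^ι`. -/
theorem tsum_exp_neg_sqForm {ι : Type*} [Fintype ι] [DecidableEq ι] {M N : Matrix ι ι ℝ}
    (hN : N.transpose * M = 1) :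
    ∑' k : ι → ℤ, Real.exp (-Real.pi * sqForm M (fun i => k i)) =
      |M.det|⁻¹ * ∑' m : ι → ℤ, Real.exp (-Real.pi * sqForm N (fun i => m i)) := by
  have hN' : M.transpose * N = 1 := by
    rw [← Matrix.transpose_one, ← hN, Matrix.transpose_mul, Matrix.transpose_transpose]
  let G : C(ι → ℝ, ℂ) := ⟨periodicGaussian M, continuous_periodicGaussian hN⟩
  have hG : Function.FactorsThrough G (toTorus ι) := fun y z hyz => by
    obtain ⟨k, hk⟩ := exists_int_of_toTorus_eq hyz
    have : z = fun i => y i + k i := funext hk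
    simp only [G, ContinuousMap.coe_mk]
    rw [this, periodicGaussian_add_int]
  let F : C(UnitAddTorus ι, ℂ) := (isQuotientMap_toTorus ι).lift G hG
  have hF : ∀ y, F (toTorus ι y) = periodicGaussian M y := fun y =>
    DFunLike.congr_fun ((isQuotientMap_toTorus ι).lift_comp G hG) y
  have hcoeff : ∀ m, UnitAddTorus.mFourierCoeff F m =
      |M.det|⁻¹ * (Real.exp (-Real.pi * sqForm N (fun i => m i)) : ℂ) := fun m => by
    rw [UnitAddTorus.mFourierCoeff_eq_integral F m 0, ← integral_unitCube_mul_periodicGaussian hN]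
    have : {x : ι → ℝ | ∀ i, x i ∈ Set.Ioc ((0 : ι → ℝ) i) ((0 : ι → ℝ) i + 1)} = unitCube ι := by
      ext; simp [unitCube]
    rw [this]
    congr 1
    funext y
    rw [smul_eq_mul, ← hF]
    rfl
  have hsum : Summable (UnitAddTorus.mFourierCoeff F) := by
    rw [funext hcoeff]
    refine Summable.mul_left _ ?_
    exact_mod_cast (summable_exp_neg_sqForm hN')
  have h := UnitAddTorus.hasSum_mFourier_series_apply_of_summable hsum (toTorus ι 0)
  rw [hF] at h
  have h1 : periodicGaussian M 0 =
      ((∑' k : ι → ℤ, Real.exp (-Real.pi * sqForm M (fun i => k i)) : ℝ) : ℂ) := by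
    simp [periodicGaussian, Complex.ofReal_tsum]
  have h2 := h.tsum_eq
  rw [h1] at h2
  have h3 : ∀ m : ι → ℤ, UnitAddTorus.mFourierCoeff F m • UnitAddTorus.mFourier m (toTorus ι 0) =
      ((|M.det|⁻¹ * Real.exp (-Real.pi * sqForm N (fun i => m i)) : ℝ) : ℂ) := fun m => by
    rw [hcoeff, mFourier_toTorus]
    simp
  rw [tsum_congr h3, ← Complex.ofReal_tsum, Complex.ofReal_inj, tsum_mul_left] at h2
  exact h2.symm

/-- The positive definite form `∑_w m_w e^{2 x_w} |α|_w²` on a number field. -/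
noncomputable def placeForm {K : Type*} [Field K] [NumberField K] (x : InfinitePlace K → ℝ)
    (α : K) : ℝ :=
  ∑ w : InfinitePlace K, (w.mult : ℝ) * (Real.exp (2 * x w) * w α ^ 2)

open Classical in
theorem sum_embeddings_eq_sum_places {K : Type*} [Field K] [NumberField K]
    (g : InfinitePlace K → ℝ) :
    ∑ φ : K →+* ℂ, g (InfinitePlace.mk φ) = ∑ w : InfinitePlace K, (w.mult : ℝ) * g w := by
  rw [← Finset.sum_fiberwise Finset.univ (fun φ : K →+* ℂ => InfinitePlace.mk φ)]
  refine Finset.sum_congr rfl fun w _ => ?_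
  rw [Finset.sum_congr rfl (g := fun _ => g w), Finset.sum_const, ← nsmul_eq_mul]
  · congr 1
    convert InfinitePlace.card_filter_mk_eq w
  · intro φ hφ
    rw [(Finset.mem_filter.1 hφ).2]

/-- The matrix of `α ↦ (e^{x_φ} (re φ α + im φ α))_φ` in the family `b`. -/
noncomputable def embeddingMatrix {K ι : Type*} [Field K] [NumberField K]
    (x : InfinitePlace K → ℝ) (b : ι → K) : Matrix (K →+* ℂ) ι ℝ :=
  Matrix.of fun φ j => Real.exp (x (InfinitePlace.mk φ)) * ((φ (b j)).re + (φ (b j)).im)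

theorem sum_comp_conjugate {K : Type*} [Field K] [NumberField K] (g : (K →+* ℂ) → ℝ) :
    ∑ φ : K →+* ℂ, g (ComplexEmbedding.conjugate φ) = ∑ φ : K →+* ℂ, g φ :=
  Equiv.sum_comp (ComplexEmbedding.involutive_conjugate K).toPerm g

theorem sum_sq_embedding_eq_placeForm {K : Type*} [Field K] [NumberField K]
    (x : InfinitePlace K → ℝ) (α : K) :
    ∑ φ : K →+* ℂ, (Real.exp (x (InfinitePlace.mk φ)) * ((φ α).re + (φ α).im)) ^ 2 =
      placeForm x α := by
  set S := ∑ φ : K →+* ℂ, (Real.exp (x (InfinitePlace.mk φ)) * ((φ α).re + (φ α).im)) ^ 2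
  have h1 : S = ∑ φ : K →+* ℂ, (Real.exp (x (InfinitePlace.mk φ)) * ((φ α).re - (φ α).im)) ^ 2 := by
    rw [← sum_comp_conjugate]
    refine Finset.sum_congr rfl fun φ _ => ?_
    simp [InfinitePlace.mk_conjugate_eq, sub_eq_add_neg]
  have h2 : S + S = 2 * placeForm x α := by
    conv_lhs => rw [h1]
    unfold placeForm
    rw [show (2 : ℝ) * ∑ w : InfinitePlace K, (w.mult : ℝ) * (Real.exp (2 * x w) * w α ^ 2) =
      2 * ∑ φ : K →+* ℂ, (Real.exp (2 * x (InfinitePlace.mk φ)) * (InfinitePlace.mk φ) α ^ 2) from by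
        rw [← sum_embeddings_eq_sum_places], ← h1, ← two_mul]
    nth_rw 1 [two_mul]
    nth_rw 2 [h1]
    rw [← Finset.sum_add_distrib, Finset.mul_sum]
    refine Finset.sum_congr rfl fun φ _ => ?_
    rw [InfinitePlace.apply, Complex.sq_norm, Complex.normSq_apply, two_mul (x _), Real.exp_add]
    ring
  linarith

theorem sqForm_embeddingMatrix {K : Type*} [Field K] [NumberField K]
    (x : InfinitePlace K → ℝ) (b : (K →+* ℂ) → K) (k : (K →+* ℂ) → ℤ) :
    sqForm (embeddingMatrix x b) (fun i => (k i : ℝ)) = placeForm x (∑ i, k i • b i) := by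
  rw [← sum_sq_embedding_eq_placeForm]
  unfold sqForm
  refine Finset.sum_congr rfl fun φ _ => ?_
  congr 1
  simp only [Matrix.mulVec, dotProduct, embeddingMatrix, Matrix.of_apply, map_sum, zsmul_eq_mul,
    map_mul, map_intCast, Complex.re_sum, Complex.im_sum]
  rw [← Finset.sum_add_distrib, Finset.mul_sum]
  refine Finset.sum_congr rfl fun j _ => ?_
  simp
  ring

open Classical in
theorem embeddingMatrix_conj_transpose_mul {K : Type*} [Field K] [NumberField K]
    (x : InfinitePlace K → ℝ) (b : Module.Basis (K →+* ℂ) ℚ K) :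
    ((embeddingMatrix (-x) b.traceDual).submatrix ComplexEmbedding.conjugate id).transpose *
      embeddingMatrix x b = 1 := by
  ext i j
  rw [Matrix.mul_apply]
  simp only [Matrix.transpose_apply, Matrix.submatrix_apply, embeddingMatrix, Matrix.of_apply, id,
    InfinitePlace.mk_conjugate_eq, ComplexEmbedding.conjugate_coe_eq, conj_re, conj_im,
    Pi.neg_apply]
  set a := b.traceDual i
  set c := b j
  have h1 : ∀ φ : K →+* ℂ, Real.exp (-x (InfinitePlace.mk φ)) * ((φ a).re + -(φ a).im) *
      (Real.exp (x (InfinitePlace.mk φ)) * ((φ c).re + (φ c).im)) =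
      (φ (a * c)).re + ((φ a).re * (φ c).im - (φ a).im * (φ c).re) := fun φ => by
    rw [mul_mul_mul_comm, ← Real.exp_add, map_mul, Complex.mul_re]
    simp
    ring
  rw [Finset.sum_congr rfl fun φ _ => h1 φ, Finset.sum_add_distrib]
  have h2 : ∑ φ : K →+* ℂ, ((φ a).re * (φ c).im - (φ a).im * (φ c).re) = 0 := by
    have : ∑ φ : K →+* ℂ, ((φ a).re * (φ c).im - (φ a).im * (φ c).re) =
        -∑ φ : K →+* ℂ, ((φ a).re * (φ c).im - (φ a).im * (φ c).re) := by
      conv_lhs => rw [← sum_comp_conjugate]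
      rw [← Finset.sum_neg_distrib]
      refine Finset.sum_congr rfl fun φ _ => ?_
      simp
      ring
    linarith
  have h3 : ((Algebra.trace ℚ K (a * c) : ℚ) : ℂ) = ∑ φ : K →+* ℂ, φ (a * c) := by
    have := trace_eq_sum_embeddings (K := ℚ) (L := K) ℂ (x := a * c)
    rw [← Equiv.sum_comp (RingHom.equivRatAlgHom (R := K) (S := ℂ))] at this
    simpa using this
  rw [h2, add_zero, ← Complex.re_sum, ← h3]
  simp only [a, c, Module.Basis.trace_traceDual_mul, Matrix.one_apply, eq_comm (a := i)]
  split_ifs <;> simp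

theorem det_embeddingMatrix {K : Type*} [Field K] [NumberField K] [DecidableEq (K →+* ℂ)]
    (x : InfinitePlace K → ℝ) (b : (K →+* ℂ) → K) :
    (embeddingMatrix x b).det = Real.exp (∑ w : InfinitePlace K, (w.mult : ℝ) * x w) *
      (embeddingMatrix 0 b).det := by
  have : embeddingMatrix x b = Matrix.diagonal (fun φ : K →+* ℂ =>
      Real.exp (x (InfinitePlace.mk φ))) * embeddingMatrix 0 b := by
    ext φ j
    simp [embeddingMatrix, Matrix.diagonal_mul]
  rw [this, Matrix.det_mul, Matrix.det_diagonal, ← sum_embeddings_eq_sum_places, Real.exp_sum]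

theorem det_embeddingMatrix_basis {K : Type*} [Field K] [NumberField K] [DecidableEq (K →+* ℂ)]
    (b b' : Module.Basis (K →+* ℂ) ℚ K) :
    (embeddingMatrix 0 b').det = (embeddingMatrix 0 b).det * ((b.det b' : ℚ) : ℝ) := by
  have : embeddingMatrix 0 b' = embeddingMatrix 0 b * (b.toMatrix b').map (algebraMap ℚ ℝ) := by
    ext φ j
    have h := b.sum_toMatrix_smul_self b' j
    simp only [embeddingMatrix, Matrix.of_apply, Matrix.mul_apply, Pi.zero_apply, Real.exp_zero,
      one_mul, Matrix.map_apply]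
    rw [← h, map_sum, Complex.re_sum, Complex.im_sum, ← Finset.sum_add_distrib]
    refine Finset.sum_congr rfl fun i _ => ?_
    rw [Algebra.smul_def, map_mul]
    simp
    ring
  rw [this, Matrix.det_mul, Module.Basis.det_apply]
  congr 1
  exact ((algebraMap ℚ ℝ).map_det _).symm

/-- The theta series of a fractional ideal. -/
noncomputable def idealTheta {K : Type*} [Field K] [NumberField K]
    (J : FractionalIdeal (𝓞 K)⁰ K) (x : InfinitePlace K → ℝ) : ℝ :=
  ∑' α : (J : Submodule (𝓞 K) K), Real.exp (-Real.pi * placeForm x (α : K))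

/-- Integer coordinates on the ℤ-span of a rational basis. -/
noncomputable def intCoordEquiv {K ι : Type*} [Field K] [NumberField K] [Finite ι]
    (b : Module.Basis ι ℚ K) (J : FractionalIdeal (𝓞 K)⁰ K)
    (hb : (J : Submodule (𝓞 K) K).restrictScalars ℤ = Submodule.span ℤ (Set.range b)) :
    (ι → ℤ) ≃ (J : Submodule (𝓞 K) K) :=
  (b.restrictScalars ℤ).equivFun.symm.toEquiv.trans
    (Equiv.subtypeEquivRight fun a => by
      rw [← hb, Submodule.restrictScalars_mem])

theorem intCoordEquiv_apply {K ι : Type*} [Field K] [NumberField K] [Fintype ι]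
    (b : Module.Basis ι ℚ K) (J : FractionalIdeal (𝓞 K)⁰ K)
    (hb : (J : Submodule (𝓞 K) K).restrictScalars ℤ = Submodule.span ℤ (Set.range b))
    (k : ι → ℤ) : (intCoordEquiv b J hb k : K) = ∑ i, k i • b i := by
  have : (intCoordEquiv b J hb k : K) = (((b.restrictScalars ℤ).equivFun.symm k :
    Submodule.span ℤ (Set.range b)) : K) := rfl
  rw [this, Module.Basis.equivFun_symm_apply]
  simp

theorem idealTheta_eq_tsum {K : Type*} [Field K] [NumberField K]
    (b : Module.Basis (K →+* ℂ) ℚ K) (J : FractionalIdeal (𝓞 K)⁰ K)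
    (hb : (J : Submodule (𝓞 K) K).restrictScalars ℤ = Submodule.span ℤ (Set.range b))
    (x : InfinitePlace K → ℝ) :
    idealTheta J x = ∑' k : (K →+* ℂ) → ℤ,
      Real.exp (-Real.pi * sqForm (embeddingMatrix x b) (fun i => (k i : ℝ))) := by
  unfold idealTheta
  rw [← (intCoordEquiv b J hb).tsum_eq]
  refine tsum_congr fun k => ?_
  rw [intCoordEquiv_apply, sqForm_embeddingMatrix]

theorem exists_basis_fractionalIdeal (K : Type*) [Field K] [NumberField K]
    [DecidableEq (K →+* ℂ)] :
    ∃ b₀ : Module.Basis (K →+* ℂ) ℚ K, ∀ J : FractionalIdeal (𝓞 K)⁰ K, J ≠ 0 →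
      ∃ b : Module.Basis (K →+* ℂ) ℚ K,
        (J : Submodule (𝓞 K) K).restrictScalars ℤ = Submodule.span ℤ (Set.range b) ∧
        |b₀.det b| = FractionalIdeal.absNorm J := by
  have hc : Fintype.card (Module.Free.ChooseBasisIndex ℤ (𝓞 K)) = Fintype.card (K →+* ℂ) := by
    rw [Embeddings.card, ← RingOfIntegers.rank, Module.finrank_eq_card_chooseBasisIndex]
  let e₀ : Module.Free.ChooseBasisIndex ℤ (𝓞 K) ≃ (K →+* ℂ) := Fintype.equivOfCardEq hc
  refine ⟨(integralBasis K).reindex e₀, fun J hJ => ?_⟩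
  let J' : (FractionalIdeal (𝓞 K)⁰ K)ˣ := Units.mk0 J hJ
  have hc' : Fintype.card (Module.Free.ChooseBasisIndex ℤ (𝓞 K)) =
      Fintype.card (Module.Free.ChooseBasisIndex ℤ J') := by
    rw [← Module.finrank_eq_card_chooseBasisIndex, ← Module.finrank_eq_card_chooseBasisIndex,
      fractionalIdeal_rank]
  let e : Module.Free.ChooseBasisIndex ℤ (𝓞 K) ≃ Module.Free.ChooseBasisIndex ℤ J' :=
    Fintype.equivOfCardEq hc'
  refine ⟨(basisOfFractionalIdeal K J').reindex (e.symm.trans e₀), ?_, ?_⟩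
  · ext a
    rw [Module.Basis.range_reindex, mem_span_basisOfFractionalIdeal]
    rfl
  · rw [Module.Basis.det_reindex]
    have := det_basisOfFractionalIdeal_eq_absNorm K J' e
    have he : (⇑((basisOfFractionalIdeal K J').reindex (e.symm.trans e₀)) ∘ e₀) =
        ⇑((basisOfFractionalIdeal K J').reindex e.symm) := by
      ext i
      simp
    rw [he]
    exact this

theorem summable_idealTheta {K : Type*} [Field K] [NumberField K]
    (J : FractionalIdeal (𝓞 K)⁰ K) (hJ : J ≠ 0) (x : InfinitePlace K → ℝ) :
    Summable fun α : (J : Submodule (𝓞 K) K) => Real.exp (-Real.pi * placeForm x (α : K)) := by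
  classical
  obtain ⟨b₀, h⟩ := exists_basis_fractionalIdeal K
  obtain ⟨b, hb, -⟩ := h J hJ
  rw [← (intCoordEquiv b J hb).summable_iff]
  have := summable_exp_neg_sqForm (embeddingMatrix_conj_transpose_mul x b)
  refine this.congr fun k => ?_
  simp [intCoordEquiv_apply, sqForm_embeddingMatrix]

theorem exists_idealTheta_functional_equation (K : Type*) [Field K] [NumberField K] :
    ∃ κ : ℝ, 0 < κ ∧ ∀ J : FractionalIdeal (𝓞 K)⁰ K, J ≠ 0 → ∀ x : InfinitePlace K → ℝ,
      idealTheta J x = (κ * (FractionalIdeal.absNorm J : ℝ) *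
        Real.exp (∑ w : InfinitePlace K, (w.mult : ℝ) * x w))⁻¹ *
          idealTheta (FractionalIdeal.dual ℤ ℚ J) (-x) := by
  classical
  obtain ⟨b₀, h⟩ := exists_basis_fractionalIdeal K
  have h0 : (embeddingMatrix 0 b₀).det ≠ 0 := fun h => by
    have := congrArg Matrix.det (embeddingMatrix_conj_transpose_mul 0 b₀)
    rw [Matrix.det_mul, h] at this
    simp at this
  refine ⟨|(embeddingMatrix 0 b₀).det|, abs_pos.2 h0, fun J hJ x => ?_⟩
  obtain ⟨b, hb, hd⟩ := h J hJ
  have hb' : ((FractionalIdeal.dual ℤ ℚ J : FractionalIdeal (𝓞 K)⁰ K) :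
      Submodule (𝓞 K) K).restrictScalars ℤ = Submodule.span ℤ (Set.range b.traceDual) := by
    rw [FractionalIdeal.coe_dual _ _ hJ]
    exact Submodule.traceDual_span_of_basis ℤ _ b hb
  rw [idealTheta_eq_tsum b J hb, tsum_exp_neg_sqForm (embeddingMatrix_conj_transpose_mul x b),
    idealTheta_eq_tsum b.traceDual _ hb', det_embeddingMatrix, det_embeddingMatrix_basis b₀ b]
  congr 1
  · rw [abs_mul, abs_mul, Real.abs_exp, ← hd]
    push_cast
    ring
  · refine tsum_congr fun k => ?_
    congr 2
    unfold sqForm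
    conv_rhs => rw [← sum_comp_conjugate]
    rfl

theorem placeForm_mul_unit {K : Type*} [Field K] [NumberField K] (x : InfinitePlace K → ℝ)
    (u : (𝓞 K)ˣ) (α : K) :
    placeForm x ((u : K) * α) = placeForm (fun w => x w + Real.log (w (u : K))) α := by
  unfold placeForm
  refine Finset.sum_congr rfl fun w _ => ?_
  have hu : 0 < w (u : K) := by
    rw [InfinitePlace.pos_iff]; simp
  rw [map_mul, mul_add, Real.exp_add, two_mul (Real.log _), Real.exp_add, Real.exp_log hu]
  ring

theorem idealTheta_add_log_unit {K : Type*} [Field K] [NumberField K]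
    (J : FractionalIdeal (𝓞 K)⁰ K) (x : InfinitePlace K → ℝ) (u : (𝓞 K)ˣ) :
    idealTheta J (fun w => x w + Real.log (w (u : K))) = idealTheta J x := by
  unfold idealTheta
  rw [← (MulAction.toPerm u : Equiv.Perm (J : Submodule (𝓞 K) K)).tsum_eq
    (fun α => Real.exp (-Real.pi * placeForm x (α : K)))]
  refine tsum_congr fun α => ?_
  rw [← placeForm_mul_unit]
  rfl

theorem exp_mul_placeForm_le {K : Type*} [Field K] [NumberField K] {x : InfinitePlace K → ℝ}
    {R : ℝ} (hx : ∀ w, R ≤ x w) (α : K) :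
    Real.exp (2 * R) * placeForm 0 α ≤ placeForm x α := by
  unfold placeForm
  rw [Finset.mul_sum]
  refine Finset.sum_le_sum fun w _ => ?_
  have : Real.exp (2 * R) ≤ Real.exp (2 * x w) := Real.exp_le_exp.2 (by linarith [hx w])
  have h2 : 0 ≤ (w.mult : ℝ) * w α ^ 2 := by positivity
  simp only [Pi.zero_apply, mul_zero, Real.exp_zero, one_mul]
  nlinarith

theorem placeForm_const {K : Type*} [Field K] [NumberField K] (c : ℝ) (α : K) :
    placeForm (fun _ => c) α = Real.exp (2 * c) * placeForm 0 α := by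
  unfold placeForm
  rw [Finset.mul_sum]
  refine Finset.sum_congr rfl fun w _ => ?_
  simp
  ring

theorem summable_exp_neg_mul_placeForm {K : Type*} [Field K] [NumberField K]
    (J : FractionalIdeal (𝓞 K)⁰ K) (hJ : J ≠ 0) {s : ℝ} (hs : 0 < s) :
    Summable fun α : (J : Submodule (𝓞 K) K) =>
      Real.exp (-Real.pi * (s * placeForm 0 (α : K))) := by
  refine (summable_idealTheta J hJ (fun _ => Real.log s / 2)).congr fun α => ?_
  rw [placeForm_const, mul_div_cancel₀ _ two_ne_zero, Real.exp_log hs]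

theorem exists_le_placeForm {K : Type*} [Field K] [NumberField K]
    (J : FractionalIdeal (𝓞 K)⁰ K) (hJ : J ≠ 0) :
    ∃ a > 0, ∀ α : (J : Submodule (𝓞 K) K), α ≠ 0 → a ≤ placeForm 0 (α : K) := by
  classical
  obtain ⟨b₀, h⟩ := exists_basis_fractionalIdeal K
  obtain ⟨b, hb, -⟩ := h J hJ
  obtain ⟨c, hc, hle⟩ := exists_mul_sum_sq_le_sqForm (embeddingMatrix_conj_transpose_mul 0 b)
  refine ⟨c, hc, fun α hα => ?_⟩
  obtain ⟨k, rfl⟩ := (intCoordEquiv b J hb).surjective α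
  rw [intCoordEquiv_apply, ← sqForm_embeddingMatrix]
  refine le_trans ?_ (hle _)
  have hk : k ≠ 0 := by
    rintro rfl
    apply hα
    apply Subtype.ext
    rw [intCoordEquiv_apply]
    simp
  obtain ⟨i, hi⟩ := Function.ne_iff.1 hk
  have h1 : (1 : ℝ) ≤ (k i : ℝ) ^ 2 := by
    have : (1 : ℤ) ≤ k i ^ 2 := by
      have h0 : k i ≠ 0 := hi
      have : 0 < k i ^ 2 := by positivity
      omega
    exact_mod_cast this
  have h2 : (k i : ℝ) ^ 2 ≤ ∑ j, (k j : ℝ) ^ 2 :=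
    Finset.single_le_sum (f := fun j => (k j : ℝ) ^ 2) (fun j _ => sq_nonneg _) (Finset.mem_univ i)
  nlinarith

theorem continuous_idealTheta {K : Type*} [Field K] [NumberField K]
    (J : FractionalIdeal (𝓞 K)⁰ K) (hJ : J ≠ 0) : Continuous (idealTheta J) := by
  rw [continuous_iff_continuousAt]
  intro x₀
  obtain ⟨R, hR⟩ : ∃ R : ℝ, ∀ w, R < x₀ w := by
    obtain ⟨R, hR⟩ := (Set.finite_range x₀).bddBelow
    exact ⟨R - 1, fun w => by linarith [hR (Set.mem_range_self w)]⟩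
  have hU : IsOpen {x : InfinitePlace K → ℝ | ∀ w, R < x w} := by
    rw [Set.ofPred_forall]
    exact isOpen_iInter_of_finite fun w => isOpen_lt continuous_const (continuous_apply w)
  refine ContinuousOn.continuousAt (s := {x | ∀ w, R < x w}) ?_ (hU.mem_nhds hR)
  refine continuousOn_tsum (u := fun α : (J : Submodule (𝓞 K) K) =>
    Real.exp (-Real.pi * (Real.exp (2 * R) * placeForm 0 (α : K)))) (fun α => ?_)
    (summable_exp_neg_mul_placeForm J hJ (Real.exp_pos _)) fun α x hx => ?_
  · unfold placeForm
    fun_prop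
  · rw [Real.norm_eq_abs, Real.abs_exp, Real.exp_le_exp]
    have := exp_mul_placeForm_le (fun w => (hx w).le) (α : K)
    nlinarith [Real.pi_pos]

theorem one_add_tsum_idealTheta {K : Type*} [Field K] [NumberField K]
    (J : FractionalIdeal (𝓞 K)⁰ K) (hJ : J ≠ 0) (x : InfinitePlace K → ℝ) :
    idealTheta J x = 1 + ∑' α : {α : (J : Submodule (𝓞 K) K) // α ≠ 0},
      Real.exp (-Real.pi * placeForm x (α : K)) := by
  classical
  unfold idealTheta
  have := (summable_idealTheta J hJ x).tsum_subtype_add_tsum_subtype_compl {0}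
  rw [← this, tsum_singleton (0 : (J : Submodule (𝓞 K) K))
    (fun α => Real.exp (-Real.pi * placeForm x (α : K)))]
  congr 1
  simp [placeForm]

theorem exists_idealTheta_sub_one_le {K : Type*} [Field K] [NumberField K]
    (J : FractionalIdeal (𝓞 K)⁰ K) (hJ : J ≠ 0) :
    ∃ C δ : ℝ, 0 < δ ∧ ∀ (R : ℝ) (x : InfinitePlace K → ℝ), 0 ≤ R → (∀ w, R ≤ x w) →
      |idealTheta J x - 1| ≤ C * Real.exp (-(δ * Real.exp (2 * R))) := by
  obtain ⟨a, ha, hle⟩ := exists_le_placeForm J hJ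
  have hs := (summable_exp_neg_mul_placeForm J hJ (s := 1 / 2) (by norm_num)).subtype {α | α ≠ 0}
  refine ⟨∑' α : {α : (J : Submodule (𝓞 K) K) // α ≠ 0},
    Real.exp (-Real.pi * (1 / 2 * placeForm 0 (α : K))), Real.pi * a / 2, by positivity,
    fun R x hR hx => ?_⟩
  rw [one_add_tsum_idealTheta J hJ, add_sub_cancel_left,
    abs_of_nonneg (tsum_nonneg fun _ => (Real.exp_pos _).le), ← tsum_mul_right]
  refine Summable.tsum_le_tsum (fun α => ?_) ((summable_idealTheta J hJ x).subtype _)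
    (hs.mul_right _)
  rw [← Real.exp_add, Real.exp_le_exp]
  have h1 := exp_mul_placeForm_le hx (α : K)
  have h2 := hle α.1 α.2
  have h3 : 1 ≤ Real.exp (2 * R) := Real.one_le_exp (by linarith)
  have h4 : 1 / 2 * placeForm 0 (α : K) + a / 2 * Real.exp (2 * R) ≤ placeForm x (α : K) := by
    nlinarith
  nlinarith [Real.pi_pos]

theorem unitCube_ae_eq_Icc (ι : Type*) [Fintype ι] :
    unitCube ι =ᵐ[MeasureTheory.volume] (Set.Icc 0 1 : Set (ι → ℝ)) := by
  have : unitCube ι = Set.univ.pi fun _ => Set.Ioc (0 : ℝ) 1 := by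
    ext; simp [unitCube]
  rw [this]
  exact MeasureTheory.Measure.univ_pi_Ioc_ae_eq_Icc

theorem setIntegral_unitCube_one_sub {ι : Type*} [Fintype ι] (g : (ι → ℝ) → ℝ) :
    ∫ c in unitCube ι, g (1 - c) = ∫ c in unitCube ι, g c := by
  rw [MeasureTheory.setIntegral_congr_set (unitCube_ae_eq_Icc ι),
    MeasureTheory.setIntegral_congr_set (unitCube_ae_eq_Icc ι)]
  have h :=
    ((MeasureTheory.volume : MeasureTheory.Measure (ι → ℝ)).measurePreserving_sub_left
      1).setIntegral_preimage_emb
    (MeasurableEquiv.subLeft (1 : ι → ℝ)).measurableEmbedding g (Set.Icc 0 1)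
  rw [← h]
  congr 2
  ext c
  simp

/-- The logarithms of the fundamental units, extended linearly. -/
noncomputable def unitLog (K : Type*) [Field K] [NumberField K]
    (c : Fin (Units.rank K) → ℝ) (w : InfinitePlace K) : ℝ :=
  ∑ i, c i * Real.log (w (Units.fundSystem K i : K))

theorem continuous_unitLog (K : Type*) [Field K] [NumberField K] (w : InfinitePlace K) :
    Continuous fun c => unitLog K c w := by
  unfold unitLog
  fun_prop

theorem unitLog_add {K : Type*} [Field K] [NumberField K] (c d : Fin (Units.rank K) → ℝ)
    (w : InfinitePlace K) : unitLog K (c + d) w = unitLog K c w + unitLog K d w := by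
  simp [unitLog, add_mul, Finset.sum_add_distrib]

theorem unitLog_neg {K : Type*} [Field K] [NumberField K] (c : Fin (Units.rank K) → ℝ)
    (w : InfinitePlace K) : unitLog K (-c) w = -unitLog K c w := by
  simp [unitLog]

theorem sum_mult_mul_unitLog {K : Type*} [Field K] [NumberField K]
    (c : Fin (Units.rank K) → ℝ) : ∑ w : InfinitePlace K, (w.mult : ℝ) * unitLog K c w = 0 := by
  unfold unitLog
  simp_rw [Finset.mul_sum]
  rw [Finset.sum_comm]
  refine Finset.sum_eq_zero fun i _ => ?_
  have := Units.sum_mult_mul_log (Units.fundSystem K i)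
  calc _ = c i * ∑ w : InfinitePlace K, (w.mult : ℝ) * Real.log (w (Units.fundSystem K i : K)) := by
        rw [Finset.mul_sum]; exact Finset.sum_congr rfl fun w _ => by ring
    _ = 0 := by rw [this, mul_zero]

theorem unitLog_intCast {K : Type*} [Field K] [NumberField K] (k : Fin (Units.rank K) → ℤ)
    (w : InfinitePlace K) : unitLog K (fun i => (k i : ℝ)) w =
      Real.log (w ((∏ i, Units.fundSystem K i ^ k i : (𝓞 K)ˣ) : K)) := by
  unfold unitLog
  have : ((∏ i, Units.fundSystem K i ^ k i : (𝓞 K)ˣ) : K) =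
      ∏ i, (Units.fundSystem K i : K) ^ k i := by
    rw [Units.coe_prod, map_prod]
    exact Finset.prod_congr rfl fun i _ => Units.coe_zpow _ _
  rw [this, map_prod, Real.log_prod]
  · refine Finset.sum_congr rfl fun i _ => ?_
    rw [map_zpow₀, Real.log_zpow]
  · intro i _
    rw [map_zpow₀]
    exact zpow_ne_zero _ (by simp)

theorem exists_abs_unitLog_le (K : Type*) [Field K] [NumberField K] :
    ∃ B : ℝ, ∀ c ∈ unitCube (Fin (Units.rank K)), ∀ w, |unitLog K c w| ≤ B := by
  refine ⟨∑ w : InfinitePlace K, ∑ i, |Real.log (w (Units.fundSystem K i : K))|, fun c hc w => ?_⟩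
  refine le_trans ?_ (Finset.single_le_sum
    (f := fun w : InfinitePlace K => ∑ i, |Real.log (w (Units.fundSystem K i : K))|)
    (fun w _ => by positivity) (Finset.mem_univ w))
  refine (Finset.abs_sum_le_sum_abs _ _).trans (Finset.sum_le_sum fun i _ => ?_)
  rw [abs_mul, abs_of_pos (hc i).1]
  exact mul_le_of_le_one_left (abs_nonneg _) (hc i).2

/-- The average of the theta series over the unit torus, on the slice of norm `t`. -/
noncomputable def idealThetaMean {K : Type*} [Field K] [NumberField K]
    (J : FractionalIdeal (𝓞 K)⁰ K) (t : ℝ) : ℝ :=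
  ∫ c in unitCube (Fin (Units.rank K)),
    idealTheta J (fun w => Real.log t / Module.finrank ℚ K + unitLog K c w)

theorem continuousOn_idealThetaMean {K : Type*} [Field K] [NumberField K]
    (J : FractionalIdeal (𝓞 K)⁰ K) (hJ : J ≠ 0) :
    ContinuousOn (idealThetaMean J) (Set.Ioi 0) := by
  have h : Continuous fun τ : ℝ => ∫ c in (Set.Icc 0 1 : Set (Fin (Units.rank K) → ℝ)),
      idealTheta J (fun w => τ + unitLog K c w) := by
    refine continuous_parametric_integral_of_continuous (f := fun τ c =>
      idealTheta J (fun w => τ + unitLog K c w)) ?_ isCompact_Icc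
    refine (continuous_idealTheta J hJ).comp (continuous_pi fun w => ?_)
    exact continuous_fst.add ((continuous_unitLog K w).comp continuous_snd)
  have h2 : ContinuousOn (fun t : ℝ => Real.log t / Module.finrank ℚ K) (Set.Ioi 0) :=
    (Real.continuousOn_log.mono fun t ht => (ne_of_gt ht)).div_const _
  refine (h.comp_continuousOn h2).congr fun t _ => ?_
  exact MeasureTheory.setIntegral_congr_set (unitCube_ae_eq_Icc _)

theorem integrableOn_unitCube_idealTheta {K : Type*} [Field K] [NumberField K]
    (J : FractionalIdeal (𝓞 K)⁰ K) (hJ : J ≠ 0) (τ : ℝ) :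
    MeasureTheory.IntegrableOn (fun c => idealTheta J (fun w => τ + unitLog K c w))
      (unitCube (Fin (Units.rank K))) := by
  refine (MeasureTheory.IntegrableOn.congr_set_ae ?_ (unitCube_ae_eq_Icc _))
  refine ContinuousOn.integrableOn_compact isCompact_Icc (Continuous.continuousOn ?_)
  exact (continuous_idealTheta J hJ).comp (continuous_pi fun w =>
    continuous_const.add (continuous_unitLog K w))

theorem idealThetaMean_sub_one_isBigO {K : Type*} [Field K] [NumberField K]
    (J : FractionalIdeal (𝓞 K)⁰ K) (hJ : J ≠ 0) (r : ℝ) :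
    (fun t => idealThetaMean J t - 1) =O[atTop] fun t : ℝ => t ^ r := by
  obtain ⟨B, hB⟩ := exists_abs_unitLog_le K
  obtain ⟨C, δ, hδ, h⟩ := exists_idealTheta_sub_one_le J hJ
  set n : ℝ := Nat.cast (Module.finrank ℚ K) with hn
  have hn0 : 0 < n := by
    rw [hn]; exact_mod_cast Module.finrank_pos
  have h1 : (fun t => idealThetaMean J t - 1) =O[atTop] fun t : ℝ =>
      Real.exp (-((δ * Real.exp (-2 * B)) * t ^ (2 / n))) := by
    refine Asymptotics.IsBigO.of_bound C ?_
    filter_upwards [eventually_ge_atTop (Real.exp (n * B)), eventually_gt_atTop 0] with t ht ht0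
    have hlog : n * B ≤ Real.log t := (Real.le_log_iff_exp_le ht0).2 ht
    have hR : 0 ≤ Real.log t / n - B := by
      rw [sub_nonneg, le_div_iff₀ hn0]; linarith
    have hintg := integrableOn_unitCube_idealTheta J hJ (Real.log t / n)
    have h3 : idealThetaMean J t - 1 = ∫ c in unitCube (Fin (Units.rank K)),
        (idealTheta J (fun w => Real.log t / n + unitLog K c w) - 1) := by
      rw [MeasureTheory.integral_sub hintg (by
        refine MeasureTheory.integrableOn_const ?_
        rw [volume_unitCube]; simp)]
      simp [idealThetaMean, MeasureTheory.measureReal_def, volume_unitCube, hn]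
    rw [h3]
    refine (MeasureTheory.norm_setIntegral_le_of_norm_le_const
      (C := C * Real.exp (-(δ * Real.exp (2 * (Real.log t / n - B)))))
      (by rw [volume_unitCube]; simp) fun c hc => ?_).trans ?_
    · refine h _ _ hR fun w => ?_
      have := (abs_le.1 (hB c hc w)).1
      linarith
    · rw [MeasureTheory.measureReal_def, volume_unitCube, Real.norm_eq_abs, Real.abs_exp]
      simp only [ENNReal.toReal_one, mul_one]
      rw [Real.rpow_def_of_pos ht0, mul_assoc, ← Real.exp_add]
      apply le_of_eq
      congr 5
      ring
  refine h1.trans ?_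
  have h2 := isLittleO_exp_neg_mul_rpow_atTop (a := δ * Real.exp (-2 * B)) (by positivity)
    (r / (2 / n))
  have h3 := h2.comp_tendsto (tendsto_rpow_atTop (y := 2 / n) (by positivity))
  refine (h3.isBigO.congr' ?_ ?_)
  · exact Eventually.of_forall fun t => by simp
  · filter_upwards [eventually_gt_atTop 0] with t ht
    simp only [Function.comp]
    rw [← Real.rpow_mul ht.le]
    congr 1
    field_simp

theorem idealThetaMean_one_div {K : Type*} [Field K] [NumberField K] {κ : ℝ}
    (J : FractionalIdeal (𝓞 K)⁰ K)
    (h : ∀ x : InfinitePlace K → ℝ, idealTheta J x = (κ * (FractionalIdeal.absNorm J : ℝ) *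
        Real.exp (∑ w : InfinitePlace K, (w.mult : ℝ) * x w))⁻¹ *
          idealTheta (FractionalIdeal.dual ℤ ℚ J) (-x)) {t : ℝ} (ht : 0 < t) :
    idealThetaMean J (1 / t) = (κ * (FractionalIdeal.absNorm J : ℝ))⁻¹ * t *
      idealThetaMean (FractionalIdeal.dual ℤ ℚ J) t := by
  have hn0 : (Module.finrank ℚ K : ℝ) ≠ 0 := by exact_mod_cast Module.finrank_pos.ne'
  unfold idealThetaMean
  rw [← setIntegral_unitCube_one_sub (ι := Fin (Units.rank K)) (fun c =>
    idealTheta (FractionalIdeal.dual ℤ ℚ J) fun w => Real.log t / Module.finrank ℚ K + unitLog K c w),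
    ← MeasureTheory.integral_const_mul]
  congr 1
  ext c
  rw [h]
  have hs : ∑ w : InfinitePlace K, (w.mult : ℝ) *
      (Real.log (1 / t) / Module.finrank ℚ K + unitLog K c w) = -Real.log t := by
    simp_rw [mul_add]
    rw [Finset.sum_add_distrib, sum_mult_mul_unitLog, ← Finset.sum_mul, add_zero, ← Nat.cast_sum,
      InfinitePlace.sum_mult_eq, one_div, Real.log_inv]
    field_simp
  rw [hs, Real.exp_neg, Real.exp_log ht, mul_inv, inv_inv]
  congr 1
  rw [← idealTheta_add_log_unit _ _ (∏ i, Units.fundSystem K i ^ (1 : ℤ))]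
  congr 1
  ext w
  rw [← unitLog_intCast (fun _ => (1 : ℤ)), sub_eq_add_neg, unitLog_add, unitLog_neg, one_div,
    Real.log_inv]
  simp only [Pi.neg_apply, Int.cast_one]
  have : unitLog K (fun _ => 1) w = unitLog K 1 w := rfl
  rw [this]
  ring

/-- The pair of averaged theta series attached to a fractional ideal and its dual. -/
noncomputable def idealFEPair {K : Type*} [Field K] [NumberField K] {κ : ℝ} (hκ : 0 < κ)
    (J : FractionalIdeal (𝓞 K)⁰ K) (hJ : J ≠ 0)
    (h : ∀ x : InfinitePlace K → ℝ, idealTheta J x = (κ * (FractionalIdeal.absNorm J : ℝ) *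
        Real.exp (∑ w : InfinitePlace K, (w.mult : ℝ) * x w))⁻¹ *
          idealTheta (FractionalIdeal.dual ℤ ℚ J) (-x)) : WeakFEPair ℂ where
  f t := (idealThetaMean J t : ℂ)
  g t := (idealThetaMean (FractionalIdeal.dual ℤ ℚ J) t : ℂ)
  k := 1
  ε := ((κ * (FractionalIdeal.absNorm J : ℝ))⁻¹ : ℝ)
  f₀ := 1
  g₀ := 1
  hf_int := (Complex.continuous_ofReal.comp_continuousOn
    (continuousOn_idealThetaMean J hJ)).locallyIntegrableOn measurableSet_Ioi
  hg_int := (Complex.continuous_ofReal.comp_continuousOn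
    (continuousOn_idealThetaMean _ (FractionalIdeal.dual_ne_zero ℤ ℚ hJ))).locallyIntegrableOn
      measurableSet_Ioi
  hk := one_pos
  hε := by
    have : FractionalIdeal.absNorm J ≠ 0 := (FractionalIdeal.absNorm_eq_zero_iff).not.2 hJ
    have h2 : (κ * (FractionalIdeal.absNorm J : ℝ))⁻¹ ≠ 0 := by
      have : (FractionalIdeal.absNorm J : ℝ) ≠ 0 := by exact_mod_cast this
      positivity
    exact_mod_cast h2
  h_feq t ht := by
    rw [idealThetaMean_one_div J h ht]
    simp
  hf_top r := by
    have := idealThetaMean_sub_one_isBigO J hJ r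
    refine Asymptotics.IsBigO.congr_left (f₁ := fun t => ((idealThetaMean J t - 1 : ℝ) : ℂ)) ?_
      fun t => by push_cast; rfl
    exact Complex.isBigO_ofReal_left.2 this
  hg_top r := by
    have := idealThetaMean_sub_one_isBigO _ (FractionalIdeal.dual_ne_zero ℤ ℚ hJ) r
    refine Asymptotics.IsBigO.congr_left (f₁ := fun t =>
      ((idealThetaMean (FractionalIdeal.dual ℤ ℚ J) t - 1 : ℝ) : ℂ)) ?_
      fun t => by push_cast; rfl
    exact Complex.isBigO_ofReal_left.2 this

/-- Logarithmic coordinates: a radial coordinate and the unit directions. -/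
noncomputable def logCoord (K : Type*) [Field K] [NumberField K] :
    (ℝ × (Fin (Units.rank K) → ℝ)) →ₗ[ℝ] (InfinitePlace K → ℝ) where
  toFun p w := p.1 + unitLog K p.2 w
  map_add' p q := by
    ext w
    simp [unitLog_add]
    ring
  map_smul' a p := by
    ext w
    simp [unitLog, mul_add, Finset.mul_sum, mul_assoc]

theorem logCoord_injective (K : Type*) [Field K] [NumberField K] :
    Function.Injective (logCoord K) := by
  rw [← LinearMap.ker_eq_bot, LinearMap.ker_eq_bot']
  rintro ⟨τ, c⟩ h
  have hw : ∀ w, τ + unitLog K c w = 0 := fun w => congrFun h w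
  have hn0 : (Module.finrank ℚ K : ℝ) ≠ 0 := by exact_mod_cast Module.finrank_pos.ne'
  have hτ : τ = 0 := by
    have h1 : ∑ w : InfinitePlace K, (w.mult : ℝ) * (τ + unitLog K c w) = 0 :=
      Finset.sum_eq_zero fun w _ => by rw [hw, mul_zero]
    simp_rw [mul_add] at h1
    rw [Finset.sum_add_distrib, sum_mult_mul_unitLog, ← Finset.sum_mul, add_zero, ← Nat.cast_sum,
      InfinitePlace.sum_mult_eq] at h1
    exact (mul_eq_zero.1 h1).resolve_left hn0
  have hli := Units.isMaxRank_fundSystem K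
  rw [Units.IsMaxRank, Fintype.linearIndependent_iff] at hli
  have hc : c = 0 := by
    funext i
    refine hli c ?_ i
    ext w
    have := hw w.1
    rw [hτ, zero_add, unitLog] at this
    rw [Finset.sum_apply]
    simp only [Pi.smul_apply, smul_eq_mul, Units.dirichletUnitTheorem.logEmbedding_component,
      Pi.zero_apply]
    calc _ = (w.1.mult : ℝ) * ∑ i, c i * Real.log (w.1 (Units.fundSystem K i : K)) := by
          rw [Finset.mul_sum]; exact Finset.sum_congr rfl fun i _ => by ring
      _ = 0 := by rw [this, mul_zero]
  rw [hτ, hc]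
  rfl

theorem exists_lintegral_logCoord (K : Type*) [Field K] [NumberField K] :
    ∃ c : ENNReal, c ≠ 0 ∧ c ≠ ⊤ ∧ ∀ g : (InfinitePlace K → ℝ) → ENNReal, Measurable g →
      ∫⁻ τ : ℝ, ∫⁻ y : Fin (Units.rank K) → ℝ, g (fun w => τ + unitLog K y w) = c * ∫⁻ x, g x := by
  have hcard : Module.finrank ℝ (ℝ × (Fin (Units.rank K) → ℝ)) =
      Module.finrank ℝ (InfinitePlace K → ℝ) := by
    have : 0 < Fintype.card (InfinitePlace K) := Fintype.card_pos
    rw [Module.finrank_prod, Module.finrank_self, Module.finrank_fin_fun,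
      Module.finrank_fintype_fun_eq_card,
      Units.rank]
    omega
  let L : (ℝ × (Fin (Units.rank K) → ℝ)) ≃L[ℝ] (InfinitePlace K → ℝ) :=
    (LinearEquiv.ofInjectiveOfFinrankEq (logCoord K) (logCoord_injective K)
      hcard).toContinuousLinearEquiv
  let μ : MeasureTheory.Measure (ℝ × (Fin (Units.rank K) → ℝ)) :=
    (MeasureTheory.volume : MeasureTheory.Measure ℝ).prod
      (MeasureTheory.volume : MeasureTheory.Measure (Fin (Units.rank K) → ℝ))
  have : μ.IsAddHaarMeasure := inferInstance
  have : (MeasureTheory.Measure.map L μ).IsAddHaarMeasure := L.isAddHaarMeasure_map μ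
  have h1 := MeasureTheory.Measure.isAddLeftInvariant_eq_smul (MeasureTheory.Measure.map L μ)
    (MeasureTheory.volume : MeasureTheory.Measure (InfinitePlace K → ℝ))
  have h2 := MeasureTheory.Measure.addHaarScalarFactor_pos_of_isAddHaarMeasure
    (MeasureTheory.Measure.map L μ)
    (MeasureTheory.volume : MeasureTheory.Measure (InfinitePlace K → ℝ))
  set c := (MeasureTheory.Measure.map L μ).addHaarScalarFactor
    (MeasureTheory.volume : MeasureTheory.Measure (InfinitePlace K → ℝ))
  refine ⟨c, by exact_mod_cast h2.ne', ENNReal.coe_ne_top, fun g hg => ?_⟩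
  have h3 : ∫⁻ x, g x ∂(MeasureTheory.Measure.map L μ) = c * ∫⁻ x, g x := by
    rw [h1, MeasureTheory.lintegral_smul_measure]
    rfl
  rw [← h3, MeasureTheory.lintegral_map hg L.continuous.measurable]
  exact (MeasureTheory.lintegral_prod (fun p => g (L p))
    (hg.comp L.continuous.measurable).aemeasurable).symm

/-- Every class of fractional ideals provides a generator of `I * J` for a unique representative
`J`. -/
theorem exists_spanSingleton_eq_mul {K : Type*} [Field K] [NumberField K]
    {J : ClassGroup (𝓞 K) → (FractionalIdeal (𝓞 K)⁰ K)ˣ}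
    (hJ : Function.Bijective fun C => ClassGroup.mk K (J C)) (I : {I : Ideal (𝓞 K) // I ≠ ⊥}) :
    ∃ C : ClassGroup (𝓞 K), ∃ a : K, a ≠ 0 ∧
      FractionalIdeal.spanSingleton (𝓞 K)⁰ a = (I.1 : FractionalIdeal (𝓞 K)⁰ K) * J C := by
  let U : (FractionalIdeal (𝓞 K)⁰ K)ˣ :=
    Units.mk0 (I.1 : FractionalIdeal (𝓞 K)⁰ K) (FractionalIdeal.coeIdeal_ne_zero.2 I.2)
  obtain ⟨C, hC⟩ := hJ.2 (ClassGroup.mk K U)⁻¹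
  have h1 : ClassGroup.mk K (U * J C) = 1 := by
    rw [map_mul]
    exact (congrArg _ hC).trans (mul_inv_cancel _)
  have h2 := (FractionalIdeal.isPrincipal_iff _).1 (ClassGroup.mk_eq_one_iff.1 h1)
  obtain ⟨a, ha⟩ := h2
  refine ⟨C, a, ?_, ?_⟩
  · rintro rfl
    rw [FractionalIdeal.spanSingleton_zero] at ha
    exact (U * J C).ne_zero ha
  · rw [← ha, Units.val_mul]
    rfl

theorem class_eq_of_mem_mul {K : Type*} [Field K] [NumberField K]
    {J : ClassGroup (𝓞 K) → (FractionalIdeal (𝓞 K)⁰ K)ˣ}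
    (hJ : Function.Bijective fun C => ClassGroup.mk K (J C)) {I : Ideal (𝓞 K)} (hI : I ≠ ⊥)
    {C C' : ClassGroup (𝓞 K)} {a a' : K}
    (h : FractionalIdeal.spanSingleton (𝓞 K)⁰ a = (I : FractionalIdeal (𝓞 K)⁰ K) * J C)
    (h' : FractionalIdeal.spanSingleton (𝓞 K)⁰ a' = (I : FractionalIdeal (𝓞 K)⁰ K) * J C') :
    C = C' := by
  let U : (FractionalIdeal (𝓞 K)⁰ K)ˣ :=
    Units.mk0 (I : FractionalIdeal (𝓞 K)⁰ K) (FractionalIdeal.coeIdeal_ne_zero.2 hI)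
  have key : ∀ (D : ClassGroup (𝓞 K)) (b : K),
      FractionalIdeal.spanSingleton (𝓞 K)⁰ b = (I : FractionalIdeal (𝓞 K)⁰ K) * J D →
      ClassGroup.mk K (J D) = (ClassGroup.mk K U)⁻¹ := by
    intro D b hb
    rw [eq_inv_iff_mul_eq_one, mul_comm, ← map_mul, ClassGroup.mk_eq_one_iff,
      FractionalIdeal.isPrincipal_iff]
    exact ⟨b, by rw [hb]; rfl⟩
  exact hJ.1 ((key C a h).trans (key C' a' h').symm)

theorem spanSingleton_eq_iff_exists_unit {K : Type*} [Field K] [NumberField K] {a b : K}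
    (ha : a ≠ 0) :
    FractionalIdeal.spanSingleton (𝓞 K)⁰ a = FractionalIdeal.spanSingleton (𝓞 K)⁰ b ↔
      ∃ u : (𝓞 K)ˣ, (u : K) * a = b := by
  constructor
  · intro h
    have hb : b ≠ 0 := by
      rintro rfl
      rw [FractionalIdeal.spanSingleton_zero] at h
      exact ha (FractionalIdeal.spanSingleton_eq_zero_iff.1 h)
    have h1 : a ∈ FractionalIdeal.spanSingleton (𝓞 K)⁰ b :=
      h ▸ FractionalIdeal.mem_spanSingleton_self _ a
    have h2 : b ∈ FractionalIdeal.spanSingleton (𝓞 K)⁰ a :=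
      h ▸ FractionalIdeal.mem_spanSingleton_self _ b
    obtain ⟨x, hx⟩ := (FractionalIdeal.mem_spanSingleton _).1 h1
    obtain ⟨y, hy⟩ := (FractionalIdeal.mem_spanSingleton _).1 h2
    rw [Algebra.smul_def] at hx hy
    have hxy : x * y = 1 := by
      apply FaithfulSMul.algebraMap_injective (𝓞 K) K
      rw [map_mul, map_one]
      apply mul_right_cancel₀ ha
      rw [mul_assoc, hy, hx, one_mul]
    exact ⟨⟨y, x, by rw [mul_comm, hxy], hxy⟩, hy⟩
  · rintro ⟨u, rfl⟩
    apply le_antisymm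
    · rw [FractionalIdeal.spanSingleton_le_iff_mem, FractionalIdeal.mem_spanSingleton]
      refine ⟨((u⁻¹ : (𝓞 K)ˣ) : 𝓞 K), ?_⟩
      rw [Algebra.smul_def, ← mul_assoc]
      change ((((u⁻¹ : (𝓞 K)ˣ) : 𝓞 K)) : K) * ((u : 𝓞 K) : K) * a = a
      rw [← map_mul, Units.inv_mul, map_one, one_mul]
    · rw [FractionalIdeal.spanSingleton_le_iff_mem, FractionalIdeal.mem_spanSingleton]
      exact ⟨(u : 𝓞 K), Algebra.smul_def _ _⟩

/-- Nonzero elements of a system of representatives of the class group correspond to pairs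
of a nonzero integral ideal and a unit. -/
theorem exists_ideal_units_equiv {K : Type*} [Field K] [NumberField K]
    {J : ClassGroup (𝓞 K) → (FractionalIdeal (𝓞 K)⁰ K)ˣ}
    (hJ : Function.Bijective fun C => ClassGroup.mk K (J C)) :
    ∃ (a : {I : Ideal (𝓞 K) // I ≠ ⊥} → K) (e : {I : Ideal (𝓞 K) // I ≠ ⊥} × (𝓞 K)ˣ ≃
        Σ C : ClassGroup (𝓞 K),
          {α : ((J C : FractionalIdeal (𝓞 K)⁰ K) : Submodule (𝓞 K) K) // α ≠ 0}),
      (∀ I, a I ≠ 0) ∧ (∀ p, (((e p).2.1 : _) : K) = (p.2 : K) * a p.1) ∧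
      ∀ p, FractionalIdeal.spanSingleton (𝓞 K)⁰ (a p.1) =
        (p.1.1 : FractionalIdeal (𝓞 K)⁰ K) * J (e p).1 := by
  choose C a ha h using exists_spanSingleton_eq_mul hJ
  have hspan : ∀ (I : {I : Ideal (𝓞 K) // I ≠ ⊥}) (u : (𝓞 K)ˣ),
      FractionalIdeal.spanSingleton (𝓞 K)⁰ ((u : K) * a I) =
        (I.1 : FractionalIdeal (𝓞 K)⁰ K) * J (C I) := fun I u => by
    rw [← h I]
    exact ((spanSingleton_eq_iff_exists_unit (ha I)).2 ⟨u, rfl⟩).symm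
  have hmem : ∀ (I : {I : Ideal (𝓞 K) // I ≠ ⊥}) (u : (𝓞 K)ˣ),
      (u : K) * a I ∈ ((J (C I) : FractionalIdeal (𝓞 K)⁰ K) : Submodule (𝓞 K) K) := by
    intro I u
    change _ ∈ (J (C I) : FractionalIdeal (𝓞 K)⁰ K)
    rw [← FractionalIdeal.spanSingleton_le_iff_mem, hspan]
    exact mul_le_of_le_one_left' FractionalIdeal.coeIdeal_le_one
  have hu0 : ∀ u : (𝓞 K)ˣ, (u : K) ≠ 0 := fun u => by
    simp
  let f : {I : Ideal (𝓞 K) // I ≠ ⊥} × (𝓞 K)ˣ → Σ C : ClassGroup (𝓞 K),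
      {α : ((J C : FractionalIdeal (𝓞 K)⁰ K) : Submodule (𝓞 K) K) // α ≠ 0} := fun p =>
    ⟨C p.1, ⟨⟨(p.2 : K) * a p.1, hmem p.1 p.2⟩, fun hz =>
      mul_ne_zero (hu0 p.2) (ha p.1) (congrArg Subtype.val hz)⟩⟩
  have hval : ∀ p q, f p = f q → C p.1 = C q.1 ∧ (p.2 : K) * a p.1 = (q.2 : K) * a q.1 := by
    intro p q hpq
    refine ⟨congrArg Sigma.fst hpq, ?_⟩
    exact congrArg (fun z : Σ C : ClassGroup (𝓞 K),
      {α : ((J C : FractionalIdeal (𝓞 K)⁰ K) : Submodule (𝓞 K) K) // α ≠ 0} => (z.2.1 : K)) hpq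
  have hbij : Function.Bijective f := by
    constructor
    · rintro ⟨I, u⟩ ⟨I', u'⟩ hpq
      obtain ⟨h1, h2⟩ := hval _ _ hpq
      dsimp only at h1 h2
      have h3 : (I.1 : FractionalIdeal (𝓞 K)⁰ K) = I'.1 := by
        have h4 := hspan I u
        rw [h2, hspan I' u', h1] at h4
        exact (mul_right_cancel₀ (J (C I')).ne_zero h4).symm
      have h5 : I = I' := Subtype.ext (FractionalIdeal.coeIdeal_injective h3)
      subst h5
      have h6 := mul_right_cancel₀ (ha I) h2
      have h7 : u = u' := by
        apply Units.ext
        exact RingOfIntegers.ext h6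
      rw [h7]
    · rintro ⟨D, ⟨⟨α, hα⟩, hα0⟩⟩
      have hα0' : α ≠ 0 := fun hz => hα0 (Subtype.ext hz)
      have hle : FractionalIdeal.spanSingleton (𝓞 K)⁰ α * ((J D)⁻¹ : (FractionalIdeal (𝓞 K)⁰ K)ˣ)
          ≤ 1 := by
        have : FractionalIdeal.spanSingleton (𝓞 K)⁰ α ≤ (J D : FractionalIdeal (𝓞 K)⁰ K) :=
          FractionalIdeal.spanSingleton_le_iff_mem.2 hα
        calc _ ≤ (J D : FractionalIdeal (𝓞 K)⁰ K) * ((J D)⁻¹ : (FractionalIdeal (𝓞 K)⁰ K)ˣ) :=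
              mul_le_mul_left this _
          _ = 1 := Units.mul_inv _
      obtain ⟨I, hI⟩ := FractionalIdeal.le_one_iff_exists_coeIdeal.1 hle
      have hI2 : FractionalIdeal.spanSingleton (𝓞 K)⁰ α =
          (I : FractionalIdeal (𝓞 K)⁰ K) * J D := by
        rw [hI, mul_assoc, Units.inv_mul, mul_one]
      have hI0 : I ≠ ⊥ := by
        rintro rfl
        rw [FractionalIdeal.coeIdeal_bot, zero_mul, FractionalIdeal.spanSingleton_eq_zero_iff] at hI2
        exact hα0' hI2
      have hD : C ⟨I, hI0⟩ = D := class_eq_of_mem_mul hJ hI0 (h ⟨I, hI0⟩) hI2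
      subst hD
      obtain ⟨u, hu⟩ := (spanSingleton_eq_iff_exists_unit (ha ⟨I, hI0⟩)).1
        ((h ⟨I, hI0⟩).trans hI2.symm)
      refine ⟨(⟨I, hI0⟩, u), ?_⟩
      simp only [f, hu]
  exact ⟨a, Equiv.ofBijective f hbij, ha, fun p => rfl, fun p => h p.1⟩

theorem units_equiv_torsion_prod (K : Type*) [Field K] [NumberField K] :
    ∃ e : Units.torsion K × (Fin (Units.rank K) → ℤ) ≃ (𝓞 K)ˣ,
      ∀ p, e p = p.1 * ∏ i, Units.fundSystem K i ^ p.2 i := by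
  refine ⟨Equiv.ofBijective (fun p => (p.1 : (𝓞 K)ˣ) * ∏ i, Units.fundSystem K i ^ p.2 i) ?_,
    fun p => rfl⟩
  constructor
  · intro p q h
    exact (Units.exist_unique_eq_mul_prod K _).unique rfl h
  · intro u
    obtain ⟨p, hp, -⟩ := Units.exist_unique_eq_mul_prod K u
    exact ⟨p, hp.symm⟩

theorem prod_rpow_eq_absNorm {K : Type*} [Field K] [NumberField K] {a : K} (ha : a ≠ 0) :
    Real.exp (∑ w : InfinitePlace K, (w.mult : ℝ) * Real.log (w a)) =
      (FractionalIdeal.absNorm (FractionalIdeal.spanSingleton (𝓞 K)⁰ a) : ℝ) := by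
  rw [FractionalIdeal.absNorm_span_singleton, ← InfinitePlace.prod_eq_abs_norm, Real.exp_sum]
  refine Finset.prod_congr rfl fun w _ => ?_
  rw [mul_comm, Real.exp_mul, Real.exp_log (InfinitePlace.pos_iff.2 ha), Real.rpow_natCast]

/-- The archimedean kernel in logarithmic coordinates. -/
noncomputable def archKernel (K : Type*) [Field K] [NumberField K] (σ : ℝ)
    (x : InfinitePlace K → ℝ) : ℝ :=
  Real.exp (σ * (∑ w, (w.mult : ℝ) * x w) - Real.pi * ∑ w, (w.mult : ℝ) * Real.exp (2 * x w))

theorem continuous_archKernel (K : Type*) [Field K] [NumberField K] (σ : ℝ) :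
    Continuous (archKernel K σ) := by
  unfold archKernel
  fun_prop

theorem exp_mul_exp_placeForm {K : Type*} [Field K] [NumberField K] (σ : ℝ)
    (x : InfinitePlace K → ℝ) {α : K} (hα : α ≠ 0) :
    Real.exp (σ * ∑ w : InfinitePlace K, (w.mult : ℝ) * x w) *
        Real.exp (-Real.pi * placeForm x α) =
      Real.exp (∑ w : InfinitePlace K, (w.mult : ℝ) * Real.log (w α)) ^ (-σ) *
        archKernel K σ (fun w => x w + Real.log (w α)) := by
  have h1 : placeForm x α =
      ∑ w : InfinitePlace K, (w.mult : ℝ) * Real.exp (2 * (x w + Real.log (w α))) := by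
    refine Finset.sum_congr rfl fun w _ => ?_
    rw [mul_add, Real.exp_add, mul_comm 2 (Real.log _), Real.exp_mul (Real.log _),
      Real.exp_log (InfinitePlace.pos_iff.2 hα), Real.rpow_two]
  rw [archKernel, h1, ← Real.exp_mul, ← Real.exp_add, ← Real.exp_add]
  congr 1
  simp_rw [mul_add (Nat.cast _)]
  rw [Finset.sum_add_distrib]
  ring

theorem integral_exp_kernel {a r : ℝ} (ha : 0 < a) (hr : 0 < r) :
    MeasureTheory.Integrable (fun y : ℝ => Real.exp (2 * a * y - r * Real.exp (2 * y))) ∧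
      ∫ y : ℝ, Real.exp (2 * a * y - r * Real.exp (2 * y)) = (1 / 2) * ((1 / r) ^ a * Real.Gamma a)
    := by
  have himg : (fun y : ℝ => Real.exp (2 * y)) '' Set.univ = Set.Ioi 0 := by
    ext u
    constructor
    · rintro ⟨y, -, rfl⟩
      exact Real.exp_pos _
    · intro hu
      exact ⟨Real.log u / 2, trivial, by
        change Real.exp (2 * (Real.log u / 2)) = u
        rw [mul_div_cancel₀ _ two_ne_zero, Real.exp_log hu]⟩
  have hder : ∀ y ∈ (Set.univ : Set ℝ), HasDerivWithinAt (fun y : ℝ => Real.exp (2 * y))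
      (Real.exp (2 * y) * 2) Set.univ y := fun y _ => by
    have h : HasDerivAt (fun y : ℝ => Real.exp (2 * y)) (Real.exp (2 * y) * 2) y := by
      simpa using ((hasDerivAt_id y).const_mul 2).exp
    exact h.hasDerivWithinAt
  have hinj : Set.InjOn (fun y : ℝ => Real.exp (2 * y)) Set.univ := fun y _ z _ h => by
    have := Real.exp_injective h
    linarith
  have hfun : (fun y : ℝ => |Real.exp (2 * y) * 2| •
      (Real.exp (2 * y) ^ (a - 1) * Real.exp (-(r * Real.exp (2 * y))))) =
      fun y => 2 * Real.exp (2 * a * y - r * Real.exp (2 * y)) := by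
    ext y
    rw [abs_of_pos (by positivity), smul_eq_mul, ← Real.exp_mul, mul_comm (Real.exp (2 * y)) 2,
      mul_assoc, ← Real.exp_add, ← Real.exp_add]
    congr 2
    ring
  have h0 : MeasureTheory.IntegrableOn (fun t : ℝ => t ^ (a - 1) * Real.exp (-(r * t)))
      (Set.Ioi 0) := by
    have := Real.integral_rpow_mul_exp_neg_mul_Ioi ha hr
    by_contra hc
    rw [MeasureTheory.integral_undef hc] at this
    have h2 := Real.Gamma_pos_of_pos ha
    have : 0 < (1 / r) ^ a * Real.Gamma a := by positivity
    linarith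
  have h1 := MeasureTheory.integrableOn_image_iff_integrableOn_abs_deriv_smul MeasurableSet.univ
    hder hinj (fun t : ℝ => t ^ (a - 1) * Real.exp (-(r * t)))
  have h2 := MeasureTheory.integral_image_eq_integral_abs_deriv_smul MeasurableSet.univ
    hder hinj (fun t : ℝ => t ^ (a - 1) * Real.exp (-(r * t)))
  rw [himg] at h1 h2
  rw [hfun, MeasureTheory.integrableOn_univ] at h1
  rw [hfun, MeasureTheory.setIntegral_univ, Real.integral_rpow_mul_exp_neg_mul_Ioi ha hr,
    MeasureTheory.integral_const_mul] at h2
  refine ⟨?_, by rw [h2]; ring⟩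
  have h3 := (h1.1 h0).const_mul (1 / 2)
  refine h3.congr (Eventually.of_forall fun y => ?_)
  dsimp only
  ring

theorem lintegral_archKernel (K : Type*) [Field K] [NumberField K] {σ : ℝ} (hσ : 0 < σ) :
    ∫⁻ x, ENNReal.ofReal (archKernel K σ x) = ENNReal.ofReal (∏ w : InfinitePlace K,
      ((1 / 2) * ((1 / (Real.pi * w.mult)) ^ (σ * w.mult / 2) * Real.Gamma (σ * w.mult / 2)))) := by
  have hm : ∀ w : InfinitePlace K, (0 : ℝ) < w.mult := fun w => by
    exact_mod_cast InfinitePlace.mult_pos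
  have hprod : ∀ x, archKernel K σ x = ∏ w : InfinitePlace K,
      Real.exp (2 * (σ * w.mult / 2) * x w - (Real.pi * w.mult) * Real.exp (2 * x w)) := by
    intro x
    rw [archKernel, ← Real.exp_sum, Finset.sum_sub_distrib, Finset.mul_sum, Finset.mul_sum]
    congr 2 <;> refine Finset.sum_congr rfl fun w _ => by ring
  have hk := fun w : InfinitePlace K => integral_exp_kernel
    (a := σ * w.mult / 2) (r := Real.pi * w.mult) (by have := hm w; positivity)
    (by have := hm w; positivity)
  have hintg : MeasureTheory.Integrable (archKernel K σ) := by
    rw [funext hprod]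
    exact MeasureTheory.Integrable.fintype_prod (fun w => (hk w).1)
  rw [← MeasureTheory.ofReal_integral_eq_lintegral_ofReal hintg
    (Eventually.of_forall fun x => (Real.exp_pos _).le)]
  congr 1
  simp_rw [hprod]
  rw [MeasureTheory.integral_fintype_prod_volume_eq_prod (fun (w : InfinitePlace K) (y : ℝ) =>
    Real.exp (2 * (σ * w.mult / 2) * y - (Real.pi * w.mult) * Real.exp (2 * y)))]
  exact Finset.prod_congr rfl fun w _ => (hk w).2

theorem ofReal_idealThetaMean_sub_one {K : Type*} [Field K] [NumberField K]
    (J : FractionalIdeal (𝓞 K)⁰ K) (hJ : J ≠ 0) (t : ℝ) :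
    ENNReal.ofReal (idealThetaMean J t - 1) = ∫⁻ c in unitCube (Fin (Units.rank K)),
      ∑' α : {α : (J : Submodule (𝓞 K) K) // α ≠ 0}, ENNReal.ofReal (Real.exp (-Real.pi *
        placeForm (fun w => Real.log t / Module.finrank ℚ K + unitLog K c w) (α : K))) := by
  have hintg := integrableOn_unitCube_idealTheta J hJ (Real.log t / Module.finrank ℚ K)
  have hconst : MeasureTheory.IntegrableOn (fun _ => (1 : ℝ)) (unitCube (Fin (Units.rank K))) := by
    refine MeasureTheory.integrableOn_const ?_
    rw [volume_unitCube]; simp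
  have h3 : idealThetaMean J t - 1 = ∫ c in unitCube (Fin (Units.rank K)),
      (idealTheta J (fun w => Real.log t / Module.finrank ℚ K + unitLog K c w) - 1) := by
    rw [MeasureTheory.integral_sub hintg hconst]
    simp [idealThetaMean, MeasureTheory.measureReal_def, volume_unitCube]
  have h4 : ∀ c, idealTheta J (fun w => Real.log t / Module.finrank ℚ K + unitLog K c w) - 1 =
      ∑' α : {α : (J : Submodule (𝓞 K) K) // α ≠ 0}, Real.exp (-Real.pi *
        placeForm (fun w => Real.log t / Module.finrank ℚ K + unitLog K c w) (α : K)) := fun c => by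
    rw [one_add_tsum_idealTheta J hJ, add_sub_cancel_left]
  have hsub : MeasureTheory.IntegrableOn (fun c =>
      idealTheta J (fun w => Real.log t / Module.finrank ℚ K + unitLog K c w) - 1)
      (unitCube (Fin (Units.rank K))) := hintg.sub hconst
  rw [h3, MeasureTheory.ofReal_integral_eq_lintegral_ofReal hsub
    (Eventually.of_forall fun c => ?_)]
  · refine MeasureTheory.lintegral_congr fun c => ?_
    rw [h4, ENNReal.ofReal_tsum_of_nonneg (fun α => (Real.exp_pos _).le)]
    exact (summable_idealTheta J hJ _).subtype _
  · change 0 ≤ _ - (1 : ℝ)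
    rw [h4]
    exact tsum_nonneg fun α => (Real.exp_pos _).le

theorem countable_fractionalIdeal {K : Type*} [Field K] [NumberField K]
    (J : FractionalIdeal (𝓞 K)⁰ K) : Countable {α : (J : Submodule (𝓞 K) K) // α ≠ 0} := by
  have : Countable (J : Submodule (𝓞 K) K) := by
    have : Countable K := by
      have := Module.Finite.of_basis (Module.finBasis ℚ K)
      exact (Module.finBasis ℚ K).equivFun.toEquiv.countable_iff.2 inferInstance
    infer_instance
  infer_instance

theorem measurable_archKernel_add (K : Type*) [Field K] [NumberField K] (σ : ℝ)
    (v : InfinitePlace K → ℝ) :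
    Measurable fun p : ℝ × (Fin (Units.rank K) → ℝ) => ENNReal.ofReal
      (archKernel K σ (fun w => p.1 + unitLog K p.2 w + v w)) := by
  refine ENNReal.measurable_ofReal.comp (Continuous.measurable ?_)
  refine (continuous_archKernel K σ).comp (continuous_pi fun w => ?_)
  have := (continuous_unitLog K w).comp (continuous_snd (X := ℝ))
  exact (continuous_fst.add this).add continuous_const

theorem exp_mul_exp_placeForm_unitLog {K : Type*} [Field K] [NumberField K] (σ τ : ℝ)
    (c : Fin (Units.rank K) → ℝ) {α : K} (hα : α ≠ 0) :
    ENNReal.ofReal (Real.exp (σ * (Module.finrank ℚ K * τ))) * ENNReal.ofReal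
        (Real.exp (-Real.pi * placeForm (fun w => τ + unitLog K c w) α)) =
      ENNReal.ofReal
          (Real.exp (∑ w : InfinitePlace K, (w.mult : ℝ) * Real.log (w α)) ^ (-σ)) *
        ENNReal.ofReal (archKernel K σ (fun w => τ + unitLog K c w + Real.log (w α))) := by
  rw [← ENNReal.ofReal_mul (Real.exp_pos _).le,
    ← ENNReal.ofReal_mul (Real.rpow_nonneg (Real.exp_pos _).le _),
    ← exp_mul_exp_placeForm σ _ hα]
  have : ∑ w : InfinitePlace K, (w.mult : ℝ) * (τ + unitLog K c w) = Module.finrank ℚ K * τ := by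
    simp_rw [mul_add (Nat.cast (InfinitePlace.mult _) : ℝ)]
    rw [Finset.sum_add_distrib, sum_mult_mul_unitLog, ← Finset.sum_mul, add_zero, ← Nat.cast_sum,
      InfinitePlace.sum_mult_eq]
  rw [this]

theorem mul_lintegral_tsum_eq {ι X : Type*} [Countable ι] [MeasurableSpace X]
    {μ : MeasureTheory.Measure X} {E : ENNReal} (hE : E ≠ ⊤) {a : ι → ENNReal} (ha : ∀ i, a i ≠ ⊤)
    {f g : ι → X → ENNReal} (hg : ∀ i, Measurable (g i)) (h : ∀ i x, E * f i x = a i * g i x) :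
    E * ∫⁻ x, ∑' i, f i x ∂μ = ∑' i, a i * ∫⁻ x, g i x ∂μ := by
  simp_rw [← MeasureTheory.lintegral_const_mul' _ _ hE, ← ENNReal.tsum_mul_left, h]
  rw [MeasureTheory.lintegral_tsum fun i => ((hg i).const_mul _).aemeasurable]
  exact tsum_congr fun i => MeasureTheory.lintegral_const_mul' _ _ (ha i)

theorem ofReal_mul_idealThetaMean_exp {K : Type*} [Field K] [NumberField K]
    (J : FractionalIdeal (𝓞 K)⁰ K) (hJ : J ≠ 0) (σ τ : ℝ) :
    ENNReal.ofReal (Real.exp (σ * (Module.finrank ℚ K * τ))) *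
        ENNReal.ofReal (idealThetaMean J (Real.exp (Module.finrank ℚ K * τ)) - 1) =
      ∑' α : {α : (J : Submodule (𝓞 K) K) // α ≠ 0},
        ENNReal.ofReal
          (Real.exp (∑ w : InfinitePlace K, (w.mult : ℝ) * Real.log (w (α : K))) ^ (-σ)) *
        ∫⁻ c in unitCube (Fin (Units.rank K)), ENNReal.ofReal
          (archKernel K σ (fun w => τ + unitLog K c w + Real.log (w (α : K)))) := by
  have hn : (Module.finrank ℚ K : ℝ) ≠ 0 := by exact_mod_cast Module.finrank_pos.ne'
  have hc := countable_fractionalIdeal J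
  rw [ofReal_idealThetaMean_sub_one J hJ, Real.log_exp, mul_div_cancel_left₀ _ hn]
  have key := mul_lintegral_tsum_eq
    (μ := MeasureTheory.volume.restrict (unitCube (Fin (Units.rank K))))
    (E := ENNReal.ofReal (Real.exp (σ * (Module.finrank ℚ K * τ)))) ENNReal.ofReal_ne_top
    (fun (α : {α : (J : Submodule (𝓞 K) K) // α ≠ 0}) => ENNReal.ofReal_ne_top)
    (fun α => (measurable_archKernel_add K σ _).comp (measurable_prodMk_left (x := τ)))
    fun α c => exp_mul_exp_placeForm_unitLog σ τ c (α := (α : K)) fun h => α.2 (Subtype.ext h)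
  refine Eq.trans ?_ (key.trans ?_)
  · rfl
  · refine tsum_congr fun α => ?_
    congr 1

/-- The Mellin transform of the averaged theta series, as a series over the nonzero elements. -/
theorem lintegral_idealThetaMean {K : Type*} [Field K] [NumberField K]
    (J : FractionalIdeal (𝓞 K)⁰ K) (hJ : J ≠ 0) (σ : ℝ) :
    ∫⁻ t in Set.Ioi (0 : ℝ), ENNReal.ofReal (t ^ (σ - 1)) *
        ENNReal.ofReal (idealThetaMean J t - 1) =
      (Module.finrank ℚ K : ENNReal) * ∑' α : {α : (J : Submodule (𝓞 K) K) // α ≠ 0},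
        ENNReal.ofReal
          (Real.exp (∑ w : InfinitePlace K, (w.mult : ℝ) * Real.log (w (α : K))) ^ (-σ)) *
        ∫⁻ τ : ℝ, ∫⁻ c in unitCube (Fin (Units.rank K)), ENNReal.ofReal
          (archKernel K σ (fun w => τ + unitLog K c w + Real.log (w (α : K)))) := by
  have hn : (0 : ℝ) < Module.finrank ℚ K := by exact_mod_cast Module.finrank_pos
  set n : ℝ := Nat.cast (Module.finrank ℚ K) with hn_def
  have himg : (fun y : ℝ => Real.exp (n * y)) '' Set.univ = Set.Ioi 0 := by
    ext u
    constructor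
    · rintro ⟨y, -, rfl⟩
      exact Real.exp_pos _
    · intro hu
      exact ⟨Real.log u / n, trivial, by
        change Real.exp (n * (Real.log u / n)) = u
        rw [mul_div_cancel₀ _ hn.ne', Real.exp_log hu]⟩
  have hder : ∀ y ∈ (Set.univ : Set ℝ), HasDerivWithinAt (fun y : ℝ => Real.exp (n * y))
      (Real.exp (n * y) * n) Set.univ y := fun y _ => by
    have h : HasDerivAt (fun y : ℝ => Real.exp (n * y)) (Real.exp (n * y) * n) y := by
      simpa using ((hasDerivAt_id y).const_mul n).exp
    exact h.hasDerivWithinAt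
  have hinj : Set.InjOn (fun y : ℝ => Real.exp (n * y)) Set.univ := fun y _ z _ h => by
    have := Real.exp_injective h
    exact mul_left_cancel₀ hn.ne' this
  rw [← himg, MeasureTheory.lintegral_image_eq_lintegral_abs_deriv_mul MeasurableSet.univ hder hinj,
    MeasureTheory.Measure.restrict_univ]
  have hc := countable_fractionalIdeal J
  have hpt : ∀ τ : ℝ, ENNReal.ofReal |Real.exp (n * τ) * n| *
      (ENNReal.ofReal (Real.exp (n * τ) ^ (σ - 1)) *
        ENNReal.ofReal (idealThetaMean J (Real.exp (n * τ)) - 1)) =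
      (Module.finrank ℚ K : ENNReal) * ∑' α : {α : (J : Submodule (𝓞 K) K) // α ≠ 0},
        ENNReal.ofReal
          (Real.exp (∑ w : InfinitePlace K, (w.mult : ℝ) * Real.log (w (α : K))) ^ (-σ)) *
        ∫⁻ c in unitCube (Fin (Units.rank K)), ENNReal.ofReal
          (archKernel K σ (fun w => τ + unitLog K c w + Real.log (w (α : K)))) := by
    intro τ
    have h1 : ENNReal.ofReal |Real.exp (n * τ) * n| *
        ENNReal.ofReal (Real.exp (n * τ) ^ (σ - 1)) =
        (Module.finrank ℚ K : ENNReal) * ENNReal.ofReal (Real.exp (σ * (n * τ))) := by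
      rw [← ENNReal.ofReal_natCast, ← ENNReal.ofReal_mul (abs_nonneg _), ← ENNReal.ofReal_mul hn.le,
        abs_of_pos (by positivity), ← Real.exp_mul, mul_comm _ n, mul_assoc, ← Real.exp_add]
      congr 3
      ring
    rw [← mul_assoc, h1, mul_assoc, ofReal_mul_idealThetaMean_exp J hJ]
  rw [MeasureTheory.lintegral_congr hpt, MeasureTheory.lintegral_const_mul' _ _
    (ENNReal.natCast_ne_top _), MeasureTheory.lintegral_tsum]
  · congr 2
    ext α
    rw [MeasureTheory.lintegral_const_mul' _ _ ENNReal.ofReal_ne_top]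
  · intro α
    exact ((measurable_archKernel_add K σ _).lintegral_prod_right'.const_mul _).aemeasurable

theorem tsum_units_lintegral_archKernel {K : Type*} [Field K] [NumberField K] {c : ENNReal}
    (hc : ∀ g : (InfinitePlace K → ℝ) → ENNReal, Measurable g →
      ∫⁻ τ : ℝ, ∫⁻ y : Fin (Units.rank K) → ℝ, g (fun w => τ + unitLog K y w) = c * ∫⁻ x, g x)
    (σ : ℝ) {a : K} (ha : a ≠ 0) :
    ∑' u : (𝓞 K)ˣ, ∫⁻ τ : ℝ, ∫⁻ y in unitCube (Fin (Units.rank K)), ENNReal.ofReal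
        (archKernel K σ (fun w => τ + unitLog K y w + Real.log (w ((u : K) * a)))) =
      ENat.card (Units.torsion K) * (c * ∫⁻ x, ENNReal.ofReal (archKernel K σ x)) := by
  obtain ⟨e, he⟩ := units_equiv_torsion_prod K
  have hlog : ∀ (p : Units.torsion K × (Fin (Units.rank K) → ℤ)) (w : InfinitePlace K),
      Real.log (w ((e p : K) * a)) = unitLog K (fun i => (p.2 i : ℝ)) w + Real.log (w a) := by
    intro p w
    have h1 : w ((p.1 : (𝓞 K)ˣ) : K) = 1 := (Units.mem_torsion K).1 p.1.2 w
    have h0 : w ((∏ i, Units.fundSystem K i ^ p.2 i : (𝓞 K)ˣ) : K) ≠ 0 :=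
      (map_ne_zero w).2 ((map_ne_zero_iff _ RingOfIntegers.coe_injective).2 (Units.ne_zero _))
    rw [unitLog_intCast, he, ← Real.log_mul h0 ((map_ne_zero w).2 ha)]
    congr 1
    rw [map_mul, Units.val_mul, map_mul, map_mul, h1, one_mul]
  rw [← e.tsum_eq, ENNReal.tsum_prod']
  simp_rw [hlog]
  rw [ENNReal.tsum_const]
  congr 1
  have hmeas := measurable_archKernel_add K σ (fun w => Real.log (w a))
  have hsh : ∫⁻ x, ENNReal.ofReal (archKernel K σ x) =
      ∫⁻ x : InfinitePlace K → ℝ, ENNReal.ofReal (archKernel K σ (fun w => x w + Real.log (w a))) :=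
    (MeasureTheory.lintegral_add_right_eq_self
      (fun x => ENNReal.ofReal (archKernel K σ x)) (fun w => Real.log (w a))).symm
  rw [hsh, ← hc (fun x : InfinitePlace K → ℝ =>
    ENNReal.ofReal (archKernel K σ (fun w => x w + Real.log (w a))))
    (ENNReal.measurable_ofReal.comp (Continuous.measurable ((continuous_archKernel K σ).comp
      (continuous_pi fun w => (continuous_apply w).add continuous_const))))]
  rw [← MeasureTheory.lintegral_tsum]
  · refine MeasureTheory.lintegral_congr fun τ => ?_
    rw [lintegral_eq_tsum_unitCube]
    refine tsum_congr fun k => MeasureTheory.lintegral_congr fun y => ?_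
    congr 2
    ext w
    change _ = τ + unitLog K (y + fun i => (k i : ℝ)) w + _
    rw [unitLog_add]
    ring
  · intro k
    have := measurable_archKernel_add K σ
      (fun w => unitLog K (fun i => (k i : ℝ)) w + Real.log (w a))
    exact this.lintegral_prod_right'.aemeasurable

/-- Summing the Mellin transforms of the averaged theta series over the ideal classes produces
the Dedekind zeta series. -/
theorem exists_sum_lintegral_idealThetaMean (K : Type*) [Field K] [NumberField K] :
    ∃ c : ENNReal, c ≠ 0 ∧ c ≠ ⊤ ∧
      ∀ J : ClassGroup (𝓞 K) → (FractionalIdeal (𝓞 K)⁰ K)ˣ,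
      (Function.Bijective fun C => ClassGroup.mk K (J C)) → ∀ σ : ℝ,
      ∑ C, ENNReal.ofReal ((FractionalIdeal.absNorm (J C : FractionalIdeal (𝓞 K)⁰ K) : ℝ) ^ σ) *
        ∫⁻ t in Set.Ioi (0 : ℝ), ENNReal.ofReal (t ^ (σ - 1)) *
          ENNReal.ofReal (idealThetaMean (J C : FractionalIdeal (𝓞 K)⁰ K) t - 1) =
      c * (∫⁻ x, ENNReal.ofReal (archKernel K σ x)) *
        ∑' I : {I : Ideal (𝓞 K) // I ≠ ⊥}, ENNReal.ofReal ((Ideal.absNorm I.1 : ℝ) ^ (-σ)) := by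
  obtain ⟨c, hc0, hct, hc⟩ := exists_lintegral_logCoord K
  have hn : (Module.finrank ℚ K : ENNReal) ≠ 0 := by exact_mod_cast Module.finrank_pos.ne'
  have ht0 : (ENat.card (Units.torsion K) : ENNReal) ≠ 0 := by
    rw [ENat.card_eq_coe_natCard]
    simp [Nat.card_pos.ne']
  have htt : (ENat.card (Units.torsion K) : ENNReal) ≠ ⊤ := by
    rw [ENat.card_eq_coe_natCard]
    simp
  refine ⟨(Module.finrank ℚ K : ENNReal) * (ENat.card (Units.torsion K) * c),
    mul_ne_zero hn (mul_ne_zero ht0 hc0),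
    ENNReal.mul_ne_top (ENNReal.natCast_ne_top _) (ENNReal.mul_ne_top htt hct), fun J hJ σ => ?_⟩
  obtain ⟨a, e, ha, he, hae⟩ := exists_ideal_units_equiv hJ
  set Φ : K → ENNReal := fun α => ∫⁻ τ : ℝ, ∫⁻ y in unitCube (Fin (Units.rank K)), ENNReal.ofReal
        (archKernel K σ (fun w => τ + unitLog K y w + Real.log (w α))) with hΦ
  set N : K → ℝ := fun α => Real.exp (∑ w : InfinitePlace K, (w.mult : ℝ) * Real.log (w α)) with hN
  set F : (Σ C : ClassGroup (𝓞 K),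
      {α : ((J C : FractionalIdeal (𝓞 K)⁰ K) : Submodule (𝓞 K) K) // α ≠ 0}) → ENNReal :=
    fun z => ENNReal.ofReal
      ((FractionalIdeal.absNorm (J z.1 : FractionalIdeal (𝓞 K)⁰ K) : ℝ) ^ σ) *
      (ENNReal.ofReal (N (z.2.1 : K) ^ (-σ)) * Φ (z.2.1 : K)) with hF
  have h1 : ∀ C, ENNReal.ofReal
      ((FractionalIdeal.absNorm (J C : FractionalIdeal (𝓞 K)⁰ K) : ℝ) ^ σ) *
        ∫⁻ t in Set.Ioi (0 : ℝ), ENNReal.ofReal (t ^ (σ - 1)) *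
          ENNReal.ofReal (idealThetaMean (J C : FractionalIdeal (𝓞 K)⁰ K) t - 1) =
      (Module.finrank ℚ K : ENNReal) *
        ∑' α : {α : ((J C : FractionalIdeal (𝓞 K)⁰ K) : Submodule (𝓞 K) K) // α ≠ 0},
          F ⟨C, α⟩ := by
    intro C
    rw [lintegral_idealThetaMean _ (J C).ne_zero, mul_left_comm, ← ENNReal.tsum_mul_left]
  have h2 : ∀ p, F (e p) =
      ENNReal.ofReal ((Ideal.absNorm p.1.1 : ℝ) ^ (-σ)) * Φ ((p.2 : K) * a p.1) := by
    intro p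
    have hu0 : (p.2 : K) ≠ 0 := by simp
    have h3 : N ((p.2 : K) * a p.1) = (Ideal.absNorm p.1.1 : ℝ) *
        (FractionalIdeal.absNorm (J (e p).1 : FractionalIdeal (𝓞 K)⁰ K) : ℝ) := by
      rw [hN]
      dsimp only
      rw [prod_rpow_eq_absNorm (mul_ne_zero hu0 (ha p.1)),
        ← (spanSingleton_eq_iff_exists_unit (ha p.1)).2 ⟨p.2, rfl⟩, hae, map_mul,
        FractionalIdeal.coeIdeal_absNorm]
      push_cast
      rfl
    have hJpos : (0 : ℝ) < FractionalIdeal.absNorm (J (e p).1 : FractionalIdeal (𝓞 K)⁰ K) := by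
      have h0 := FractionalIdeal.absNorm_nonneg (J (e p).1 : FractionalIdeal (𝓞 K)⁰ K)
      have h1 : FractionalIdeal.absNorm (J (e p).1 : FractionalIdeal (𝓞 K)⁰ K) ≠ 0 :=
        (FractionalIdeal.absNorm_eq_zero_iff).not.2 (J (e p).1).ne_zero
      exact_mod_cast lt_of_le_of_ne h0 h1.symm
    rw [hF]
    dsimp only
    rw [he, h3, ← mul_assoc, ← ENNReal.ofReal_mul (Real.rpow_nonneg hJpos.le _),
      Real.mul_rpow (Nat.cast_nonneg _) hJpos.le, mul_left_comm, ← Real.rpow_add hJpos,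
      add_neg_cancel, Real.rpow_zero, mul_one]
  rw [Finset.sum_congr rfl fun C _ => h1 C, ← Finset.mul_sum, ← tsum_fintype (L := .unconditional _),
    ← ENNReal.tsum_sigma', ← e.tsum_eq, tsum_congr h2, ENNReal.tsum_prod']
  simp_rw [ENNReal.tsum_mul_left]
  rw [tsum_congr fun I => by rw [tsum_units_lintegral_archKernel hc σ (ha I)], ENNReal.tsum_mul_right]
  ring

theorem idealThetaMean_sub_one_nonneg {K : Type*} [Field K] [NumberField K]
    (J : FractionalIdeal (𝓞 K)⁰ K) (hJ : J ≠ 0) (t : ℝ) : 0 ≤ idealThetaMean J t - 1 := by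
  have hintg := integrableOn_unitCube_idealTheta J hJ (Real.log t / Module.finrank ℚ K)
  have hconst : MeasureTheory.IntegrableOn (fun _ => (1 : ℝ)) (unitCube (Fin (Units.rank K))) := by
    refine MeasureTheory.integrableOn_const ?_
    rw [volume_unitCube]; simp
  have h3 : idealThetaMean J t - 1 = ∫ c in unitCube (Fin (Units.rank K)),
      (idealTheta J (fun w => Real.log t / Module.finrank ℚ K + unitLog K c w) - 1) := by
    rw [MeasureTheory.integral_sub hintg hconst]
    simp [idealThetaMean, MeasureTheory.measureReal_def, volume_unitCube]
  rw [h3]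
  refine MeasureTheory.integral_nonneg fun c => ?_
  change 0 ≤ _ - (1 : ℝ)
  rw [one_add_tsum_idealTheta J hJ, add_sub_cancel_left]
  exact tsum_nonneg fun α => (Real.exp_pos _).le

theorem weakFEPair_Λ_eq_toReal {K : Type*} [Field K] [NumberField K]
    {J : FractionalIdeal (𝓞 K)⁰ K} (hJ : J ≠ 0) {P : WeakFEPair ℂ}
    (hPf : P.f = fun t => (idealThetaMean J t : ℂ)) (hP0 : P.f₀ = 1) (hPk : P.k = 1) {σ : ℝ}
    (hσ : 1 < σ) :
    (∫⁻ t in Set.Ioi (0 : ℝ), ENNReal.ofReal (t ^ (σ - 1)) *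
      ENNReal.ofReal (idealThetaMean J t - 1)) ≠ ⊤ ∧
    P.Λ σ = ((∫⁻ t in Set.Ioi (0 : ℝ), ENNReal.ofReal (t ^ (σ - 1)) *
      ENNReal.ofReal (idealThetaMean J t - 1)).toReal : ℂ) := by
  obtain ⟨h1, h2⟩ := P.hasMellin (s := (σ : ℂ)) (by rw [hPk, Complex.ofReal_re]; exact hσ)
  have heq : ∀ t ∈ Set.Ioi (0 : ℝ), (t : ℂ) ^ ((σ : ℂ) - 1) • (P.f t - P.f₀) =
      ((t ^ (σ - 1) * (idealThetaMean J t - 1) : ℝ) : ℂ) := by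
    intro t ht
    rw [hPf, hP0, smul_eq_mul]
    push_cast
    rw [Complex.ofReal_cpow (le_of_lt ht)]
    push_cast
    rfl
  rw [MellinConvergent, MeasureTheory.integrableOn_congr_fun heq measurableSet_Ioi] at h1
  rw [mellin, MeasureTheory.setIntegral_congr_fun measurableSet_Ioi heq, integral_complex_ofReal] at h2
  have h3 : MeasureTheory.IntegrableOn (fun t : ℝ => t ^ (σ - 1) * (idealThetaMean J t - 1))
      (Set.Ioi 0) := by
    have := h1.re
    simpa [MeasureTheory.IntegrableOn] using this
  have h4 : ∀ᵐ t ∂(MeasureTheory.volume.restrict (Set.Ioi (0 : ℝ))),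
      0 ≤ t ^ (σ - 1) * (idealThetaMean J t - 1) := by
    refine (MeasureTheory.ae_restrict_iff' measurableSet_Ioi).2 (Eventually.of_forall fun t ht => ?_)
    exact mul_nonneg (Real.rpow_nonneg (le_of_lt ht) _)
      (idealThetaMean_sub_one_nonneg J hJ t)
  have h5 : ∫⁻ t in Set.Ioi (0 : ℝ), ENNReal.ofReal (t ^ (σ - 1)) *
      ENNReal.ofReal (idealThetaMean J t - 1) =
      ENNReal.ofReal (∫ t in Set.Ioi (0 : ℝ), t ^ (σ - 1) * (idealThetaMean J t - 1)) := by
    rw [MeasureTheory.ofReal_integral_eq_lintegral_ofReal h3 h4]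
    refine MeasureTheory.setLIntegral_congr_fun measurableSet_Ioi fun t ht => ?_
    exact (ENNReal.ofReal_mul (Real.rpow_nonneg (le_of_lt ht) _)).symm
  refine ⟨by rw [h5]; exact ENNReal.ofReal_ne_top, ?_⟩
  rw [h5, ENNReal.toReal_ofReal (MeasureTheory.integral_nonneg_of_ae h4), ← h2]

/-- The inverse of the archimedean factor of the Dedekind zeta function. -/
noncomputable def archGammaInv (K : Type*) [Field K] [NumberField K] (s : ℂ) : ℂ :=
  ∏ w : InfinitePlace K,
    (((Real.pi * w.mult : ℝ) : ℂ) ^ (s * w.mult / 2) * (Complex.Gamma (s * w.mult / 2))⁻¹)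

theorem differentiable_archGammaInv (K : Type*) [Field K] [NumberField K] :
    Differentiable ℂ (archGammaInv K) := by
  refine Differentiable.fun_finsetProd fun w _ => ?_
  have hm : ((Real.pi * w.mult : ℝ) : ℂ) ≠ 0 := by
    have : w.mult ≠ 0 := InfinitePlace.mult_pos.ne'
    exact_mod_cast mul_ne_zero Real.pi_ne_zero (by exact_mod_cast this)
  refine Differentiable.mul (fun s => ?_) ?_
  · refine DifferentiableAt.const_cpow (by fun_prop) (Or.inl hm)
  · exact Complex.differentiable_one_div_Gamma.comp
      (f := fun s : ℂ => s * (w.mult : ℂ) / 2) (by fun_prop)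

theorem archGammaInv_mul_toReal (K : Type*) [Field K] [NumberField K] {σ : ℝ} (hσ : 0 < σ) :
    archGammaInv K σ * ((∫⁻ x, ENNReal.ofReal (archKernel K σ x)).toReal : ℂ) =
      ∏ _w : InfinitePlace K, (1 / 2 : ℂ) := by
  have hm : ∀ w : InfinitePlace K, (0 : ℝ) < w.mult := fun w => by
    exact_mod_cast InfinitePlace.mult_pos
  have hpos : ∀ w : InfinitePlace K, 0 < Real.Gamma (σ * w.mult / 2) := fun w =>
    Real.Gamma_pos_of_pos (by have := hm w; positivity)
  rw [lintegral_archKernel K hσ, ENNReal.toReal_ofReal (Finset.prod_nonneg fun w _ => by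
    have := hm w
    have := hpos w
    positivity), archGammaInv, Complex.ofReal_prod, ← Finset.prod_mul_distrib]
  refine Finset.prod_congr rfl fun w _ => ?_
  have hr : (0 : ℝ) < Real.pi * w.mult := by have := hm w; positivity
  have h1 : ((Real.pi * w.mult : ℝ) : ℂ) ^ ((σ : ℂ) * w.mult / 2) =
      (((Real.pi * w.mult) ^ (σ * w.mult / 2) : ℝ) : ℂ) := by
    rw [Complex.ofReal_cpow hr.le]
    push_cast
    rfl
  have h2 : Complex.Gamma ((σ : ℂ) * w.mult / 2) = (Real.Gamma (σ * w.mult / 2) : ℂ) := by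
    rw [← Complex.Gamma_ofReal]
    push_cast
    rfl
  rw [h1, h2, one_div (Real.pi * (w.mult : ℝ)), Real.inv_rpow hr.le]
  have h3 : (Real.pi * (w.mult : ℝ)) ^ (σ * w.mult / 2) ≠ 0 := (Real.rpow_pos_of_pos hr _).ne'
  have h4 := (hpos w).ne'
  have h5 : (Real.pi * (w.mult : ℝ)) ^ (σ * w.mult / 2) * (Real.Gamma (σ * w.mult / 2))⁻¹ *
      (1 / 2 * (((Real.pi * (w.mult : ℝ)) ^ (σ * w.mult / 2))⁻¹ * Real.Gamma (σ * w.mult / 2))) =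
      1 / 2 := by
    generalize Real.Gamma (σ * w.mult / 2) = G at h4
    field_simp
  have h6 := congrArg (fun x : ℝ => (x : ℂ)) h5
  push_cast at h6
  push_cast
  exact h6

/-- The completed partial zeta functions sum to the Dedekind zeta function. -/
theorem exists_archGammaInv_mul_sum_Λ (K : Type*) [Field K] [NumberField K] :
    ∃ c : ℂ, c ≠ 0 ∧ ∀ (ζK : ℂ → ℂ), (∀ s : ℂ, s ≠ 1 → DifferentiableAt ℂ ζK s) →
      (∀ s : ℂ, 1 < s.re → HasSum (fun I : {I : Ideal (𝓞 K) // I ≠ ⊥} =>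
        ((Ideal.absNorm I.1 : ℕ) : ℂ) ^ (-s)) (ζK s)) →
      ∀ J : ClassGroup (𝓞 K) → (FractionalIdeal (𝓞 K)⁰ K)ˣ,
      (Function.Bijective fun C => ClassGroup.mk K (J C)) → ∀ P : ClassGroup (𝓞 K) → WeakFEPair ℂ,
      (∀ C, (P C).f = fun t => (idealThetaMean (J C : FractionalIdeal (𝓞 K)⁰ K) t : ℂ)) →
      (∀ C, (P C).f₀ = 1) → (∀ C, (P C).k = 1) →
      ∀ s : ℂ, s ≠ 0 → s ≠ 1 → archGammaInv K s *
        ∑ C, ((FractionalIdeal.absNorm (J C : FractionalIdeal (𝓞 K)⁰ K) : ℝ) : ℂ) ^ s * (P C).Λ s =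
          c * ζK s := by
  obtain ⟨c, hc0, hct, hc⟩ := exists_sum_lintegral_idealThetaMean K
  refine ⟨c.toReal * ∏ _w : InfinitePlace K, (1 / 2 : ℂ), mul_ne_zero ?_ ?_, ?_⟩
  · exact_mod_cast (ENNReal.toReal_pos hc0 hct).ne'
  · exact Finset.prod_ne_zero_iff.2 fun w _ => by norm_num
  intro ζK hζ_an hζ_ser J hJ P hPf hP0 hPk
  have hN : ∀ C, (0 : ℝ) < FractionalIdeal.absNorm (J C : FractionalIdeal (𝓞 K)⁰ K) := fun C => by
    have h0 := FractionalIdeal.absNorm_nonneg (J C : FractionalIdeal (𝓞 K)⁰ K)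
    have h1 : FractionalIdeal.absNorm (J C : FractionalIdeal (𝓞 K)⁰ K) ≠ 0 :=
      (FractionalIdeal.absNorm_eq_zero_iff).not.2 (J C).ne_zero
    exact_mod_cast lt_of_le_of_ne h0 h1.symm
  have hreal : ∀ σ : ℝ, 1 < σ → archGammaInv K σ *
      ∑ C, ((FractionalIdeal.absNorm (J C : FractionalIdeal (𝓞 K)⁰ K) : ℝ) : ℂ) ^ (σ : ℂ) *
        (P C).Λ σ = c.toReal * (∏ _w : InfinitePlace K, (1 / 2 : ℂ)) * ζK σ := by
    intro σ hσ
    have h1 := congrArg ENNReal.toReal (hc J hJ σ)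
    rw [ENNReal.toReal_sum fun C _ => ENNReal.mul_ne_top ENNReal.ofReal_ne_top
      (weakFEPair_Λ_eq_toReal (J C).ne_zero (hPf C) (hP0 C) (hPk C) hσ).1, ENNReal.toReal_mul,
      ENNReal.toReal_mul] at h1
    have h2 : ∑ C, ((FractionalIdeal.absNorm (J C : FractionalIdeal (𝓞 K)⁰ K) : ℝ) : ℂ) ^ (σ : ℂ) *
        (P C).Λ σ = ((∑ C, (ENNReal.ofReal
          ((FractionalIdeal.absNorm (J C : FractionalIdeal (𝓞 K)⁰ K) : ℝ) ^ σ) *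
        ∫⁻ t in Set.Ioi (0 : ℝ), ENNReal.ofReal (t ^ (σ - 1)) *
          ENNReal.ofReal (idealThetaMean (J C : FractionalIdeal (𝓞 K)⁰ K) t - 1)).toReal : ℝ) : ℂ)
        := by
      rw [Complex.ofReal_sum]
      refine Finset.sum_congr rfl fun C _ => ?_
      rw [(weakFEPair_Λ_eq_toReal (J C).ne_zero (hPf C) (hP0 C) (hPk C) hσ).2, ENNReal.toReal_mul,
        ENNReal.toReal_ofReal (Real.rpow_nonneg (hN C).le _), Complex.ofReal_mul,
        Complex.ofReal_cpow (hN C).le]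
    have h3 : ζK σ = ((∑' I : {I : Ideal (𝓞 K) // I ≠ ⊥},
        ENNReal.ofReal ((Ideal.absNorm I.1 : ℝ) ^ (-σ))).toReal : ℂ) := by
      have h4 := hζ_ser σ (by simpa using hσ)
      have h5 : ∀ I : {I : Ideal (𝓞 K) // I ≠ ⊥}, ((Ideal.absNorm I.1 : ℕ) : ℂ) ^ (-(σ : ℂ)) =
          (((Ideal.absNorm I.1 : ℝ) ^ (-σ) : ℝ) : ℂ) := fun I => by
        rw [Complex.ofReal_cpow (Nat.cast_nonneg _)]
        push_cast
        rfl
      simp_rw [h5] at h4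
      have h6 := Complex.hasSum_re h4
      simp only [Complex.ofReal_re] at h6
      rw [← ENNReal.ofReal_tsum_of_nonneg (fun I => Real.rpow_nonneg (Nat.cast_nonneg _) _)
        h6.summable, ENNReal.toReal_ofReal (tsum_nonneg fun I => Real.rpow_nonneg
        (Nat.cast_nonneg _) _), Complex.ofReal_tsum, h4.tsum_eq]
    rw [h2, h1, h3, ← archGammaInv_mul_toReal K (one_pos.trans hσ)]
    push_cast
    ring
  set U : Set ℂ := {0, 1}ᶜ with hU
  have hUo : IsOpen U := (Set.toFinite _).isClosed.isOpen_compl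
  have hUc : IsPreconnected U :=
    ((Set.toFinite ({0, 1} : Set ℂ)).countable.isConnected_compl_of_one_lt_rank
      (by rw [Complex.rank_real_complex]; exact Nat.one_lt_ofNat)).isPreconnected
  have hmem : ∀ s ∈ U, s ≠ 0 ∧ s ≠ 1 := fun s hs => by
    simpa [hU, not_or] using hs
  have hf : AnalyticOnNhd ℂ (fun s => archGammaInv K s *
      ∑ C, ((FractionalIdeal.absNorm (J C : FractionalIdeal (𝓞 K)⁰ K) : ℝ) : ℂ) ^ s * (P C).Λ s)
      U := by
    refine DifferentiableOn.analyticOnNhd (fun s hs => DifferentiableAt.differentiableWithinAt ?_) hUo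
    refine (differentiable_archGammaInv K s).mul (DifferentiableAt.fun_sum fun C _ => ?_)
    refine DifferentiableAt.mul ?_ ?_
    · exact differentiableAt_id.const_cpow (Or.inl (by exact_mod_cast (hN C).ne'))
    · exact (P C).differentiableAt_Λ (Or.inl (hmem s hs).1)
        (Or.inl (by rw [hPk]; simpa using (hmem s hs).2))
  have hg : AnalyticOnNhd ℂ
      (fun s => c.toReal * (∏ _w : InfinitePlace K, (1 / 2 : ℂ)) * ζK s) U :=
    DifferentiableOn.analyticOnNhd (fun s hs => DifferentiableAt.differentiableWithinAt
      ((hζ_an s (hmem s hs).2).const_mul _)) hUo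
  have h2 : (2 : ℂ) ∈ U := by simp [hU]
  have hfreq : ∃ᶠ s in 𝓝[≠] (2 : ℂ), archGammaInv K s *
      ∑ C, ((FractionalIdeal.absNorm (J C : FractionalIdeal (𝓞 K)⁰ K) : ℝ) : ℂ) ^ s * (P C).Λ s =
      c.toReal * (∏ _w : InfinitePlace K, (1 / 2 : ℂ)) * ζK s := by
    have ht : Tendsto (fun σ : ℝ => (σ : ℂ)) (𝓝[>] 2) (𝓝[≠] (2 : ℂ)) := by
      refine tendsto_nhdsWithin_iff.2 ⟨?_, ?_⟩
      · have := (Complex.continuous_ofReal.tendsto 2).mono_left (nhdsWithin_le_nhds (s := Set.Ioi 2))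
        simpa using this
      · filter_upwards [self_mem_nhdsWithin] with σ hσ h
        have h7 : (σ : ℂ) = ((2 : ℝ) : ℂ) := by simpa using h
        rw [Complex.ofReal_inj] at h7
        exact (ne_of_gt hσ) h7
    refine ht.frequently (Eventually.frequently ?_)
    filter_upwards [self_mem_nhdsWithin] with σ hσ
    exact hreal σ (lt_trans one_lt_two hσ)
  intro s h0 h1
  exact hf.eqOn_of_preconnected_of_frequently_eq hg hUc h2 hfreq (by simp [hU, h0, h1])

theorem norm_mellin_le_of_re_mem_Icc {f : ℝ → ℂ} {a b : ℝ} (ha : MellinConvergent f a)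
    (hb : MellinConvergent f b) :
    ∃ M : ℝ, ∀ s : ℂ, s.re ∈ Set.Icc a b → ‖mellin f s‖ ≤ M := by
  refine ⟨∫ t in Set.Ioi (0 : ℝ), (‖(t : ℂ) ^ ((a : ℂ) - 1) • f t‖ +
    ‖(t : ℂ) ^ ((b : ℂ) - 1) • f t‖), fun s hs => ?_⟩
  refine MeasureTheory.norm_integral_le_of_norm_le (ha.norm.add hb.norm) ?_
  refine (MeasureTheory.ae_restrict_iff' measurableSet_Ioi).2 (Eventually.of_forall fun t ht => ?_)
  have ht : 0 < t := ht
  simp only [norm_smul, Complex.norm_cpow_eq_rpow_re_of_pos ht, Complex.sub_re, Complex.one_re,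
    Complex.ofReal_re]
  rw [← add_mul]
  refine mul_le_mul_of_nonneg_right ?_ (norm_nonneg _)
  have h1 := Real.rpow_nonneg ht.le (a - 1)
  have h2 := Real.rpow_nonneg ht.le (b - 1)
  rcases le_total t 1 with h | h
  · have := Real.rpow_le_rpow_of_exponent_ge ht h (sub_le_sub_right hs.1 1)
    linarith
  · have := Real.rpow_le_rpow_of_exponent_le h (sub_le_sub_right hs.2 1)
    linarith

theorem WeakFEPair.exists_norm_Λ_le (P : WeakFEPair ℂ) (a b : ℝ) :
    ∃ M : ℝ, ∀ s : ℂ, s.re ∈ Set.Icc a b → 1 ≤ |s.im| → ‖P.Λ s‖ ≤ M := by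
  have hm : ∀ s : ℂ, MellinConvergent P.f_modif s := fun s =>
    (P.isStrongFEPair_toStrongFEPair.hasMellin s).1
  obtain ⟨M, hM⟩ := norm_mellin_le_of_re_mem_Icc (hm a) (hm b)
  refine ⟨M + ‖P.f₀‖ + ‖P.ε‖ * ‖P.g₀‖, fun s hs him => ?_⟩
  have h1 : 1 ≤ ‖s‖ := him.trans (Complex.abs_im_le_norm s)
  have h2 : 1 ≤ ‖(P.k : ℂ) - s‖ := by
    refine him.trans ?_
    simpa using Complex.abs_im_le_norm ((P.k : ℂ) - s)
  have h3 : ‖(1 / s) • P.f₀‖ ≤ ‖P.f₀‖ := by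
    rw [norm_smul, norm_div, norm_one]
    refine mul_le_of_le_one_left (norm_nonneg _) ?_
    rw [div_le_one (by linarith)]; exact h1
  have h4 : ‖(P.ε / (P.k - s)) • P.g₀‖ ≤ ‖P.ε‖ * ‖P.g₀‖ := by
    rw [norm_smul, norm_div]
    refine mul_le_mul_of_nonneg_right ?_ (norm_nonneg _)
    exact div_le_self (norm_nonneg _) h2
  have h5 := hM s hs
  calc ‖P.Λ s‖ ≤ ‖P.Λ₀ s‖ + ‖(1 / s) • P.f₀‖ + ‖(P.ε / (P.k - s)) • P.g₀‖ :=
        (norm_sub_le _ _).trans (add_le_add_left (norm_sub_le _ _) _)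
    _ ≤ _ := add_le_add (add_le_add h5 h3) h4

theorem archGammaInv_ne_zero {K : Type*} [Field K] [NumberField K] {s : ℂ}
    (hs : 0 < s.re ∨ s.im ≠ 0) : archGammaInv K s ≠ 0 := by
  refine Finset.prod_ne_zero_iff.2 fun w _ => ?_
  have hm : (0 : ℝ) < w.mult := by exact_mod_cast InfinitePlace.mult_pos
  have hre : (s * w.mult / 2).re = s.re * w.mult / 2 := by
    simp
  have him : (s * w.mult / 2).im = s.im * w.mult / 2 := by
    simp
  refine mul_ne_zero ?_ (inv_ne_zero (Complex.Gamma_ne_zero fun m hsm => ?_))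
  · rw [Ne, Complex.cpow_eq_zero_iff, not_and_or]
    refine Or.inl ?_
    exact_mod_cast (mul_pos Real.pi_pos hm).ne'
  · rw [hsm] at hre him
    simp only [Complex.neg_re, Complex.natCast_re, Complex.neg_im, Complex.natCast_im] at hre him
    rcases hs with hs | hs
    · have : 0 < s.re * w.mult / 2 := by positivity
      have : (0 : ℝ) ≤ m := Nat.cast_nonneg m
      linarith
    · have : s.im * w.mult / 2 ≠ 0 := by
        have := hm.ne'
        positivity
      exact this (by rw [← him]; simp)

theorem exists_classGroup_rep (K : Type*) [Field K] [NumberField K] :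
    ∃ J J' : ClassGroup (𝓞 K) → (FractionalIdeal (𝓞 K)⁰ K)ˣ,
      (Function.Bijective fun C => ClassGroup.mk K (J C)) ∧
      (Function.Bijective fun C => ClassGroup.mk K (J' C)) ∧
      ∀ C, (J' C : FractionalIdeal (𝓞 K)⁰ K) = FractionalIdeal.dual ℤ ℚ (J C) := by
  have hsurj : Function.Surjective (ClassGroup.mk (R := 𝓞 K) K) := by
    intro C
    exact ClassGroup.induction K (P := fun C => ∃ I, ClassGroup.mk K I = C)
      (fun I => ⟨I, rfl⟩) C
  choose J hJ using hsurj
  let D : (FractionalIdeal (𝓞 K)⁰ K)ˣ :=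
    Units.mk0 (FractionalIdeal.dual ℤ ℚ 1) (FractionalIdeal.dual_ne_zero ℤ ℚ one_ne_zero)
  refine ⟨J, fun C => D * (J C)⁻¹, ?_, ?_, fun C => ?_⟩
  · simp only [hJ]; exact Function.bijective_id
  · simp only [map_mul, map_inv, hJ]
    exact (Equiv.bijective ((Equiv.inv _).trans (Equiv.mulLeft (ClassGroup.mk K D))))
  · rw [FractionalIdeal.dual_eq_mul_inv ℤ ℚ]
    simp [D]

/-- The functional equation of the Dedekind zeta function. -/
theorem exists_completed_dedekindZeta {K : Type*} [Field K] [NumberField K] {ζK : ℂ → ℂ}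
    (hζ_an : ∀ s : ℂ, s ≠ 1 → DifferentiableAt ℂ ζK s)
    (hζ_ser : ∀ s : ℂ, 1 < s.re → HasSum (fun I : {I : Ideal (𝓞 K) // I ≠ ⊥} =>
      ((Ideal.absNorm I.1 : ℕ) : ℂ) ^ (-s)) (ζK s)) :
    ∃ (Λ : ℂ → ℂ) (a d : ℝ), 0 < a ∧ 0 < d ∧
      (∀ s : ℂ, s.im ≠ 0 → ζK s = archGammaInv K s * Λ s) ∧
      (∀ s : ℂ, s.im ≠ 0 → Λ (1 - s) = a * (d : ℂ) ^ s * Λ s) ∧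
      ∀ x y : ℝ, ∃ M : ℝ, ∀ s : ℂ, s.re ∈ Set.Icc x y → 1 ≤ |s.im| → ‖Λ s‖ ≤ M := by
  obtain ⟨κ, hκ, hFE⟩ := exists_idealTheta_functional_equation K
  let Q (I : FractionalIdeal (𝓞 K)⁰ K) (hI : I ≠ 0) : WeakFEPair ℂ :=
    idealFEPair hκ I hI (hFE I hI)
  obtain ⟨c, hc, hΛ⟩ := exists_archGammaInv_mul_sum_Λ K
  obtain ⟨J, J', hJ, hJ', hJJ'⟩ := exists_classGroup_rep K
  have hN : ∀ J : (FractionalIdeal (𝓞 K)⁰ K)ˣ,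
      (0 : ℝ) < FractionalIdeal.absNorm (J : FractionalIdeal (𝓞 K)⁰ K) := fun J => by
    have h0 := FractionalIdeal.absNorm_nonneg (J : FractionalIdeal (𝓞 K)⁰ K)
    have h1 : FractionalIdeal.absNorm (J : FractionalIdeal (𝓞 K)⁰ K) ≠ 0 :=
      (FractionalIdeal.absNorm_eq_zero_iff).not.2 J.ne_zero
    exact_mod_cast lt_of_le_of_ne h0 h1.symm
  set D : (FractionalIdeal (𝓞 K)⁰ K)ˣ :=
    Units.mk0 (FractionalIdeal.dual ℤ ℚ 1) (FractionalIdeal.dual_ne_zero ℤ ℚ one_ne_zero) with hD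
  set δ : ℝ := (FractionalIdeal.absNorm (D : FractionalIdeal (𝓞 K)⁰ K) : ℝ) with hδ
  have hδ0 : 0 < δ := hN D
  have hNN : ∀ C, (FractionalIdeal.absNorm (J' C : FractionalIdeal (𝓞 K)⁰ K) : ℝ) =
      δ * (FractionalIdeal.absNorm (J C : FractionalIdeal (𝓞 K)⁰ K) : ℝ)⁻¹ := fun C => by
    rw [hJJ', FractionalIdeal.dual_eq_mul_inv ℤ ℚ, map_mul, map_inv₀]
    push_cast
    rfl
  let P : ClassGroup (𝓞 K) → WeakFEPair ℂ := fun C =>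
    Q (J C) (J C).ne_zero
  set X : ℂ → ℂ := fun s => ∑ C,
    ((FractionalIdeal.absNorm (J C : FractionalIdeal (𝓞 K)⁰ K) : ℝ) : ℂ) ^ s * (P C).Λ s with hX
  set Y : ℂ → ℂ := fun s => ∑ C,
    ((FractionalIdeal.absNorm (J' C : FractionalIdeal (𝓞 K)⁰ K) : ℝ) : ℂ) ^ s *
      (P C).symm.Λ s with hY
  have hXζ : ∀ s : ℂ, s ≠ 0 → s ≠ 1 → archGammaInv K s * X s = c * ζK s :=
    hΛ ζK hζ_an hζ_ser J hJ P (fun C => rfl) (fun C => rfl) (fun C => rfl)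
  have hYζ : ∀ s : ℂ, s ≠ 0 → s ≠ 1 → archGammaInv K s * Y s = c * ζK s :=
    hΛ ζK hζ_an hζ_ser J' hJ' (fun C => (P C).symm)
      (fun C => by rw [hJJ']; rfl) (fun C => rfl) (fun C => rfl)
  have h01 : ∀ s : ℂ, s.im ≠ 0 → s ≠ 0 ∧ s ≠ 1 := fun s hs =>
    ⟨fun h => hs (by simp [h]), fun h => hs (by simp [h])⟩
  have hXY : ∀ s : ℂ, s.im ≠ 0 → X s = Y s := fun s hs => by
    refine mul_left_cancel₀ (archGammaInv_ne_zero (K := K) (Or.inr hs)) ?_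
    rw [hXζ s (h01 s hs).1 (h01 s hs).2, hYζ s (h01 s hs).1 (h01 s hs).2]
  refine ⟨fun s => c⁻¹ * X s, κ⁻¹, δ⁻¹, inv_pos.2 hκ, inv_pos.2 hδ0, fun s hs => ?_, fun s hs => ?_,
    fun x y => ?_⟩
  · have := hXζ s (h01 s hs).1 (h01 s hs).2
    rw [mul_left_comm, this, inv_mul_cancel_left₀ hc]
  · beta_reduce
    rw [hXY s hs, hX, hY]
    simp only [Finset.mul_sum]
    refine Finset.sum_congr rfl fun C _ => ?_
    have hFE := (P C).functional_equation s
    have hk : ((P C).k : ℂ) = 1 := Complex.ofReal_one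
    have hε : (P C).ε =
        (((κ * (FractionalIdeal.absNorm (J C : FractionalIdeal (𝓞 K)⁰ K) : ℝ))⁻¹ : ℝ) : ℂ) := rfl
    rw [hk, hε] at hFE
    rw [hFE, hNN]
    have hNC := hN (J C)
    generalize (FractionalIdeal.absNorm (J C : FractionalIdeal (𝓞 K)⁰ K) : ℝ) = N at *
    have hN0 : (N : ℂ) ≠ 0 := by exact_mod_cast hNC.ne'
    have hδ1 : (δ : ℂ) ≠ 0 := by exact_mod_cast hδ0.ne'
    have hκ1 : (κ : ℂ) ≠ 0 := by exact_mod_cast hκ.ne'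
    rw [Complex.ofReal_mul, Complex.mul_cpow_ofReal_nonneg hδ0.le (inv_pos.2 hNC).le,
      Complex.cpow_sub _ _ hN0, Complex.cpow_one, Complex.ofReal_inv δ, Complex.ofReal_inv N,
      Complex.inv_cpow _ _ (by rw [Complex.arg_ofReal_of_nonneg hδ0.le]; exact Real.pi_pos.ne),
      Complex.inv_cpow _ _ (by rw [Complex.arg_ofReal_of_nonneg hNC.le]; exact Real.pi_pos.ne)]
    have h1 : (N : ℂ) ^ s ≠ 0 := by simp [Complex.cpow_eq_zero_iff, hN0]
    have h2 : (δ : ℂ) ^ s ≠ 0 := by simp [Complex.cpow_eq_zero_iff, hδ1]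
    rw [smul_eq_mul]
    push_cast
    field_simp
  · have hM : ∀ C, ∃ M : ℝ, ∀ s : ℂ, s.re ∈ Set.Icc x y → 1 ≤ |s.im| → ‖(P C).Λ s‖ ≤ M :=
      fun C => (P C).exists_norm_Λ_le x y
    choose M hM using hM
    refine ⟨‖c⁻¹‖ * ∑ C,
      ((FractionalIdeal.absNorm (J C : FractionalIdeal (𝓞 K)⁰ K) : ℝ) ^ x +
        (FractionalIdeal.absNorm (J C : FractionalIdeal (𝓞 K)⁰ K) : ℝ) ^ y) * M C,
      fun s hs him => ?_⟩
    beta_reduce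
    rw [norm_mul]
    refine mul_le_mul_of_nonneg_left ((norm_sum_le _ _).trans (Finset.sum_le_sum fun C _ => ?_))
      (norm_nonneg _)
    rw [norm_mul, Complex.norm_cpow_eq_rpow_re_of_pos (hN (J C))]
    have hNC := hN (J C)
    have h1 := Real.rpow_nonneg hNC.le x
    have h2 := Real.rpow_nonneg hNC.le y
    refine mul_le_mul ?_ (hM C s hs him) (norm_nonneg _) (by positivity)
    rcases le_total (FractionalIdeal.absNorm (J C : FractionalIdeal (𝓞 K)⁰ K) : ℝ) 1 with h | h
    · have := Real.rpow_le_rpow_of_exponent_ge hNC h hs.1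
      linarith
    · have := Real.rpow_le_rpow_of_exponent_le h hs.2
      linarith

theorem Complex.exists_norm_Gamma_le {x y : ℝ} (hx : 0 < x) :
    ∃ M : ℝ, ∀ s : ℂ, s.re ∈ Set.Icc x y → ‖Gamma s‖ ≤ M := by
  rcases lt_or_ge y x with h | h
  · exact ⟨0, fun s hs => absurd (hs.1.trans hs.2) (not_le.2 h)⟩
  have hc : ∀ a : ℝ, 0 < a → MellinConvergent (fun t : ℝ => ((Real.exp (-t) : ℝ) : ℂ)) a :=
    fun a ha => by
      have := Complex.GammaIntegral_convergent (s := (a : ℂ)) (by simpa using ha)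
      simpa only [MellinConvergent, smul_eq_mul, mul_comm] using this
  obtain ⟨M, hM⟩ := norm_mellin_le_of_re_mem_Icc (hc x hx) (hc y (hx.trans_le h))
  refine ⟨M, fun s hs => ?_⟩
  rw [Complex.Gamma_eq_integral (hx.trans_le hs.1), Complex.GammaIntegral_eq_mellin]
  exact hM s hs

theorem Complex.ne_neg_natCast_of_im_ne_zero {s : ℂ} (hs : s.im ≠ 0) (m : ℕ) : s ≠ -m :=
  fun h => hs (by simp [h])

theorem Complex.norm_Gamma_inv_le_norm_Gamma_sub_inv {s : ℂ} (hs : 1 ≤ |s.im|) (n : ℕ) :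
    ‖(Gamma s)⁻¹‖ ≤ ‖(Gamma (s - n))⁻¹‖ := by
  induction n with
  | zero => simp
  | succ n ih =>
    refine ih.trans ?_
    have him : (s - (n + 1 : ℕ)).im = s.im := by simp
    have h1 : 1 ≤ ‖s - (n + 1 : ℕ)‖ := by
      refine hs.trans ?_
      rw [← him]
      exact Complex.abs_im_le_norm _
    have h0 : s - (n + 1 : ℕ) ≠ 0 := norm_pos_iff.1 (one_pos.trans_le h1)
    have h2 : s - n = s - (n + 1 : ℕ) + 1 := by push_cast; ring
    rw [h2, Complex.Gamma_add_one _ h0, mul_inv, norm_mul]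
    refine mul_le_of_le_one_left (norm_nonneg _) ?_
    rw [norm_inv]
    exact inv_le_one_of_one_le₀ h1

theorem Complex.norm_sin_le_exp_abs_im (z : ℂ) : ‖sin z‖ ≤ Real.exp |z.im| := by
  have h1 : ∀ w : ℂ, |w.re| = |z.im| → ‖exp w‖ ≤ Real.exp |z.im| := fun w hw => by
    rw [Complex.norm_exp, ← hw]
    exact Real.exp_le_exp.2 (le_abs_self _)
  rw [Complex.sin, norm_div, norm_mul, Complex.norm_I, mul_one, Complex.norm_ofNat,
    div_le_iff₀ two_pos]
  refine (norm_sub_le _ _).trans ?_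
  rw [mul_two]
  exact add_le_add (h1 _ (by simp)) (h1 _ (by simp))

theorem Complex.exists_norm_Gamma_inv_le (x y : ℝ) :
    ∃ M : ℝ, 0 ≤ M ∧ ∀ s : ℂ, s.re ∈ Set.Icc x y → 1 ≤ |s.im| →
      ‖(Gamma s)⁻¹‖ ≤ M * Real.exp (Real.pi * |s.im|) := by
  obtain ⟨n, hn⟩ := exists_nat_ge y
  obtain ⟨M, hM⟩ := Complex.exists_norm_Gamma_le (x := 1) (y := 1 - x + n) one_pos
  refine ⟨max M 0 / Real.pi, by positivity, fun s hs him => ?_⟩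
  refine (Complex.norm_Gamma_inv_le_norm_Gamma_sub_inv him n).trans ?_
  set z : ℂ := s - n with hz
  have hzim : z.im = s.im := by simp [hz]
  have hz0 : z.im ≠ 0 := fun h => by
    rw [← hzim, h, abs_zero] at him
    linarith
  have h1 : Gamma z ≠ 0 := Complex.Gamma_ne_zero (Complex.ne_neg_natCast_of_im_ne_zero hz0)
  have h2 : Gamma (1 - z) ≠ 0 :=
    Complex.Gamma_ne_zero (Complex.ne_neg_natCast_of_im_ne_zero (by simpa using hz0))
  have h3 := Complex.Gamma_mul_Gamma_one_sub z
  have hpi : (Real.pi : ℂ) ≠ 0 := by exact_mod_cast Real.pi_ne_zero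
  have h4 : sin (Real.pi * z) ≠ 0 := fun h => by
    rw [h, div_zero] at h3
    exact mul_ne_zero h1 h2 h3
  have h5 : (Gamma z)⁻¹ = Gamma (1 - z) * sin (Real.pi * z) / Real.pi := by
    rw [eq_div_iff h4] at h3
    rw [eq_div_iff hpi, inv_mul_eq_iff_eq_mul₀ h1, ← mul_assoc]
    exact h3.symm
  rw [h5, norm_div, norm_mul, Complex.norm_real, Real.norm_of_nonneg Real.pi_pos.le,
    div_mul_eq_mul_div]
  have h6 : ‖Gamma (1 - z)‖ ≤ max M 0 := by
    refine (hM _ ?_).trans (le_max_left _ _)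
    simp only [hz, Complex.sub_re, Complex.one_re, Complex.natCast_re]
    constructor <;> linarith [hs.1, hs.2]
  have h7 : ‖sin (Real.pi * z)‖ ≤ Real.exp (Real.pi * |s.im|) := by
    refine (Complex.norm_sin_le_exp_abs_im _).trans_eq ?_
    simp [hzim, abs_mul, abs_of_pos Real.pi_pos]
  have := Real.pi_pos
  gcongr

theorem Complex.norm_Gamma_add_nat_le {s : ℂ} (hs : s.im ≠ 0) (n : ℕ) :
    ‖Gamma (s + n)‖ ≤ (‖s‖ + n) ^ n * ‖Gamma s‖ := by
  induction n with
  | zero => simp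
  | succ n ih =>
    have h0 : s + n ≠ 0 := fun h => hs (by simpa using congrArg Complex.im h)
    have h1 : s + (n + 1 : ℕ) = s + n + 1 := by push_cast; ring
    rw [h1, Complex.Gamma_add_one _ h0, norm_mul, pow_succ', mul_assoc]
    have h2 : ‖s + n‖ ≤ ‖s‖ + (n + 1 : ℕ) := by
      refine (norm_add_le _ _).trans ?_
      simp
    refine mul_le_mul h2 (ih.trans ?_) (norm_nonneg _) (by positivity)
    gcongr
    simp

theorem exists_norm_archGammaInv_le (K : Type*) [Field K] [NumberField K] (x y : ℝ) :
    ∃ M c : ℝ, 0 ≤ M ∧ 0 ≤ c ∧ ∀ s : ℂ, s.re ∈ Set.Icc x y → 2 ≤ |s.im| →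
      ‖archGammaInv K s‖ ≤ M * Real.exp (c * |s.im|) := by
  have h : ∀ w : InfinitePlace K, ∃ M : ℝ, 0 ≤ M ∧ ∀ s : ℂ, s.re ∈ Set.Icc x y → 2 ≤ |s.im| →
      ‖((Real.pi * w.mult : ℝ) : ℂ) ^ (s * w.mult / 2) * (Complex.Gamma (s * w.mult / 2))⁻¹‖ ≤
        M * Real.exp (Real.pi * |s.im|) := fun w => by
    have hm1 : (1 : ℝ) ≤ w.mult := by exact_mod_cast InfinitePlace.mult_pos
    have hm2 : (w.mult : ℝ) ≤ 2 := by
      unfold InfinitePlace.mult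
      split_ifs <;> norm_num
    obtain ⟨M, hM0, hM⟩ := Complex.exists_norm_Gamma_inv_le (x * w.mult / 2) (y * w.mult / 2)
    refine ⟨(Real.pi * w.mult) ^ (y * w.mult / 2) * M, by positivity, fun s hs him => ?_⟩
    have hre : (s * w.mult / 2).re = s.re * w.mult / 2 := by simp
    have hi : (s * w.mult / 2).im = s.im * w.mult / 2 := by simp
    have hi2 : |(s * w.mult / 2).im| = |s.im| * w.mult / 2 := by
      rw [hi, abs_div, abs_mul, abs_of_pos (two_pos : (0 : ℝ) < 2),
        abs_of_nonneg (by linarith : (0 : ℝ) ≤ w.mult)]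
    have h1 := hM (s * w.mult / 2) (by
      rw [hre]; constructor
      · have := mul_le_mul_of_nonneg_right hs.1 (by linarith : (0 : ℝ) ≤ w.mult); linarith
      · have := mul_le_mul_of_nonneg_right hs.2 (by linarith : (0 : ℝ) ≤ w.mult); linarith)
      (by rw [hi2]; nlinarith)
    rw [norm_mul, mul_assoc, Complex.norm_cpow_eq_rpow_re_of_pos (by positivity), hre]
    refine mul_le_mul ?_ (h1.trans ?_) (norm_nonneg _) (by positivity)
    · refine Real.rpow_le_rpow_of_exponent_le ?_ ?_
      · nlinarith [Real.pi_gt_three]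
      · have := mul_le_mul_of_nonneg_right hs.2 (by linarith : (0 : ℝ) ≤ w.mult); linarith
    · rw [hi2]
      have := Real.pi_pos
      have : |s.im| * w.mult / 2 ≤ |s.im| := by nlinarith [abs_nonneg s.im]
      gcongr
  choose M hM0 hM using h
  refine ⟨∏ w, M w, Fintype.card (InfinitePlace K) * Real.pi, Finset.prod_nonneg fun w _ => hM0 w,
    by positivity, fun s hs him => ?_⟩
  rw [archGammaInv, norm_prod]
  refine (Finset.prod_le_prod (fun w _ => norm_nonneg _) fun w _ => hM w s hs him).trans_eq ?_
  rw [Finset.prod_mul_distrib, Finset.prod_const, ← Real.exp_nat_mul, Finset.card_univ, mul_assoc]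

theorem exists_norm_archGammaInv_le_mul (K : Type*) [Field K] [NumberField K] (k : ℕ) :
    ∃ (M : ℝ) (N : ℕ), 0 ≤ M ∧ ∀ s : ℂ, s.re = 1 / 2 - k → s.im ≠ 0 →
      ‖archGammaInv K s‖ ≤ M * (‖s‖ + 2 * k) ^ N * ‖archGammaInv K (1 - s)‖ := by
  have h : ∀ w : InfinitePlace K, ∃ M : ℝ, 0 ≤ M ∧ ∀ s : ℂ, s.re = 1 / 2 - k → s.im ≠ 0 →
      ‖((Real.pi * w.mult : ℝ) : ℂ) ^ (s * w.mult / 2) * (Complex.Gamma (s * w.mult / 2))⁻¹‖ ≤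
        M * (‖s‖ + 2 * k) ^ (k * w.mult) * ‖((Real.pi * w.mult : ℝ) : ℂ) ^ ((1 - s) * w.mult / 2) *
          (Complex.Gamma ((1 - s) * w.mult / 2))⁻¹‖ := fun w => by
    have hm1 : (1 : ℝ) ≤ w.mult := by exact_mod_cast InfinitePlace.mult_pos
    have hm2 : (w.mult : ℝ) ≤ 2 := by
      unfold InfinitePlace.mult
      split_ifs <;> norm_num
    have hp : (0 : ℝ) < Real.pi * w.mult := by positivity
    refine ⟨(Real.pi * w.mult) ^ ((1 / 2 - k : ℝ) * w.mult / 2) *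
      ((Real.pi * w.mult) ^ ((1 / 2 + k : ℝ) * w.mult / 2))⁻¹, by positivity, fun s hs him => ?_⟩
    have hre : (s * w.mult / 2).re = (1 / 2 - k : ℝ) * w.mult / 2 := by simp [hs]
    have hre2 : ((1 - s) * w.mult / 2).re = (1 / 2 + k : ℝ) * w.mult / 2 := by
      simp [hs]; ring
    have hi : (s * w.mult / 2).im ≠ 0 := by
      have : (s * w.mult / 2).im = s.im * w.mult / 2 := by simp
      rw [this]
      exact div_ne_zero (mul_ne_zero him (by positivity)) two_ne_zero
    have hconj : (1 - s) * w.mult / 2 =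
        (starRingEnd ℂ) (s * w.mult / 2) + ((k * w.mult : ℕ) : ℂ) := by
      apply Complex.ext
      · rw [hre2, Complex.add_re, Complex.conj_re, hre]
        simp only [Complex.natCast_re]
        push_cast
        ring
      · rw [Complex.add_im, Complex.conj_im, Complex.natCast_im]
        simp [neg_div]
    have hG := Complex.norm_Gamma_add_nat_le
      (s := (starRingEnd ℂ) (s * w.mult / 2)) (by rw [Complex.conj_im]; exact neg_ne_zero.2 hi)
      (k * w.mult)
    rw [← hconj, Complex.Gamma_conj, Complex.norm_conj, Complex.norm_conj] at hG
    have hsm : ‖s * w.mult / 2‖ + ((k * w.mult : ℕ) : ℝ) ≤ ‖s‖ + 2 * k := by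
      rw [norm_div, norm_mul, Complex.norm_natCast, Complex.norm_ofNat]
      push_cast
      nlinarith [norm_nonneg s, (Nat.cast_nonneg k : (0 : ℝ) ≤ k)]
    have hG2 := hG.trans (mul_le_mul_of_nonneg_right
      (pow_le_pow_left₀ (by positivity) hsm (k * w.mult)) (norm_nonneg _))
    have g1 : Gamma (s * w.mult / 2) ≠ 0 :=
      Complex.Gamma_ne_zero (Complex.ne_neg_natCast_of_im_ne_zero hi)
    have g2 : Gamma ((1 - s) * w.mult / 2) ≠ 0 := by
      refine Complex.Gamma_ne_zero (Complex.ne_neg_natCast_of_im_ne_zero ?_)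
      rw [hconj, Complex.add_im, Complex.conj_im, Complex.natCast_im, add_zero]
      exact neg_ne_zero.2 hi
    rw [norm_mul, norm_mul, Complex.norm_cpow_eq_rpow_re_of_pos hp,
      Complex.norm_cpow_eq_rpow_re_of_pos hp, hre, hre2, norm_inv, norm_inv]
    have g1' := norm_pos_iff.2 g1
    have g2' := norm_pos_iff.2 g2
    have e2 : (0 : ℝ) < (Real.pi * w.mult) ^ ((1 / 2 + k : ℝ) * w.mult / 2) :=
      Real.rpow_pos_of_pos hp _
    have e1 : (0 : ℝ) < (Real.pi * w.mult) ^ ((1 / 2 - k : ℝ) * w.mult / 2) :=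
      Real.rpow_pos_of_pos hp _
    generalize (Real.pi * (w.mult : ℝ)) ^ ((1 / 2 + k : ℝ) * w.mult / 2) = E2 at *
    generalize (Real.pi * (w.mult : ℝ)) ^ ((1 / 2 - k : ℝ) * w.mult / 2) = E1 at *
    have h8 : E1 * E2⁻¹ * (‖s‖ + 2 * k) ^ (k * w.mult) *
        (E2 * ‖Gamma ((1 - s) * w.mult / 2)‖⁻¹) =
        E1 * ((‖s‖ + 2 * k) ^ (k * w.mult) * ‖Gamma ((1 - s) * w.mult / 2)‖⁻¹) := by
      field_simp
    rw [h8]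
    refine mul_le_mul_of_nonneg_left ?_ e1.le
    rw [← div_eq_mul_inv, le_div_iff₀ g2', inv_mul_le_iff₀ g1', mul_comm ‖Gamma _‖]
    exact hG2
  choose M hM0 hM using h
  refine ⟨∏ w, M w, ∑ w : InfinitePlace K, k * w.mult, Finset.prod_nonneg fun w _ => hM0 w,
    fun s hs him => ?_⟩
  rw [archGammaInv, archGammaInv, norm_prod, norm_prod]
  refine (Finset.prod_le_prod (fun w _ => norm_nonneg _) fun w _ => hM w s hs him).trans_eq ?_
  rw [Finset.prod_mul_distrib, Finset.prod_mul_distrib, Finset.prod_pow_eq_pow_sum]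

theorem exists_entire_eq_sub_mul {f : ℂ → ℂ} {c : ℂ} (hf : ∀ s : ℂ, s ≠ c → DifferentiableAt ℂ f s)
    (hpole : ∃ A : ℂ, A ≠ 0 ∧ Tendsto (fun s : ℂ => (s - c) * f s) (𝓝[≠] c) (𝓝 A)) :
    ∃ F : ℂ → ℂ, Differentiable ℂ F ∧ F c ≠ 0 ∧ ∀ s, s ≠ c → F s = (s - c) * f s := by
  obtain ⟨A, hA, h⟩ := hpole
  refine ⟨Function.update (fun s => (s - c) * f s) c A, ?_, by simpa using hA,
    fun s hs => Function.update_of_ne hs _ _⟩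
  rw [← differentiableOn_univ]
  refine (Complex.differentiableOn_compl_singleton_and_continuousAt_iff univ_mem (c := c)).1 ⟨?_, ?_⟩
  · intro s hs
    have hsc : s ≠ c := by simpa using hs
    have hd : DifferentiableAt ℂ (fun s => (s - c) * f s) s := (by fun_prop :
      DifferentiableAt ℂ (fun s => s - c) s).mul (hf s hsc)
    refine (hd.congr_of_eventuallyEq ?_).differentiableWithinAt
    filter_upwards [isOpen_ne.mem_nhds hsc] with z hz
    exact Function.update_of_ne hz _ _
  · exact continuousAt_update_same.2 h

theorem exists_norm_dedekindZeta_le {K : Type*} [Field K] [NumberField K] {ζK : ℂ → ℂ}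
    (hζ_ser : ∀ s : ℂ, 1 < s.re → HasSum (fun I : {I : Ideal (𝓞 K) // I ≠ ⊥} =>
      ((Ideal.absNorm I.1 : ℕ) : ℂ) ^ (-s)) (ζK s)) {x : ℝ} (hx : 1 < x) :
    ∃ M : ℝ, 0 ≤ M ∧ ∀ s : ℂ, x ≤ s.re → ‖ζK s‖ ≤ M := by
  have h1 := (hζ_ser x (by simpa using hx)).summable.norm
  refine ⟨∑' I : {I : Ideal (𝓞 K) // I ≠ ⊥}, ‖((Ideal.absNorm I.1 : ℕ) : ℂ) ^ (-(x : ℂ))‖,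
    tsum_nonneg fun I => norm_nonneg _, fun s hs => ?_⟩
  rw [← (hζ_ser s (hx.trans_le hs)).tsum_eq]
  refine tsum_of_norm_bounded h1.hasSum fun I => ?_
  have h0 : 0 < Ideal.absNorm I.1 := Nat.pos_of_ne_zero (Ideal.absNorm_eq_zero_iff.not.2 I.2)
  have h2 : (1 : ℝ) ≤ Ideal.absNorm I.1 := by exact_mod_cast h0
  rw [Complex.norm_natCast_cpow_of_pos h0, Complex.norm_natCast_cpow_of_pos h0]
  exact Real.rpow_le_rpow_of_exponent_le h2 (by simpa using hs)

theorem exists_norm_dedekindZeta_le_left {K : Type*} [Field K] [NumberField K] {ζK : ℂ → ℂ}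
    (hζ_an : ∀ s : ℂ, s ≠ 1 → DifferentiableAt ℂ ζK s)
    (hζ_ser : ∀ s : ℂ, 1 < s.re → HasSum (fun I : {I : Ideal (𝓞 K) // I ≠ ⊥} =>
      ((Ideal.absNorm I.1 : ℕ) : ℂ) ^ (-s)) (ζK s)) {k : ℕ} (hk : k ≠ 0) :
    ∃ (M : ℝ) (N : ℕ), 0 ≤ M ∧ ∀ s : ℂ, s.re = 1 / 2 - k → s.im ≠ 0 →
      ‖ζK s‖ ≤ M * (‖s‖ + 2 * k) ^ N := by
  have hk1 : (1 : ℝ) ≤ k := by exact_mod_cast Nat.one_le_iff_ne_zero.2 hk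
  obtain ⟨Λ, a, d, ha, hd, hΛ, hFE, -⟩ := exists_completed_dedekindZeta hζ_an hζ_ser
  obtain ⟨Z, hZ0, hZ⟩ := exists_norm_dedekindZeta_le hζ_ser (x := 1 / 2 + k) (by linarith)
  obtain ⟨M, N, hM0, hM⟩ := exists_norm_archGammaInv_le_mul K k
  refine ⟨M * (a * d ^ (1 / 2 + k : ℝ)) * Z, N, by positivity, fun s hs him => ?_⟩
  have h1 : (1 - s).im ≠ 0 := by simpa using him
  have h2 := hFE (1 - s) h1
  rw [sub_sub_cancel] at h2
  have hre : (1 - s).re = 1 / 2 + k := by rw [Complex.sub_re, hs, Complex.one_re]; ring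
  have h3 := hZ (1 - s) hre.ge
  rw [hΛ _ h1, norm_mul] at h3
  rw [hΛ s him, h2, norm_mul, norm_mul, norm_mul, Complex.norm_cpow_eq_rpow_re_of_pos hd, hre,
    Complex.norm_real, Real.norm_of_nonneg ha.le]
  calc _ ≤ (M * (‖s‖ + 2 * k) ^ N * ‖archGammaInv K (1 - s)‖) *
        (a * d ^ (1 / 2 + k : ℝ) * ‖Λ (1 - s)‖) := by
        gcongr
        exact hM s hs him
    _ = M * (a * d ^ (1 / 2 + k : ℝ)) * (‖s‖ + 2 * k) ^ N *
        (‖archGammaInv K (1 - s)‖ * ‖Λ (1 - s)‖) := by ring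
    _ ≤ M * (a * d ^ (1 / 2 + k : ℝ)) * (‖s‖ + 2 * k) ^ N * Z := by gcongr
    _ = _ := by ring

set_option maxHeartbeats 600000 in
/-- Polynomial growth of the Dedekind zeta function in vertical strips. -/
theorem exists_norm_entire_le_pow {K : Type*} [Field K] [NumberField K] {ζK F : ℂ → ℂ}
    (hζ_an : ∀ s : ℂ, s ≠ 1 → DifferentiableAt ℂ ζK s)
    (hζ_ser : ∀ s : ℂ, 1 < s.re → HasSum (fun I : {I : Ideal (𝓞 K) // I ≠ ⊥} =>
      ((Ideal.absNorm I.1 : ℕ) : ℂ) ^ (-s)) (ζK s))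
    (hF : Differentiable ℂ F) (hFζ : ∀ s, s ≠ 1 → F s = (s - 1) * ζK s) {k : ℕ} (hk : k ≠ 0) :
    ∃ (C : ℝ) (A : ℕ), ∀ s : ℂ, s.re ∈ Set.Icc (1 / 2 - k : ℝ) (1 / 2 + k) →
      ‖F s‖ ≤ C * ‖s + (k + 1)‖ ^ A := by
  have hk1 : (1 : ℝ) ≤ k := by exact_mod_cast Nat.one_le_iff_ne_zero.2 hk
  obtain ⟨Z, hZ0, hZ⟩ := exists_norm_dedekindZeta_le hζ_ser (x := 1 / 2 + k) (by linarith)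
  obtain ⟨M, N, hM0, hM⟩ := exists_norm_dedekindZeta_le_left hζ_an hζ_ser hk
  obtain ⟨Λ, a, d, -, -, hΛ, -, hΛb⟩ := exists_completed_dedekindZeta hζ_an hζ_ser
  obtain ⟨L, hL⟩ := hΛb (1 / 2 - k) (1 / 2 + k)
  obtain ⟨G, c, hG0, hc0, hG⟩ := exists_norm_archGammaInv_le K (1 / 2 - k) (1 / 2 + k)
  have hu : ∀ s : ℂ, (1 / 2 - k : ℝ) ≤ s.re → 1 ≤ ‖s + (k + 1)‖ := fun s hs => by
    refine le_trans ?_ (Complex.re_le_norm _)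
    simp only [Complex.add_re, Complex.natCast_re, Complex.one_re]
    linarith
  have hs1 : ∀ s : ℂ, (1 / 2 - k : ℝ) ≤ s.re → ‖s - 1‖ ≤ (k + 3) * ‖s + (k + 1)‖ := fun s hs => by
    have h1 := hu s hs
    have h2 : ‖s - 1‖ ≤ ‖s + (k + 1)‖ + ‖((k + 2 : ℕ) : ℂ)‖ := by
      have : s - 1 = s + (k + 1) - ((k + 2 : ℕ) : ℂ) := by push_cast; ring
      rw [this]
      exact norm_sub_le _ _
    rw [Complex.norm_natCast] at h2
    push_cast at h2
    nlinarith
  have hs2 : ∀ s : ℂ, (1 / 2 - k : ℝ) ≤ s.re → ‖s‖ + 2 * k ≤ (3 * k + 2) * ‖s + (k + 1)‖ :=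
    fun s hs => by
    have h1 := hu s hs
    have h2 : ‖s‖ ≤ ‖s + (k + 1)‖ + ‖((k + 1 : ℕ) : ℂ)‖ := by
      have : s = s + (k + 1) - ((k + 1 : ℕ) : ℂ) := by push_cast; ring
      nth_rewrite 1 [this]
      exact norm_sub_le _ _
    rw [Complex.norm_natCast] at h2
    push_cast at h2
    nlinarith
  set f : ℂ → ℂ := fun s => F s / (s + (k + 1)) ^ (N + 1) with hf
  have hfn : ∀ s : ℂ, (1 / 2 - k : ℝ) ≤ s.re → ∀ B : ℝ,
      ‖F s‖ ≤ B * ‖s + (k + 1)‖ ^ (N + 1) → ‖f s‖ ≤ B := fun s hs B h => by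
    rw [hf, norm_div, norm_pow, div_le_iff₀ (pow_pos (one_pos.trans_le (hu s hs)) _)]
    exact h
  obtain ⟨B₀, hB₀⟩ := (isCompact_closedBall (0 : ℂ) (k + 2)).exists_bound_of_continuousOn
    hF.continuous.continuousOn
  set B : ℝ := max (max B₀ 0) (max ((k + 3) * (M * (3 * k + 2) ^ N)) ((k + 3) * Z)) with hB
  have hB₀B : B₀ ≤ B := (le_max_left B₀ 0).trans (le_max_left _ _)
  have hB0 : 0 ≤ B := (le_max_right B₀ 0).trans (le_max_left _ _)
  have hleft : ∀ s : ℂ, s.re = 1 / 2 - k → ‖f s‖ ≤ B := fun s hs => by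
    have h1 := hu s hs.ge
    refine hfn s hs.ge _ ?_
    by_cases him : |s.im| ≤ 1
    · have hsB : s ∈ Metric.closedBall (0 : ℂ) (k + 2) := by
        rw [mem_closedBall_zero_iff]
        refine (Complex.norm_le_abs_re_add_abs_im s).trans ?_
        have : |s.re| ≤ k := by rw [hs, abs_le]; constructor <;> linarith
        linarith
      refine (hB₀ s hsB).trans (hB₀B.trans ?_)
      exact le_mul_of_one_le_right hB0 (one_le_pow₀ h1)
    · have him0 : s.im ≠ 0 := fun h => him (by simp [h])
      rw [hFζ s (fun h => him0 (by simp [h])), norm_mul]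
      calc _ ≤ (k + 3) * ‖s + (k + 1)‖ * (M * ((3 * k + 2) * ‖s + (k + 1)‖) ^ N) := by
            gcongr
            · exact hs1 s hs.ge
            · refine (hM s hs him0).trans ?_
              gcongr
              exact hs2 s hs.ge
        _ = (k + 3) * (M * (3 * k + 2) ^ N) * ‖s + (k + 1)‖ ^ (N + 1) := by
            rw [mul_pow, pow_succ]; ring
        _ ≤ _ := by
            gcongr
            exact (le_max_left _ _).trans (le_max_right _ _)
  have hright : ∀ s : ℂ, s.re = 1 / 2 + k → ‖f s‖ ≤ B := fun s hs => by
    have hs' : (1 / 2 - k : ℝ) ≤ s.re := by linarith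
    have h1 := hu s hs'
    refine hfn s hs' _ ?_
    rw [hFζ s (fun h => by rw [h, Complex.one_re] at hs; linarith), norm_mul]
    calc _ ≤ (k + 3) * ‖s + (k + 1)‖ * Z := by
          gcongr
          · exact hs1 s hs'
          · exact hZ s hs.ge
      _ = (k + 3) * Z * ‖s + (k + 1)‖ ^ 1 := by ring
      _ ≤ _ := by
          gcongr
          · exact (le_max_right _ _).trans (le_max_right _ _)
          · exact Nat.le_add_left 1 N
  have hgrow : ∀ s : ℂ, s.re ∈ Set.Icc (1 / 2 - k : ℝ) (1 / 2 + k) → 2 ≤ |s.im| →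
      ‖f s‖ ≤ (k + 3) * (G * L) * Real.exp (c * |s.im|) := fun s hs him => by
    have h1 := hu s hs.1
    have him0 : s.im ≠ 0 := fun h => by
      rw [h, abs_zero] at him; linarith
    have hL' := hL s hs (by linarith)
    have hL0 : 0 ≤ L := (norm_nonneg _).trans hL'
    refine hfn s hs.1 _ ?_
    rw [hFζ s (fun h => him0 (by simp [h])), hΛ s him0, norm_mul, norm_mul]
    calc _ ≤ (k + 3) * ‖s + (k + 1)‖ * (G * Real.exp (c * |s.im|) * L) := by
          gcongr
          · exact hs1 s hs.1
          · exact hG s hs him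
      _ = (k + 3) * (G * L) * Real.exp (c * |s.im|) * ‖s + (k + 1)‖ ^ 1 := by ring
      _ ≤ _ := by
          gcongr
          · exact Nat.le_add_left 1 N
  refine ⟨B, N + 1, fun s hs => ?_⟩
  have hfs : ‖f s‖ ≤ B := by
    refine PhragmenLindelof.vertical_strip (a := 1 / 2 - k) (b := 1 / 2 + k) ?_ ?_ hleft hright
      hs.1 hs.2
    · refine DifferentiableOn.diffContOnCl fun z hz => ?_
      have hz' : (1 / 2 - k : ℝ) ≤ z.re := by
        have hcl : IsClosed {z : ℂ | (1 / 2 - k : ℝ) ≤ z.re} :=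
          isClosed_le continuous_const Complex.continuous_re
        exact closure_minimal (fun w hw => le_of_lt hw.1) hcl hz
      have hz0 : z + (k + 1) ≠ 0 := norm_pos_iff.1 (one_pos.trans_le (hu z hz'))
      have hd : DifferentiableAt ℂ (fun s : ℂ => (s + (k + 1)) ^ (N + 1)) z := by fun_prop
      have hn : (z + (k + 1)) ^ (N + 1) ≠ 0 := pow_ne_zero _ hz0
      exact ((hF z).fun_div hd hn).differentiableWithinAt
    · set e : ℝ := Real.pi / (1 / 2 + k - (1 / 2 - k)) / 2 with he
      have hp : 0 < Real.pi / (1 / 2 + k - (1 / 2 - k)) := div_pos Real.pi_pos (by linarith)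
      have he0 : 0 < e := half_pos hp
      refine ⟨e, half_lt_self hp, c / e, Asymptotics.IsBigO.of_bound ((k + 3) * (G * |L|)) ?_⟩
      filter_upwards [mem_inf_of_left (preimage_mem_comap (Ici_mem_atTop (2 : ℝ))),
        mem_inf_of_right (mem_principal_self _)] with z hz1 hz2
      have hz1 : 2 ≤ |z.im| := hz1
      refine (hgrow z ⟨hz2.1.le, hz2.2.le⟩ hz1).trans ?_
      rw [Real.norm_of_nonneg (Real.exp_pos _).le]
      have h5 : c * |z.im| ≤ c / e * Real.exp (e * |z.im|) := by
        have h6 : e * |z.im| ≤ Real.exp (e * |z.im|) := by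
          linarith [Real.add_one_le_exp (e * |z.im|)]
        calc c * |z.im| = c / e * (e * |z.im|) := by field_simp
          _ ≤ _ := by gcongr
      gcongr
      exact le_abs_self L
  have h1 := hu s hs.1
  rwa [hf, norm_div, norm_pow, div_le_iff₀ (pow_pos (one_pos.trans_le h1) _)] at hfs

open Classical in
theorem hasSum_log_absNorm_of_prime_pow_dvd {K : Type*} [Field K] [NumberField K]
    {I : Ideal (𝓞 K)} (hI : I ≠ ⊥) :
    HasSum (fun p : {P : Ideal (𝓞 K) // Prime P} × ℕ =>
      if p.1.1 ^ (p.2 + 1) ∣ I then Real.log (Ideal.absNorm p.1.1) else 0)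
      (Real.log (Ideal.absNorm I)) := by
  have hI0 : I ≠ 0 := hI
  set F := UniqueFactorizationMonoid.normalizedFactors I with hF
  have hprime : ∀ P ∈ F, Prime P := fun P hP =>
    UniqueFactorizationMonoid.prime_of_normalized_factor P hP
  have hdvd : ∀ p : {P : Ideal (𝓞 K) // Prime P} × ℕ,
      p.1.1 ^ (p.2 + 1) ∣ I ↔ p.2 < F.count p.1.1 := fun p => by
    rw [pow_dvd_iff_le_emultiplicity,
      UniqueFactorizationMonoid.emultiplicity_eq_count_normalizedFactors p.1.2.irreducible hI0,
      normalize_eq, Nat.cast_le, Nat.succ_le_iff]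
  have hlog : ∀ M : Multiset (Ideal (𝓞 K)), (∀ P ∈ M, Prime P) →
      Real.log (Ideal.absNorm M.prod) = (M.map fun P => Real.log (Ideal.absNorm P)).sum := by
    intro M
    induction M using Multiset.induction_on with
    | empty => simp
    | cons P M ih =>
      intro h
      have hP : Prime P := h P (Multiset.mem_cons_self _ _)
      have hM : ∀ Q ∈ M, Prime Q := fun Q hQ => h Q (Multiset.mem_cons_of_mem hQ)
      have hM0 : M.prod ≠ 0 := fun h0 => (hM 0 (Multiset.prod_eq_zero_iff.1 h0)).ne_zero rfl
      have h1 : (Ideal.absNorm P : ℝ) ≠ 0 :=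
        Nat.cast_ne_zero.2 (Ideal.absNorm_eq_zero_iff.not.2 hP.ne_zero)
      have h2 : (Ideal.absNorm M.prod : ℝ) ≠ 0 :=
        Nat.cast_ne_zero.2 (Ideal.absNorm_eq_zero_iff.not.2 hM0)
      rw [Multiset.prod_cons, map_mul, Nat.cast_mul, Real.log_mul h1 h2, ih hM,
        Multiset.map_cons, Multiset.sum_cons]
  have hval : Real.log (Ideal.absNorm I) =
      ∑ p ∈ (F.toFinset.subtype Prime) ×ˢ Finset.range (Multiset.card F),
        if p.1.1 ^ (p.2 + 1) ∣ I then Real.log (Ideal.absNorm p.1.1) else 0 := by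
    have h1 : I = F.prod := (Ideal.prod_normalizedFactors_eq_self hI).symm
    nth_rewrite 1 [h1]
    rw [hlog F hprime, Finset.sum_multiset_map_count, Finset.sum_product,
      ← Finset.sum_subtype_of_mem (p := Prime) _ fun P hP => hprime P (Multiset.mem_toFinset.1 hP)]
    refine Finset.sum_congr rfl fun P _ => ?_
    simp only [fun k => hdvd (P, k)]
    rw [← Finset.sum_filter, Finset.sum_const]
    have h2 : {k ∈ Finset.range (Multiset.card F) | k < F.count P.1} =
        Finset.range (F.count P.1) := by
      ext k
      simp only [Finset.mem_range, Finset.mem_filter]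
      have := F.count_le_card P.1
      omega
    rw [h2, Finset.card_range]
  rw [hval]
  refine hasSum_sum_of_ne_finset_zero fun p hp => if_neg fun h => hp ?_
  rw [hdvd] at h
  simp only [Finset.mem_product, Finset.mem_subtype, Multiset.mem_toFinset, Finset.mem_range]
  exact ⟨Multiset.count_pos.1 (by omega), h.trans_le (F.count_le_card _)⟩

theorem log_absNorm_mul_rpow_le {K : Type*} [Field K] [NumberField K] (I : Ideal (𝓞 K))
    (hI : I ≠ ⊥) {ε x : ℝ} (hε : 0 < ε) :
    Real.log (Ideal.absNorm I) * (Ideal.absNorm I : ℝ) ^ (-x) ≤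
      ε⁻¹ * (Ideal.absNorm I : ℝ) ^ (-(x - ε)) := by
  have h0 : 0 < Ideal.absNorm I := Nat.pos_of_ne_zero (Ideal.absNorm_eq_zero_iff.not.2 hI)
  have h1 : (0 : ℝ) < Ideal.absNorm I := by exact_mod_cast h0
  calc _ ≤ ((Ideal.absNorm I : ℝ) ^ ε / ε) * (Ideal.absNorm I : ℝ) ^ (-x) := by
        gcongr
        exact Real.log_le_rpow_div h1.le hε
    _ = _ := by
        rw [show -(x - ε) = ε + -x by ring, Real.rpow_add h1]; ring

section
variable {K : Type*} [Field K] [NumberField K] {ζK : ℂ → ℂ}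

theorem summable_absNorm_rpow
    (hζ_ser : ∀ s : ℂ, 1 < s.re → HasSum (fun I : {I : Ideal (𝓞 K) // I ≠ ⊥} =>
      ((Ideal.absNorm I.1 : ℕ) : ℂ) ^ (-s)) (ζK s)) {x : ℝ} (hx : 1 < x) :
    Summable fun I : {I : Ideal (𝓞 K) // I ≠ ⊥} => (Ideal.absNorm I.1 : ℝ) ^ (-x) := by
  refine (hζ_ser x (by simpa using hx)).summable.norm.congr fun I => ?_
  have h0 : 0 < Ideal.absNorm I.1 := Nat.pos_of_ne_zero (Ideal.absNorm_eq_zero_iff.not.2 I.2)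
  rw [Complex.norm_natCast_cpow_of_pos h0]
  simp

theorem summable_log_mul_absNorm_rpow
    (hζ_ser : ∀ s : ℂ, 1 < s.re → HasSum (fun I : {I : Ideal (𝓞 K) // I ≠ ⊥} =>
      ((Ideal.absNorm I.1 : ℕ) : ℂ) ^ (-s)) (ζK s)) {x : ℝ} (hx : 1 < x) :
    Summable fun I : {I : Ideal (𝓞 K) // I ≠ ⊥} =>
      Real.log (Ideal.absNorm I.1) * (Ideal.absNorm I.1 : ℝ) ^ (-x) := by
  have h := (summable_absNorm_rpow hζ_ser (x := x - (x - 1) / 2) (by linarith)).mul_left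
    ((x - 1) / 2)⁻¹
  refine Summable.of_nonneg_of_le (fun I => ?_) (fun I =>
    log_absNorm_mul_rpow_le I.1 I.2 (by linarith)) h
  exact mul_nonneg (Real.log_natCast_nonneg _) (Real.rpow_nonneg (Nat.cast_nonneg _) _)

theorem hasSum_neg_deriv_dedekindZeta
    (hζ_ser : ∀ s : ℂ, 1 < s.re → HasSum (fun I : {I : Ideal (𝓞 K) // I ≠ ⊥} =>
      ((Ideal.absNorm I.1 : ℕ) : ℂ) ^ (-s)) (ζK s)) {s : ℂ} (hs : 1 < s.re) :
    HasSum (fun I : {I : Ideal (𝓞 K) // I ≠ ⊥} =>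
      (Real.log (Ideal.absNorm I.1) : ℂ) * ((Ideal.absNorm I.1 : ℕ) : ℂ) ^ (-s))
      (-deriv ζK s) := by
  obtain ⟨x, hx1, hxs⟩ := exists_between hs
  have hne : ∀ I : {I : Ideal (𝓞 K) // I ≠ ⊥}, ((Ideal.absNorm I.1 : ℕ) : ℂ) ≠ 0 := fun I =>
    Nat.cast_ne_zero.2 (Ideal.absNorm_eq_zero_iff.not.2 I.2)
  have hd : ∀ (I : {I : Ideal (𝓞 K) // I ≠ ⊥}) (w : ℂ),
      HasDerivAt (fun w : ℂ => ((Ideal.absNorm I.1 : ℕ) : ℂ) ^ (-w))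
        (-((Real.log (Ideal.absNorm I.1) : ℂ) * ((Ideal.absNorm I.1 : ℕ) : ℂ) ^ (-w))) w :=
    fun I w => by
      have := (hasDerivAt_neg w).const_cpow (c := ((Ideal.absNorm I.1 : ℕ) : ℂ)) (Or.inl (hne I))
      convert this using 1
      rw [← Complex.natCast_log]; ring
  have h := Complex.hasSum_deriv_of_summable_norm (U := {w : ℂ | x < w.re}) (z := s)
    (summable_absNorm_rpow hζ_ser hx1)
    (fun I w _ => (hd I w).differentiableAt.differentiableWithinAt)
    (isOpen_lt continuous_const Complex.continuous_re)
    (fun I w hw => by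
      have h0 : 0 < Ideal.absNorm I.1 :=
        Nat.pos_of_ne_zero (Ideal.absNorm_eq_zero_iff.not.2 I.2)
      have h2 : (1 : ℝ) ≤ Ideal.absNorm I.1 := by exact_mod_cast h0
      rw [Complex.norm_natCast_cpow_of_pos h0]
      have hw : x < w.re := hw
      exact Real.rpow_le_rpow_of_exponent_le h2 (by simpa using hw.le)) hxs
  have he : deriv (fun w : ℂ => ∑' I : {I : Ideal (𝓞 K) // I ≠ ⊥},
      ((Ideal.absNorm I.1 : ℕ) : ℂ) ^ (-w)) s = deriv ζK s := by
    refine Filter.EventuallyEq.deriv_eq ?_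
    filter_upwards [(isOpen_lt continuous_const Complex.continuous_re).mem_nhds hs] with w hw
    exact (hζ_ser w hw).tsum_eq
  rw [he] at h
  simpa only [(hd _ s).deriv, neg_neg] using h.neg

set_option maxHeartbeats 1000000 in
open Classical in
theorem hasSum_prime_pow_mul_dedekindZeta
    (hζ_ser : ∀ s : ℂ, 1 < s.re → HasSum (fun I : {I : Ideal (𝓞 K) // I ≠ ⊥} =>
      ((Ideal.absNorm I.1 : ℕ) : ℂ) ^ (-s)) (ζK s)) {s : ℂ} (hs : 1 < s.re) :
    HasSum (fun p : {P : Ideal (𝓞 K) // Prime P} × ℕ =>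
      (Real.log (Ideal.absNorm p.1.1) : ℂ) *
        (((Ideal.absNorm (p.1.1 ^ (p.2 + 1)) : ℕ) : ℂ) ^ (-s) * ζK s))
      (-deriv ζK s) := by
  set G : {I : Ideal (𝓞 K) // I ≠ ⊥} × ({P : Ideal (𝓞 K) // Prime P} × ℕ) → ℂ := fun q =>
    (((if q.2.1.1 ^ (q.2.2 + 1) ∣ q.1.1 then Real.log (Ideal.absNorm q.2.1.1) else 0 : ℝ) : ℂ)) *
      ((Ideal.absNorm q.1.1 : ℕ) : ℂ) ^ (-s) with hG
  have hrow : ∀ I : {I : Ideal (𝓞 K) // I ≠ ⊥}, HasSum (fun p => G (I, p))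
      ((Real.log (Ideal.absNorm I.1) : ℂ) * ((Ideal.absNorm I.1 : ℕ) : ℂ) ^ (-s)) := fun I => by
    have h1 := (Complex.hasSum_ofReal (L := SummationFilter.unconditional _)).2
      (hasSum_log_absNorm_of_prime_pow_dvd I.2)
    exact h1.mul_right (((Ideal.absNorm I.1 : ℕ) : ℂ) ^ (-s))
  have hrow' : ∀ I : {I : Ideal (𝓞 K) // I ≠ ⊥}, HasSum (fun p => ‖G (I, p)‖)
      (Real.log (Ideal.absNorm I.1) * (Ideal.absNorm I.1 : ℝ) ^ (-s.re)) := fun I => by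
    have h0 : 0 < Ideal.absNorm I.1 :=
      Nat.pos_of_ne_zero (Ideal.absNorm_eq_zero_iff.not.2 I.2)
    have e : (fun p => ‖G (I, p)‖) = fun p : {P : Ideal (𝓞 K) // Prime P} × ℕ =>
        (if p.1.1 ^ (p.2 + 1) ∣ I.1 then Real.log (Ideal.absNorm p.1.1) else 0) *
          (Ideal.absNorm I.1 : ℝ) ^ (-s.re) := by
      funext p
      rw [hG, norm_mul, Complex.norm_natCast_cpow_of_pos h0, Complex.neg_re, Complex.norm_real,
        Real.norm_of_nonneg]
      split_ifs
      · exact Real.log_natCast_nonneg _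
      · exact le_rfl
    rw [e]
    exact (hasSum_log_absNorm_of_prime_pow_dvd I.2).mul_right _
  have hsum : Summable G := by
    refine Summable.of_norm ((summable_prod_of_nonneg fun q => norm_nonneg _).2
      ⟨fun I => (hrow' I).summable, ?_⟩)
    refine (summable_log_mul_absNorm_rpow hζ_ser hs).congr fun I => (hrow' I).tsum_eq.symm
  have htot := hsum.hasSum.prod_fiberwise hrow
  have hval := htot.unique (hasSum_neg_deriv_dedekindZeta hζ_ser hs)
  have hswap : HasSum (fun q => G (Equiv.prodComm _ _ q)) (-deriv ζK s) :=
    (Equiv.hasSum_iff (Equiv.prodComm _ _)).2 (hval ▸ hsum.hasSum)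
  refine hswap.prod_fiberwise fun p => ?_
  have hp0 : p.1.1 ≠ ⊥ := p.1.2.ne_zero
  have hq0 : p.1.1 ^ (p.2 + 1) ≠ ⊥ := pow_ne_zero _ hp0
  set g : {I : Ideal (𝓞 K) // I ≠ ⊥} → {I : Ideal (𝓞 K) // I ≠ ⊥} := fun J =>
    ⟨p.1.1 ^ (p.2 + 1) * J.1, mul_ne_zero hq0 J.2⟩ with hg
  have hginj : Function.Injective g := fun J J' h => by
    have := congrArg Subtype.val h
    exact Subtype.ext (mul_left_cancel₀ hq0 this)
  refine (hginj.hasSum_iff fun I hI => ?_).1 ?_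
  · have : ¬ p.1.1 ^ (p.2 + 1) ∣ I.1 := fun ⟨J, hJ⟩ => by
      refine hI ⟨⟨J, fun h => I.2 ?_⟩, Subtype.ext hJ.symm⟩
      rw [hJ, h]; exact mul_zero _
    simp [hG, this]
  · have e : G ∘ Equiv.prodComm _ _ ∘ (fun I => (p, I)) ∘ g = fun J =>
        (Real.log (Ideal.absNorm p.1.1) : ℂ) *
          (((Ideal.absNorm (p.1.1 ^ (p.2 + 1)) : ℕ) : ℂ) ^ (-s) *
            ((Ideal.absNorm J.1 : ℕ) : ℂ) ^ (-s)) := by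
      funext J
      have h1 : p.1.1 ^ (p.2 + 1) ∣ (g J).1 := Dvd.intro _ rfl
      have h2 : ((Ideal.absNorm (g J).1 : ℕ) : ℂ) ^ (-s) =
          ((Ideal.absNorm (p.1.1 ^ (p.2 + 1)) : ℕ) : ℂ) ^ (-s) *
            ((Ideal.absNorm J.1 : ℕ) : ℂ) ^ (-s) := by
        rw [← Complex.natCast_mul_natCast_cpow, ← Nat.cast_mul, ← map_mul]
      change ((if p.1.1 ^ (p.2 + 1) ∣ (g J).1 then Real.log (Ideal.absNorm p.1.1) else 0 : ℝ) : ℂ) *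
        ((Ideal.absNorm (g J).1 : ℕ) : ℂ) ^ (-s) = _
      rw [if_pos h1, h2]
    change HasSum (G ∘ Equiv.prodComm _ _ ∘ (fun I => (p, I)) ∘ g) _
    rw [e]
    exact ((hζ_ser s hs).mul_left (((Ideal.absNorm (p.1.1 ^ (p.2 + 1)) : ℕ) : ℂ) ^ (-s))).mul_left
      (Real.log (Ideal.absNorm p.1.1) : ℂ)
end

theorem not_eventually_eq_zero_of_differentiable {F : ℂ → ℂ} (hF : Differentiable ℂ F) {c : ℂ}
    (hc : F c ≠ 0) (z : ℂ) : ¬ ∀ᶠ w in 𝓝 z, F w = 0 := fun h => hc <| by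
  have hA : AnalyticOnNhd ℂ F Set.univ := fun w _ => hF.analyticAt w
  exact hA.eqOn_zero_of_preconnected_of_eventuallyEq_zero isPreconnected_univ (Set.mem_univ z) h
    (Set.mem_univ c)

theorem tendsto_sub_mul_logDeriv {F : ℂ → ℂ} {z : ℂ} (hF : AnalyticAt ℂ F z)
    (h0 : ¬ ∀ᶠ w in 𝓝 z, F w = 0) :
    ∃ m : ℕ, (m = 0 ↔ F z ≠ 0) ∧
      Tendsto (fun w => (w - z) * (deriv F w / F w)) (𝓝[≠] z) (𝓝 (m : ℂ)) := by
  obtain ⟨m, g, hg, hgz, hFg⟩ := hF.exists_eventuallyEq_pow_smul_nonzero_iff.2 h0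
  refine ⟨m, ?_, ?_⟩
  · rw [hFg.self_of_nhds, sub_self, smul_eq_mul]
    constructor
    · rintro rfl; simpa using hgz
    · intro h
      by_contra hm
      exact h (by rw [zero_pow hm, zero_mul])
  · have hlim : Tendsto (fun w => (m : ℂ) + (w - z) * (deriv g w / g w)) (𝓝[≠] z) (𝓝 (m : ℂ)) := by
      have hc : ContinuousAt (fun w => (m : ℂ) + (w - z) * (deriv g w / g w)) z :=
        continuousAt_const.add ((continuousAt_id.sub continuousAt_const).mul
          (hg.deriv.continuousAt.div hg.continuousAt hgz))
      have := hc.tendsto.mono_left (nhdsWithin_le_nhds (s := {z}ᶜ))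
      simpa using this
    refine hlim.congr' ?_
    have h1 : ∀ᶠ w in 𝓝[≠] z, ∀ᶠ v in 𝓝 w, F v = (v - z) ^ m • g v :=
      hFg.eventually_nhds.filter_mono nhdsWithin_le_nhds
    have h2 : ∀ᶠ w in 𝓝[≠] z, g w ≠ 0 :=
      (hg.continuousAt.eventually_ne hgz).filter_mono nhdsWithin_le_nhds
    have h3 : ∀ᶠ w in 𝓝[≠] z, AnalyticAt ℂ g w :=
      hg.eventually_analyticAt.filter_mono nhdsWithin_le_nhds
    filter_upwards [h1, h2, h3, self_mem_nhdsWithin] with w hw1 hw2 hw3 hw4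
    have hwz : w - z ≠ 0 := sub_ne_zero.2 hw4
    have hd : HasDerivAt (fun v => (v - z) ^ m • g v)
        ((m * (w - z) ^ (m - 1) * 1) * g w + (w - z) ^ m * deriv g w) w :=
      (((hasDerivAt_id w).sub_const z).pow m).mul hw3.differentiableAt.hasDerivAt
    have hFd : deriv F w = _ := (Filter.EventuallyEq.deriv_eq hw1).trans hd.deriv
    rw [hFd, hw1.self_of_nhds, smul_eq_mul]
    rcases Nat.eq_zero_or_pos m with rfl | hm
    · simp
    · obtain ⟨n, rfl⟩ : ∃ n, m = n + 1 := ⟨m - 1, by omega⟩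
      rw [Nat.add_sub_cancel]
      field_simp
      ring

section
variable {K : Type*} [Field K] [NumberField K] {ζK : ℂ → ℂ}

theorem dedekindZeta_ofReal_ne_zero
    (hζ_ser : ∀ s : ℂ, 1 < s.re → HasSum (fun I : {I : Ideal (𝓞 K) // I ≠ ⊥} =>
      ((Ideal.absNorm I.1 : ℕ) : ℂ) ^ (-s)) (ζK s)) {x : ℝ} (hx : 1 < x) : ζK x ≠ 0 := by
  have h := Complex.hasSum_re (hζ_ser x (by simpa using hx))
  have e : ∀ n : ℕ, ((n : ℂ) ^ (-(x : ℂ))).re = (n : ℝ) ^ (-x) := fun n => by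
    rw [← Complex.ofReal_neg, ← Complex.ofReal_natCast, ← Complex.ofReal_cpow (Nat.cast_nonneg _),
      Complex.ofReal_re]
  simp only [e] at h
  have h1 := le_hasSum h ⟨⊤, top_ne_bot⟩ fun I _ => Real.rpow_nonneg (Nat.cast_nonneg _) _
  intro h0
  rw [h0] at h1
  norm_num at h1

theorem summable_log_mul_prime_pow_rpow
    (hζ_ser : ∀ s : ℂ, 1 < s.re → HasSum (fun I : {I : Ideal (𝓞 K) // I ≠ ⊥} =>
      ((Ideal.absNorm I.1 : ℕ) : ℂ) ^ (-s)) (ζK s)) {s : ℂ} (hs : 1 < s.re) :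
    Summable fun p : {P : Ideal (𝓞 K) // Prime P} × ℕ =>
      (Real.log (Ideal.absNorm p.1.1) : ℂ) *
        ((Ideal.absNorm (p.1.1 ^ (p.2 + 1)) : ℕ) : ℂ) ^ (-s) := by
  have h := (hasSum_prime_pow_mul_dedekindZeta hζ_ser (s := (s.re : ℂ)) (by simpa using hs)).summable
  simp only [← mul_assoc] at h
  have h2 := (summable_mul_right_iff (dedekindZeta_ofReal_ne_zero hζ_ser hs)).1 h
  refine Summable.of_norm (h2.norm.congr fun p => ?_)
  have h0 : 0 < Ideal.absNorm (p.1.1 ^ (p.2 + 1)) :=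
    Nat.pos_of_ne_zero (Ideal.absNorm_eq_zero_iff.not.2 (pow_ne_zero _ p.1.2.ne_zero))
  rw [norm_mul, norm_mul, Complex.norm_natCast_cpow_of_pos h0, Complex.norm_natCast_cpow_of_pos h0]
  simp

/-- The Dirichlet series of the negative logarithmic derivative. -/
noncomputable def primePowSum (K : Type*) [Field K] [NumberField K] (s : ℂ) : ℂ :=
  ∑' p : {P : Ideal (𝓞 K) // Prime P} × ℕ, (Real.log (Ideal.absNorm p.1.1) : ℂ) *
    ((Ideal.absNorm (p.1.1 ^ (p.2 + 1)) : ℕ) : ℂ) ^ (-s)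

theorem primePowSum_mul_dedekindZeta
    (hζ_ser : ∀ s : ℂ, 1 < s.re → HasSum (fun I : {I : Ideal (𝓞 K) // I ≠ ⊥} =>
      ((Ideal.absNorm I.1 : ℕ) : ℂ) ^ (-s)) (ζK s)) {s : ℂ} (hs : 1 < s.re) :
    primePowSum K s * ζK s = -deriv ζK s := by
  rw [← (hasSum_prime_pow_mul_dedekindZeta hζ_ser hs).tsum_eq, primePowSum,
    ← (summable_log_mul_prime_pow_rpow hζ_ser hs).tsum_mul_right]
  simp only [mul_assoc]

theorem norm_primePowSum_le
    (hζ_ser : ∀ s : ℂ, 1 < s.re → HasSum (fun I : {I : Ideal (𝓞 K) // I ≠ ⊥} =>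
      ((Ideal.absNorm I.1 : ℕ) : ℂ) ^ (-s)) (ζK s)) {x : ℝ} (hx : 1 < x) :
    ∃ M, ∀ s : ℂ, x ≤ s.re → ‖primePowSum K s‖ ≤ M := by
  have h := (summable_log_mul_prime_pow_rpow hζ_ser (s := x) (by simpa using hx)).norm
  refine ⟨_, fun s hs => tsum_of_norm_bounded h.hasSum fun p => ?_⟩
  have h0 : 0 < Ideal.absNorm (p.1.1 ^ (p.2 + 1)) :=
    Nat.pos_of_ne_zero (Ideal.absNorm_eq_zero_iff.not.2 (pow_ne_zero _ p.1.2.ne_zero))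
  have h2 : (1 : ℝ) ≤ Ideal.absNorm (p.1.1 ^ (p.2 + 1)) := by exact_mod_cast h0
  rw [norm_mul, norm_mul, Complex.norm_natCast_cpow_of_pos h0, Complex.norm_natCast_cpow_of_pos h0]
  exact mul_le_mul_of_nonneg_left (Real.rpow_le_rpow_of_exponent_le h2 (by simpa using hs))
    (norm_nonneg _)

theorem re_primePowSum_three_four_one
    (hζ_ser : ∀ s : ℂ, 1 < s.re → HasSum (fun I : {I : Ideal (𝓞 K) // I ≠ ⊥} =>
      ((Ideal.absNorm I.1 : ℕ) : ℂ) ^ (-s)) (ζK s)) {x : ℝ} (hx : 1 < x) (t : ℝ) :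
    0 ≤ (3 * primePowSum K x + 4 * primePowSum K (x + t * I) + primePowSum K (x + 2 * t * I)).re := by
  have h1 := (summable_log_mul_prime_pow_rpow hζ_ser (s := x) (by simpa using hx)).hasSum
  have h2 := (summable_log_mul_prime_pow_rpow hζ_ser (s := x + t * I) (by simpa using hx)).hasSum
  have h3 := (summable_log_mul_prime_pow_rpow hζ_ser (s := x + 2 * t * I)
    (by simpa using hx)).hasSum
  have h := Complex.hasSum_re (((h1.mul_left 3).add (h2.mul_left 4)).add h3)
  refine h.nonneg fun p => ?_
  have h0 : Ideal.absNorm (p.1.1 ^ (p.2 + 1)) ≠ 0 :=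
    Ideal.absNorm_eq_zero_iff.not.2 (pow_ne_zero _ p.1.2.ne_zero)
  set n := Ideal.absNorm (p.1.1 ^ (p.2 + 1)) with hn
  have hn0 : (n : ℂ) ≠ 0 := Nat.cast_ne_zero.2 h0
  set u : ℂ := (n : ℂ) ^ (-(t * I)) with hu
  have hu1 : ‖u‖ = 1 := by
    rw [hu, Complex.norm_natCast_cpow_of_pos (Nat.pos_of_ne_zero h0)]; simp
  have e1 : (n : ℂ) ^ (-((x : ℂ) + t * I)) = (n : ℂ) ^ (-(x : ℂ)) * u := by
    rw [neg_add, Complex.cpow_add _ _ hn0]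
  have e2 : (n : ℂ) ^ (-((x : ℂ) + 2 * t * I)) = (n : ℂ) ^ (-(x : ℂ)) * (u * u) := by
    rw [← Complex.cpow_add _ _ hn0, ← Complex.cpow_add _ _ hn0]; congr 1; ring
  have e3 : (n : ℂ) ^ (-(x : ℂ)) = (((n : ℝ) ^ (-x) : ℝ) : ℂ) := by
    rw [Complex.ofReal_cpow (Nat.cast_nonneg _)]; simp
  have e4 : u.re * u.re + u.im * u.im = 1 := by
    rw [← Complex.normSq_apply, Complex.normSq_eq_norm_sq, hu1, one_pow]
  have key : 3 * ((Real.log (Ideal.absNorm p.1.1) : ℂ) * (n : ℂ) ^ (-(x : ℂ))) +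
      4 * ((Real.log (Ideal.absNorm p.1.1) : ℂ) * (n : ℂ) ^ (-((x : ℂ) + t * I))) +
      (Real.log (Ideal.absNorm p.1.1) : ℂ) * (n : ℂ) ^ (-((x : ℂ) + 2 * t * I)) =
      ((Real.log (Ideal.absNorm p.1.1) * (n : ℝ) ^ (-x) : ℝ) : ℂ) * (3 + 4 * u + u * u) := by
    rw [e1, e2, e3]; push_cast; ring
  rw [key, Complex.re_ofReal_mul]
  refine mul_nonneg (mul_nonneg (Real.log_natCast_nonneg _)
    (Real.rpow_nonneg (Nat.cast_nonneg _) _)) ?_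
  have : (3 + 4 * u + u * u).re = 2 * (1 + u.re) ^ 2 := by
    simp; nlinarith
  rw [this]; positivity

theorem logDeriv_sub_one_mul_dedekindZeta {F : ℂ → ℂ}
    (hζ_an : ∀ s : ℂ, s ≠ 1 → DifferentiableAt ℂ ζK s)
    (hζ_ser : ∀ s : ℂ, 1 < s.re → HasSum (fun I : {I : Ideal (𝓞 K) // I ≠ ⊥} =>
      ((Ideal.absNorm I.1 : ℕ) : ℂ) ^ (-s)) (ζK s))
    (hFζ : ∀ s, s ≠ 1 → F s = (s - 1) * ζK s) {s : ℂ} (hs : 1 < s.re) (h0 : F s ≠ 0) :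
    primePowSum K s = 1 / (s - 1) - deriv F s / F s := by
  have hs1 : s ≠ 1 := fun h => by rw [h, Complex.one_re] at hs; exact hs.false
  have hζ0 : ζK s ≠ 0 := fun h => h0 (by rw [hFζ s hs1, h, mul_zero])
  have hs1' : s - 1 ≠ 0 := sub_ne_zero.2 hs1
  have hd : HasDerivAt (fun w => (w - 1) * ζK w) (1 * ζK s + (s - 1) * deriv ζK s) s :=
    ((hasDerivAt_id s).sub_const 1).mul (hζ_an s hs1).hasDerivAt
  have he : F =ᶠ[𝓝 s] fun w => (w - 1) * ζK w := by
    filter_upwards [isOpen_ne.mem_nhds hs1] with w hw using hFζ w hw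
  rw [he.deriv_eq, hd.deriv, hFζ s hs1]
  have h := primePowSum_mul_dedekindZeta hζ_ser hs
  have h' : deriv ζK s = -(primePowSum K s * ζK s) := by rw [h, neg_neg]
  rw [h']
  field_simp
  ring

theorem tendsto_mul_primePowSum {F : ℂ → ℂ}
    (hζ_an : ∀ s : ℂ, s ≠ 1 → DifferentiableAt ℂ ζK s)
    (hζ_ser : ∀ s : ℂ, 1 < s.re → HasSum (fun I : {I : Ideal (𝓞 K) // I ≠ ⊥} =>
      ((Ideal.absNorm I.1 : ℕ) : ℂ) ^ (-s)) (ζK s))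
    (hF : Differentiable ℂ F) (hF1 : F 1 ≠ 0)
    (hFζ : ∀ s, s ≠ 1 → F s = (s - 1) * ζK s) {z : ℂ} (hz : 1 ≤ z.re) :
    ∃ m : ℕ, (m = 0 ↔ F z ≠ 0) ∧
      Tendsto (fun ε : ℝ => (ε : ℂ) * primePowSum K (z + ε) - ε / (z + ε - 1)) (𝓝[>] 0)
        (𝓝 (-(m : ℂ))) := by
  have hfo := not_eventually_eq_zero_of_differentiable hF hF1 z
  obtain ⟨m, hm, h⟩ := tendsto_sub_mul_logDeriv (hF.analyticAt z) hfo
  refine ⟨m, hm, ?_⟩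
  have hcurve : Tendsto (fun ε : ℝ => z + ε) (𝓝[>] 0) (𝓝[≠] z) := by
    refine tendsto_nhdsWithin_iff.2 ⟨?_, ?_⟩
    · have hc : Continuous fun ε : ℝ => z + (ε : ℂ) := by fun_prop
      have := hc.tendsto 0
      simp only [Complex.ofReal_zero, add_zero] at this
      exact this.mono_left nhdsWithin_le_nhds
    · filter_upwards [self_mem_nhdsWithin] with ε hε
      have hε : 0 < ε := hε
      simpa using hε.ne'
  have hne : ∀ᶠ w in 𝓝[≠] z, F w ≠ 0 :=
    (hF.analyticAt z).eventually_eq_zero_or_eventually_ne_zero.resolve_left hfo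
  refine (h.comp hcurve).neg.congr' ?_
  filter_upwards [hcurve.eventually hne, self_mem_nhdsWithin] with ε h0 hε
  have hε : 0 < ε := hε
  have hre : 1 < (z + ε).re := by simp; linarith
  rw [logDeriv_sub_one_mul_dedekindZeta hζ_an hζ_ser hFζ hre h0]
  simp only [Function.comp_apply]
  ring

/-- The Dedekind zeta function has no zero in the closed half-plane `1 ≤ re s`. -/
theorem entire_ne_zero_of_one_le_re {F : ℂ → ℂ}
    (hζ_an : ∀ s : ℂ, s ≠ 1 → DifferentiableAt ℂ ζK s)
    (hζ_ser : ∀ s : ℂ, 1 < s.re → HasSum (fun I : {I : Ideal (𝓞 K) // I ≠ ⊥} =>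
      ((Ideal.absNorm I.1 : ℕ) : ℂ) ^ (-s)) (ζK s))
    (hF : Differentiable ℂ F) (hF1 : F 1 ≠ 0)
    (hFζ : ∀ s, s ≠ 1 → F s = (s - 1) * ζK s) {z : ℂ} (hz : 1 ≤ z.re) : F z ≠ 0 := by
  by_cases hz1 : z = 1
  · rwa [hz1]
  have hquot : ∀ w : ℂ, w ≠ 1 → Tendsto (fun ε : ℝ => (ε : ℂ) / (w + ε - 1)) (𝓝[>] 0) (𝓝 0) := by
    intro w hw
    have hc : ContinuousAt (fun ε : ℝ => (ε : ℂ) / (w + ε - 1)) 0 := by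
      refine ContinuousAt.div (by fun_prop) (by fun_prop) ?_
      simpa using sub_ne_zero.2 hw
    have := hc.tendsto.mono_left (nhdsWithin_le_nhds (s := Set.Ioi 0))
    simpa using this
  have hlim : ∀ w : ℂ, 1 ≤ w.re → w ≠ 1 → ∃ m : ℕ, (m = 0 ↔ F w ≠ 0) ∧
      Tendsto (fun ε : ℝ => (ε : ℂ) * primePowSum K (w + ε)) (𝓝[>] 0) (𝓝 (-(m : ℂ))) := by
    intro w hw hw1
    obtain ⟨m, hm, h⟩ := tendsto_mul_primePowSum hζ_an hζ_ser hF hF1 hFζ hw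
    refine ⟨m, hm, ?_⟩
    simpa using h.add (hquot w hw1)
  obtain ⟨m, hm, h⟩ := hlim z hz hz1
  refine hm.1 ?_
  have hε0 : Tendsto (fun ε : ℝ => (ε : ℂ)) (𝓝[>] 0) (𝓝 0) := by
    have := (Complex.continuous_ofReal.tendsto 0).mono_left (nhdsWithin_le_nhds (s := Set.Ioi 0))
    simpa using this
  rcases hz.lt_or_eq with hz' | hz'
  · obtain ⟨M, hM⟩ := norm_primePowSum_le hζ_ser hz'
    have h0 : Tendsto (fun ε : ℝ => (ε : ℂ) * primePowSum K (z + ε)) (𝓝[>] 0) (𝓝 0) := by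
      refine squeeze_zero_norm' (a := fun ε : ℝ => ‖(ε : ℂ)‖ * M) ?_ ?_
      · filter_upwards [self_mem_nhdsWithin] with ε hε
        have hε : 0 < ε := hε
        rw [norm_mul]
        gcongr
        exact hM _ (by simpa using hε.le)
      · simpa using (hε0.norm.mul_const M)
    have := tendsto_nhds_unique h h0
    simpa using this
  · have hzt : z = 1 + z.im * I := by
      apply Complex.ext <;> simp [← hz']
    have him : z.im ≠ 0 := fun h => hz1 (by rw [hzt, h]; simp)
    obtain ⟨m₁, hm₁, h₁⟩ := tendsto_mul_primePowSum hζ_an hζ_ser hF hF1 hFζ (z := 1) (by simp)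
    obtain ⟨m₂, hm₂, h₂⟩ := hlim (1 + 2 * z.im * I) (by simp) fun h => by
      have := congrArg Complex.im h
      simp at this
      exact him this
    have hm₁0 : m₁ = 0 := hm₁.2 hF1
    rw [hm₁0] at h₁
    have h₁' : Tendsto (fun ε : ℝ => (ε : ℂ) * primePowSum K (1 + ε)) (𝓝[>] 0) (𝓝 1) := by
      have h3 : Tendsto (fun ε : ℝ => (ε : ℂ) / (1 + ε - 1)) (𝓝[>] 0) (𝓝 1) := by
        refine tendsto_const_nhds.congr' ?_
        filter_upwards [self_mem_nhdsWithin] with ε hε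
        have hε : (ε : ℂ) ≠ 0 := Complex.ofReal_ne_zero.2 (ne_of_gt hε)
        rw [add_sub_cancel_left, div_self hε]
      simpa using h₁.add h3
    have hsum := ((h₁'.const_mul 3).add (h.const_mul 4)).add h₂
    have hre := (Complex.continuous_re.tendsto _).comp hsum
    have hnonneg : 0 ≤ (3 * 1 + 4 * -(m : ℂ) + -(m₂ : ℂ)).re := by
      refine ge_of_tendsto hre ?_
      filter_upwards [self_mem_nhdsWithin] with ε hε
      have hε : 0 < ε := hε
      have key := re_primePowSum_three_four_one hζ_ser (x := 1 + ε) (by linarith) z.im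
      have e1 : ((1 + ε : ℝ) : ℂ) + z.im * I = z + ε := by
        nth_rewrite 2 [hzt]; push_cast; ring
      have e2 : ((1 + ε : ℝ) : ℂ) + 2 * z.im * I = 1 + 2 * z.im * I + ε := by push_cast; ring
      rw [e1, e2, Complex.ofReal_add, Complex.ofReal_one] at key
      have e3 : 3 * ((ε : ℂ) * primePowSum K (1 + ε)) + 4 * (ε * primePowSum K (z + ε)) +
          ε * primePowSum K (1 + 2 * z.im * I + ε) = (ε : ℂ) * (3 * primePowSum K (1 + ε) +
          4 * primePowSum K (z + ε) + primePowSum K (1 + 2 * z.im * I + ε)) := by ring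
      simp only [Function.comp_apply]
      rw [e3, Complex.re_ofReal_mul]
      exact mul_nonneg hε.le key
    have h5 : (0 : ℝ) ≤ 3 - 4 * m - m₂ := by
      simpa [← sub_eq_add_neg] using hnonneg
    by_contra hm0
    have h6 : (1 : ℝ) ≤ m := by exact_mod_cast Nat.one_le_iff_ne_zero.2 hm0
    have h7 : (0 : ℝ) ≤ m₂ := Nat.cast_nonneg _
    linarith
end

theorem exists_eq_pow_analyticOrderNatAt_mul {F : ℂ → ℂ} (hF : Differentiable ℂ F) {a : ℂ}
    (h0 : ¬ ∀ᶠ w in 𝓝 a, F w = 0) :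
    ∃ H : ℂ → ℂ, Differentiable ℂ H ∧ H a ≠ 0 ∧
      ∀ z, F z = (z - a) ^ analyticOrderNatAt F a * H z := by
  have hFa := hF.analyticAt a
  have ho : analyticOrderAt F a ≠ ⊤ := fun h => h0 (analyticOrderAt_eq_top.1 h)
  obtain ⟨g, hg, hga, hFg⟩ := (hFa.analyticOrderNatAt_eq_iff ho).1 rfl
  set m := analyticOrderNatAt F a with hm
  set H : ℂ → ℂ := Function.update (fun z => F z / (z - a) ^ m) a (g a) with hH
  have hHa : H a = g a := Function.update_self _ _ _
  have hHz : ∀ z, z ≠ a → H z = F z / (z - a) ^ m := fun z hz => Function.update_of_ne hz _ _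
  have hz0 : ∀ z, z ≠ a → (z - a) ^ m ≠ 0 := fun z hz => pow_ne_zero _ (sub_ne_zero.2 hz)
  refine ⟨H, fun z => ?_, hHa ▸ hga, fun z => ?_⟩
  · rcases eq_or_ne z a with rfl | hz
    · refine hg.differentiableAt.congr_of_eventuallyEq ?_
      filter_upwards [hFg] with w hw
      rcases eq_or_ne w z with rfl | hwz
      · exact hHa
      · rw [hHz w hwz, hw, smul_eq_mul, mul_div_cancel_left₀ _ (hz0 w hwz)]
    · have hd : DifferentiableAt ℂ (fun w : ℂ => (w - a) ^ m) z := by fun_prop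
      refine ((hF z).fun_div hd (hz0 z hz)).congr_of_eventuallyEq ?_
      filter_upwards [isOpen_ne.mem_nhds hz] with w hw using hHz w hw
  · rcases eq_or_ne z a with rfl | hz
    · rw [hHa]
      simpa using hFg.self_of_nhds
    · rw [hHz z hz, mul_div_cancel₀ _ (hz0 z hz)]

theorem exists_eq_prod_pow_analyticOrderNatAt_mul {F : ℂ → ℂ} (hF : Differentiable ℂ F) {c : ℂ}
    (hc : F c ≠ 0) (Z : Finset ℂ) :
    ∃ G : ℂ → ℂ, Differentiable ℂ G ∧ (∀ ρ ∈ Z, G ρ ≠ 0) ∧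
      ∀ z, F z = (∏ ρ ∈ Z, (z - ρ) ^ analyticOrderNatAt F ρ) * G z := by
  induction Z using Finset.induction_on with
  | empty => exact ⟨F, hF, by simp, by simp⟩
  | insert a Z ha ih =>
    obtain ⟨G, hG, hGZ, hFG⟩ := ih
    have hGc : G c ≠ 0 := fun h => hc (by rw [hFG, h, mul_zero])
    obtain ⟨H, hH, hHa, hGH⟩ := exists_eq_pow_analyticOrderNatAt_mul hG
      (not_eventually_eq_zero_of_differentiable hG hGc a)
    have hord : analyticOrderNatAt F a = analyticOrderNatAt G a := by
      have ho : analyticOrderAt F a ≠ ⊤ := fun h =>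
        not_eventually_eq_zero_of_differentiable hF hc a (analyticOrderAt_eq_top.1 h)
      refine ((hF.analyticAt a).analyticOrderNatAt_eq_iff ho).2
        ⟨fun z => (∏ ρ ∈ Z, (z - ρ) ^ analyticOrderNatAt F ρ) * H z, ?_, ?_, ?_⟩
      · have hd : Differentiable ℂ fun z => (∏ ρ ∈ Z, (z - ρ) ^ analyticOrderNatAt F ρ) * H z := by
          fun_prop
        exact hd.analyticAt a
      · refine mul_ne_zero (Finset.prod_ne_zero_iff.2 fun ρ hρ => pow_ne_zero _ ?_) hHa
        exact sub_ne_zero.2 fun h => ha (h ▸ hρ)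
      · refine Eventually.of_forall fun z => ?_
        rw [hFG, hGH, smul_eq_mul]; ring
    refine ⟨H, hH, fun ρ hρ => ?_, fun z => ?_⟩
    · rcases Finset.mem_insert.1 hρ with rfl | hρ
      · exact hHa
      · intro h
        exact hGZ ρ hρ (by rw [hGH, h, mul_zero])
    · rw [Finset.prod_insert ha, hFG, hGH, hord]; ring

theorem exists_finset_zeros {F : ℂ → ℂ} (hF : Differentiable ℂ F) {c : ℂ} (hc : F c ≠ 0) (r : ℝ) :
    ∃ Z : Finset ℂ, ∀ z, z ∈ Z ↔ ‖z‖ ≤ r ∧ F z = 0 := by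
  have hfin : (Metric.closedBall (0 : ℂ) r ∩ {z | F z = 0}).Finite := by
    by_contra hinf
    obtain ⟨z, -, hz⟩ := Set.Infinite.exists_accPt_of_subset_isCompact hinf
      (isCompact_closedBall 0 r) Set.inter_subset_left
    rcases (hF.analyticAt z).eventually_eq_zero_or_eventually_ne_zero with h | h
    · exact not_eventually_eq_zero_of_differentiable hF hc z h
    · have h2 := (accPt_iff_frequently_nhdsNE.1 hz).and_eventually h
      obtain ⟨w, hw1, hw2⟩ := h2.exists
      exact hw2 hw1.2
  refine ⟨hfin.toFinset, fun z => ?_⟩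
  simp [Set.Finite.mem_toFinset]

theorem norm_deriv_div_le_of_norm_le {G : ℂ → ℂ} (hG : Differentiable ℂ G) {M r : ℝ} (hM : 0 < M)
    (hr : 0 < r) (hG0 : ∀ z, ‖z‖ < r → G z ≠ 0)
    (hb : ∀ z, ‖z‖ < r → ‖G z‖ ≤ Real.exp M * ‖G 0‖) {s : ℂ} (hs : ‖s‖ ≤ r / 4) :
    ‖deriv G s / G s‖ ≤ 8 * M / r := by
  have hmem : ∀ z : ℂ, z ∈ Metric.ball (0 : ℂ) r ↔ ‖z‖ < r := fun z => mem_ball_zero_iff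
  have hG00 : G 0 ≠ 0 := hG0 0 (by simpa using hr)
  have hd : DifferentiableOn ℂ (fun z => deriv G z / G z) (Metric.ball 0 r) := fun z hz =>
    (((hG.analyticAt z).deriv.differentiableAt).fun_div (hG z)
      (hG0 z ((hmem z).1 hz))).differentiableWithinAt
  obtain ⟨f, hf0, hf⟩ := hd.isExactOn_ball.with_val_at 0 0
  have hexp : ∀ z, ‖z‖ < r → G z = G 0 * Complex.exp (f z) := by
    have hdz : ∀ z ∈ Metric.ball (0 : ℂ) r,
        HasDerivAt (fun z => G z * Complex.exp (-f z)) 0 z := fun z hz => by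
      have h := (hG z).hasDerivAt.mul (hf z hz).neg.cexp
      have e : G z * (deriv G z / G z) = deriv G z :=
        mul_div_cancel₀ _ (hG0 z ((hmem z).1 hz))
      have e0 : deriv G z * Complex.exp (-f z) +
          G z * (Complex.exp (-f z) * -(deriv G z / G z)) = 0 := by
        linear_combination -Complex.exp (-f z) * e
      rw [← e0]
      exact h
    intro z hz
    have hconst := (convex_ball (0 : ℂ) r).is_const_of_fderivWithin_eq_zero (𝕜 := ℂ)
      (f := fun z => G z * Complex.exp (-f z))
      (fun z hz => (hdz z hz).differentiableAt.differentiableWithinAt)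
      (fun z hz => by
        rw [fderivWithin_of_isOpen Metric.isOpen_ball hz]
        ext
        simp [(hdz z hz).deriv])
      ((hmem z).2 hz) ((hmem 0).2 (by simpa using hr))
    simp only [hf0, neg_zero, Complex.exp_zero, mul_one] at hconst
    rw [← hconst, mul_assoc, ← Complex.exp_add, neg_add_cancel, Complex.exp_zero, mul_one]
  have hmaps : Set.MapsTo f (Metric.ball 0 r) {z | z.re ≤ M} := fun z hz => by
    have hz' := (hmem z).1 hz
    have h := hb z hz'
    rw [hexp z hz', norm_mul, Complex.norm_exp, mul_comm] at h
    exact Real.exp_le_exp.1 (le_of_mul_le_mul_right h (norm_pos_iff.2 hG00))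
  have hfd : DifferentiableOn ℂ f (Metric.ball 0 r) := fun z hz =>
    (hf z hz).differentiableAt.differentiableWithinAt
  have hbc : ∀ z, ‖z‖ ≤ r / 2 → ‖f z‖ ≤ 2 * M := fun z hz => by
    refine (Complex.borelCaratheodory_zero hM hfd hmaps hr ((hmem z).2 (by linarith)) hf0).trans ?_
    rw [div_le_iff₀ (by linarith)]
    nlinarith
  have hsub : Metric.closedBall s (r / 4) ⊆ Metric.ball 0 r := fun z hz => by
    rw [hmem]
    have : ‖z‖ ≤ ‖z - s‖ + ‖s‖ := by simpa using norm_add_le (z - s) s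
    rw [mem_closedBall_iff_norm] at hz
    linarith
  have hsr : s ∈ Metric.ball (0 : ℂ) r := hsub (Metric.mem_closedBall_self (by linarith))
  rw [← (hf s hsr).deriv]
  refine (Complex.norm_deriv_le_of_forall_mem_sphere_norm_le (R := r / 4) (C := 2 * M)
    (by linarith) ?_ fun z hz => hbc z ?_).trans_eq ?_
  · exact (hfd.mono (Metric.closure_ball_subset_closedBall.trans hsub)).diffContOnCl
  · have : ‖z‖ ≤ ‖z - s‖ + ‖s‖ := by simpa using norm_add_le (z - s) s
    rw [mem_sphere_iff_norm] at hz
    linarith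
  · field_simp; norm_num

/-- Landau's lemma on the logarithmic derivative of a holomorphic function bounded on a disc. -/
theorem norm_logDeriv_sub_sum_le {F : ℂ → ℂ} (hF : Differentiable ℂ F) {M r : ℝ} (hM : 0 < M)
    (hr : 0 < r) (hF0 : F 0 ≠ 0) (hb : ∀ z, ‖z‖ ≤ 3 * r → ‖F z‖ ≤ Real.exp M * ‖F 0‖) :
    ∃ Z : Finset ℂ, (∀ z, z ∈ Z ↔ ‖z‖ ≤ r ∧ F z = 0) ∧
      (∑ ρ ∈ Z, (analyticOrderNatAt F ρ : ℝ)) ≤ M / Real.log 2 ∧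
      ∀ s, ‖s‖ ≤ r / 4 → F s ≠ 0 →
        ‖deriv F s / F s - ∑ ρ ∈ Z, (analyticOrderNatAt F ρ : ℂ) / (s - ρ)‖ ≤ 8 * M / r := by
  obtain ⟨Z, hZ⟩ := exists_finset_zeros hF hF0 r
  obtain ⟨G, hG, hGZ, hFG⟩ := exists_eq_prod_pow_analyticOrderNatAt_mul hF hF0 Z
  have hGne : ∀ z, ‖z‖ ≤ r → G z ≠ 0 := fun z hz h => by
    have : z ∈ Z := (hZ z).2 ⟨hz, by rw [hFG, h, mul_zero]⟩
    exact hGZ z this h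
  set n := ∑ ρ ∈ Z, analyticOrderNatAt F ρ with hn
  have hmax : ∀ z, ‖z‖ ≤ 3 * r → ‖G z‖ ≤ Real.exp M * ‖G 0‖ / 2 ^ n := by
    intro z hz
    refine Complex.norm_le_of_forall_mem_frontier_norm_le (U := Metric.ball 0 (3 * r))
      Metric.isBounded_ball hG.diffContOnCl (fun w hw => ?_) ?_
    · rw [frontier_ball _ (by positivity), mem_sphere_zero_iff_norm] at hw
      have h1 := hb w hw.le
      rw [hFG w, hFG 0, norm_mul, norm_mul] at h1
      have h2 : 2 ^ n * ‖∏ ρ ∈ Z, (0 - ρ) ^ analyticOrderNatAt F ρ‖ ≤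
          ‖∏ ρ ∈ Z, (w - ρ) ^ analyticOrderNatAt F ρ‖ := by
        rw [hn, ← Finset.prod_pow_eq_pow_sum, norm_prod, norm_prod, ← Finset.prod_mul_distrib]
        refine Finset.prod_le_prod (fun ρ _ => by positivity) fun ρ hρ => ?_
        rw [norm_pow, norm_pow, ← mul_pow]
        refine pow_le_pow_left₀ (by positivity) ?_ _
        have h3 := ((hZ ρ).1 hρ).1
        have h4 : ‖w‖ ≤ ‖w - ρ‖ + ‖ρ‖ := by simpa using norm_add_le (w - ρ) ρ
        rw [zero_sub, norm_neg]
        linarith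
      set P := ‖∏ ρ ∈ Z, (0 - ρ) ^ analyticOrderNatAt F ρ‖ with hP
      have hP0 : 0 < P := by
        rw [hP, norm_pos_iff]
        intro h
        exact hF0 (by rw [hFG, h, zero_mul])
      rw [le_div_iff₀ (by positivity)]
      have h5 : P * (‖G w‖ * 2 ^ n) ≤ P * (Real.exp M * ‖G 0‖) := by
        calc P * (‖G w‖ * 2 ^ n) = 2 ^ n * P * ‖G w‖ := by ring
          _ ≤ _ := mul_le_mul_of_nonneg_right h2 (norm_nonneg _)
          _ ≤ _ := h1
          _ = _ := by ring
      exact le_of_mul_le_mul_left h5 hP0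
    · rwa [closure_ball _ (by positivity), mem_closedBall_zero_iff]
  have hG0 : 0 < ‖G 0‖ := norm_pos_iff.2 (hGne 0 (by simpa using hr.le))
  have hcount : (n : ℝ) ≤ M / Real.log 2 := by
    have h := hmax 0 (by simpa using hr.le)
    rw [le_div_iff₀ (by positivity), mul_comm] at h
    have h1 := le_of_mul_le_mul_right h hG0
    rw [le_div_iff₀ (Real.log_pos one_lt_two), ← Real.log_pow,
      Real.log_le_iff_le_exp (by positivity)]
    exact h1
  refine ⟨Z, hZ, by simpa [hn] using hcount, fun s hs hFs => ?_⟩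
  have hsr : ‖s‖ ≤ r := hs.trans (by linarith)
  have hld : deriv F s / F s - ∑ ρ ∈ Z, (analyticOrderNatAt F ρ : ℂ) / (s - ρ) =
      deriv G s / G s := by
    have hP0 : ∀ ρ ∈ Z, (s - ρ) ^ analyticOrderNatAt F ρ ≠ 0 := by
      intro ρ hρ h
      exact hFs (by rw [hFG, Finset.prod_eq_zero hρ h, zero_mul])
    have hF' : F = fun z => (∏ ρ ∈ Z, (z - ρ) ^ analyticOrderNatAt F ρ) * G z := funext hFG
    have h1 : logDeriv F s = logDeriv (fun z => ∏ ρ ∈ Z, (z - ρ) ^ analyticOrderNatAt F ρ) s +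
        logDeriv G s := by
      conv_lhs => rw [hF']
      exact logDeriv_mul s (Finset.prod_ne_zero_iff.2 hP0) (hGne s hsr) (by fun_prop) (hG s)
    have h2 : logDeriv (fun z => ∏ ρ ∈ Z, (z - ρ) ^ analyticOrderNatAt F ρ) s =
        ∑ ρ ∈ Z, (analyticOrderNatAt F ρ : ℂ) / (s - ρ) := by
      rw [logDeriv_prod hP0 fun ρ _ => by fun_prop]
      refine Finset.sum_congr rfl fun ρ hρ => ?_
      rw [logDeriv_fun_pow (by fun_prop), logDeriv_apply]
      simp [div_eq_mul_inv]
    rw [← logDeriv_apply, ← logDeriv_apply, h1, h2, add_sub_cancel_left]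
  rw [hld]
  refine norm_deriv_div_le_of_norm_le hG hM hr (fun z hz => hGne z hz.le) (fun z hz => ?_) hs
  refine (hmax z (by linarith)).trans (div_le_self (by positivity) ?_)
  exact one_le_pow₀ one_le_two

section
variable {K : Type*} [Field K] [NumberField K] {ζK : ℂ → ℂ}

theorem exists_half_le_norm_dedekindZeta
    (hζ_ser : ∀ s : ℂ, 1 < s.re → HasSum (fun I : {I : Ideal (𝓞 K) // I ≠ ⊥} =>
      ((Ideal.absNorm I.1 : ℕ) : ℂ) ^ (-s)) (ζK s)) :
    ∃ x : ℝ, 2 ≤ x ∧ ∀ s : ℂ, s.re = x → 1 / 2 ≤ ‖ζK s‖ := by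
  have h2 := summable_absNorm_rpow hζ_ser one_lt_two
  set S := ∑' I : {I : Ideal (𝓞 K) // I ≠ ⊥}, (Ideal.absNorm I.1 : ℝ) ^ (-2 : ℝ) with hS
  have hlim : Tendsto (fun n : ℕ => (1 / 2 : ℝ) ^ n * S) atTop (𝓝 0) := by
    simpa using (tendsto_pow_atTop_nhds_zero_of_lt_one (r := (1 / 2 : ℝ)) (by norm_num)
      (by norm_num)).mul_const S
  obtain ⟨n, hn⟩ := (hlim.eventually_le_const (show (0 : ℝ) < 1 / 2 by norm_num)).exists
  refine ⟨n + 2, by linarith [(Nat.cast_nonneg n : (0 : ℝ) ≤ n)], fun s hs => ?_⟩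
  have hs1 : 1 < s.re := by rw [hs]; linarith [(Nat.cast_nonneg n : (0 : ℝ) ≤ n)]
  classical
  set b : {I : Ideal (𝓞 K) // I ≠ ⊥} := ⟨⊤, top_ne_bot⟩ with hb
  have h := (hζ_ser s hs1).update b 0
  have hb1 : ((Ideal.absNorm b.1 : ℕ) : ℂ) ^ (-s) = 1 := by simp [hb]
  rw [hb1, zero_sub] at h
  have hle : ‖-1 + ζK s‖ ≤ (1 / 2 : ℝ) ^ n * S := by
    refine h.norm_le_of_bounded (h2.hasSum.mul_left _) fun I => ?_
    by_cases hI : I = b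
    · rw [hI, Function.update_self, norm_zero]
      exact mul_nonneg (by positivity) (Real.rpow_nonneg (Nat.cast_nonneg _) _)
    · have h0 : 0 < Ideal.absNorm I.1 :=
        Nat.pos_of_ne_zero (Ideal.absNorm_eq_zero_iff.not.2 I.2)
      have h1 : Ideal.absNorm I.1 ≠ 1 := fun h => hI (Subtype.ext (Ideal.absNorm_eq_one_iff.1 h))
      have h3 : (2 : ℝ) ≤ Ideal.absNorm I.1 := by
        exact_mod_cast (by omega : 2 ≤ Ideal.absNorm I.1)
      have h4 : (0 : ℝ) < Ideal.absNorm I.1 := by linarith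
      rw [Function.update_of_ne hI, Complex.norm_natCast_cpow_of_pos h0, Complex.neg_re, hs,
        show (-(n + 2 : ℝ)) = -n + -2 by ring, Real.rpow_add h4, Real.rpow_neg h4.le,
        Real.rpow_natCast, one_div, inv_pow]
      gcongr
  have h5 : ‖(1 : ℂ)‖ ≤ ‖ζK s‖ + ‖-1 + ζK s‖ := by
    have : (1 : ℂ) = ζK s - (-1 + ζK s) := by ring
    nth_rewrite 1 [this]
    exact norm_sub_le _ _
  rw [norm_one] at h5
  linarith

theorem dedekindZeta_zero_re_mem_Ioo {F : ℂ → ℂ}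
    (hζ_an : ∀ s : ℂ, s ≠ 1 → DifferentiableAt ℂ ζK s)
    (hζ_ser : ∀ s : ℂ, 1 < s.re → HasSum (fun I : {I : Ideal (𝓞 K) // I ≠ ⊥} =>
      ((Ideal.absNorm I.1 : ℕ) : ℂ) ^ (-s)) (ζK s))
    (hF : Differentiable ℂ F) (hF1 : F 1 ≠ 0)
    (hFζ : ∀ s, s ≠ 1 → F s = (s - 1) * ζK s) {ρ : ℂ} (hρ : ζK ρ = 0) (him : ρ.im ≠ 0) :
    0 < ρ.re ∧ ρ.re < 1 := by
  have hne : ∀ z : ℂ, 1 ≤ z.re → z.im ≠ 0 → ζK z ≠ 0 := fun z hz hzi h =>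
    entire_ne_zero_of_one_le_re hζ_an hζ_ser hF hF1 hFζ hz
      (by rw [hFζ z (fun h1 => hzi (by rw [h1, Complex.one_im])), h, mul_zero])
  constructor
  · by_contra! hre
    obtain ⟨Λ, a, d, ha, hd, hΛ, hFE, -⟩ := exists_completed_dedekindZeta hζ_an hζ_ser
    have him' : (1 - ρ).im ≠ 0 := by simpa using him
    refine hne (1 - ρ) (by simp; linarith) him' ?_
    have h1 : Λ ρ = 0 := by
      have h2 := hΛ ρ him
      rw [hρ] at h2
      exact (mul_eq_zero.1 h2.symm).resolve_left (archGammaInv_ne_zero (Or.inr him))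
    rw [hΛ _ him', hFE ρ him, h1, mul_zero, mul_zero]
  · by_contra! hre
    exact hne ρ hre him hρ

end

theorem tsum_subtype_eq_sum {P : ℂ → Prop} (f : ℂ → ℂ) (W : Finset ℂ) (hW : ∀ ρ, ρ ∈ W ↔ P ρ) :
    ∑' ρ : {ρ : ℂ // P ρ}, f ρ.1 = ∑ ρ ∈ W, f ρ := by
  obtain rfl : P = (· ∈ W) := funext fun ρ => propext (hW ρ).symm
  exact W.tsum_subtype f

theorem norm_sum_div_sub_le {Z : Finset ℂ} {m : ℂ → ℕ} {s : ℂ}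
    (h : ∀ ρ ∈ Z, 1 ≤ ‖s - ρ‖) : ‖∑ ρ ∈ Z, (m ρ : ℂ) / (s - ρ)‖ ≤ ∑ ρ ∈ Z, (m ρ : ℝ) := by
  refine (norm_sum_le _ _).trans (Finset.sum_le_sum fun ρ hρ => ?_)
  rw [norm_div, Complex.norm_natCast]
  exact div_le_self (Nat.cast_nonneg _) (h ρ hρ)

section
variable {K : Type*} [Field K] [NumberField K] {ζK : ℂ → ℂ}

theorem exists_norm_entire_le_exp_log {F : ℂ → ℂ}
    (hζ_an : ∀ s : ℂ, s ≠ 1 → DifferentiableAt ℂ ζK s)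
    (hζ_ser : ∀ s : ℂ, 1 < s.re → HasSum (fun I : {I : Ideal (𝓞 K) // I ≠ ⊥} =>
      ((Ideal.absNorm I.1 : ℕ) : ℂ) ^ (-s)) (ζK s))
    (hF : Differentiable ℂ F) (hFζ : ∀ s, s ≠ 1 → F s = (s - 1) * ζK s) :
    ∃ x E : ℝ, 2 ≤ x ∧ 0 < E ∧ ∀ t : ℝ, 2 ≤ t → F (x + t * I) ≠ 0 ∧
      ∀ z : ℂ, ‖z‖ ≤ 3 * (4 * (x + 1)) →
        ‖F (z + (x + t * I))‖ ≤ Real.exp (E * Real.log t) * ‖F (x + t * I)‖ := by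
  obtain ⟨x, hx2, hx⟩ := exists_half_le_norm_dedekindZeta hζ_ser
  obtain ⟨k, hk⟩ := exists_nat_ge (3 * (4 * (x + 1)) + x + 1)
  have hk1 : (1 : ℝ) ≤ k := by linarith
  have hk0 : k ≠ 0 := by rintro rfl; norm_num at hk1
  obtain ⟨C₀, A, hC₀⟩ := exists_norm_entire_le_pow hζ_an hζ_ser hF hFζ hk0
  set C := max C₀ 1 with hC
  have hC1 : 1 ≤ C := le_max_right _ _
  set B : ℝ := 3 * (4 * (x + 1)) + x + k + 2 with hB
  have hB1 : 1 ≤ B := by linarith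
  have hl2 : 0 < Real.log 2 := Real.log_pos one_lt_two
  have hlC : 0 < Real.log (2 * C) := Real.log_pos (by linarith)
  have hlB : 0 ≤ Real.log B := Real.log_nonneg hB1
  have hE : 0 < (Real.log (2 * C) + A * Real.log B) / Real.log 2 + A := by positivity
  refine ⟨x, _, hx2, hE, fun t ht => ?_⟩
  have ht0 : 0 < t := by linarith
  have hre : (x + t * I : ℂ).re = x := by simp
  have him : (x + t * I : ℂ).im = t := by simp
  have hlt : Real.log 2 ≤ Real.log t := Real.log_le_log two_pos ht
  have hlow : 1 / 2 ≤ ‖F (x + t * I)‖ := by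
    have h1 : (x + t * I : ℂ) ≠ 1 := fun h => by
      have := congrArg Complex.im h
      rw [him, Complex.one_im] at this
      linarith
    have h2 : 1 ≤ ‖(x + t * I : ℂ) - 1‖ :=
      le_trans (by rw [Complex.sub_re, hre, Complex.one_re, abs_of_nonneg] <;> linarith)
        (Complex.abs_re_le_norm _)
    rw [hFζ _ h1, norm_mul]
    exact (hx _ hre).trans (le_mul_of_one_le_left (norm_nonneg _) h2)
  refine ⟨norm_pos_iff.1 (by linarith), fun z hz => ?_⟩
  have hzre := abs_le.1 ((Complex.abs_re_le_norm z).trans hz)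
  have hle := hC₀ (z + (x + t * I)) (by
    rw [Complex.add_re, hre]
    constructor <;> linarith)
  have hn : ‖z + (x + t * I) + (k + 1)‖ ≤ B * t := by
    have h3 : ‖z + (x + t * I) + (k + 1)‖ ≤ ‖z‖ + (x + t) + (k + 1) := by
      refine (norm_add_le _ _).trans (add_le_add ((norm_add_le _ _).trans
        (add_le_add le_rfl ((norm_add_le _ _).trans (add_le_add ?_ ?_)))) ?_)
      · rw [Complex.norm_real, Real.norm_of_nonneg (by linarith)]
      · rw [norm_mul, Complex.norm_real, Complex.norm_I, mul_one, Real.norm_of_nonneg ht0.le]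
      · exact (norm_add_le _ _).trans (by simp)
    have h4 : (B - 1) * 1 ≤ (B - 1) * t := mul_le_mul_of_nonneg_left (by linarith) (by linarith)
    nlinarith
  have hP : 0 < 2 * C * (B * t) ^ A := by positivity
  have hexp : 2 * C * (B * t) ^ A ≤
      Real.exp (((Real.log (2 * C) + A * Real.log B) / Real.log 2 + A) * Real.log t) := by
    rw [← Real.log_le_iff_le_exp hP, Real.log_mul (by positivity) (by positivity), Real.log_pow,
      Real.log_mul (by positivity) ht0.ne']
    have h5 : Real.log (2 * C) + A * Real.log B ≤
        (Real.log (2 * C) + A * Real.log B) / Real.log 2 * Real.log t := by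
      rw [div_mul_eq_mul_div, le_div_iff₀ hl2]
      exact mul_le_mul_of_nonneg_left hlt (by positivity)
    linarith
  calc ‖F (z + (x + t * I))‖ ≤ C₀ * ‖z + (x + t * I) + (k + 1)‖ ^ A := hle
    _ ≤ C * (B * t) ^ A := mul_le_mul (le_max_left _ _)
        (pow_le_pow_left₀ (norm_nonneg _) hn A) (by positivity) (by linarith)
    _ = 2 * C * (B * t) ^ A * (1 / 2) := by ring
    _ ≤ _ := mul_le_mul hexp hlow (by norm_num) (Real.exp_pos _).le

theorem analyticOrderNatAt_comp_add_eq_of_eventually_eq {F f g : ℂ → ℂ} (hF : Differentiable ℂ F)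
    (hF1 : F 1 ≠ 0) (hFf : ∀ s, s ≠ 1 → F s = (s - 1) * f s) {c w : ℂ} {m : ℕ}
    (hw : w + c ≠ 1) (hg : AnalyticAt ℂ g (w + c)) (hg0 : g (w + c) ≠ 0)
    (hfg : ∀ᶠ s in 𝓝 (w + c), f s = (s - (w + c)) ^ m * g s) :
    analyticOrderNatAt (fun z => F (z + c)) w = m := by
  have hFc : Differentiable ℂ fun z => F (z + c) := by fun_prop
  have ho : analyticOrderAt (fun z => F (z + c)) w ≠ ⊤ := fun h =>
    not_eventually_eq_zero_of_differentiable hFc (c := 1 - c) (by simpa using hF1) w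
      (analyticOrderAt_eq_top.1 h)
  have hg' : AnalyticAt ℂ (fun z => g (z + c)) w :=
    AnalyticAt.comp (g := g) (f := fun z => z + c) hg (analyticAt_id.add analyticAt_const)
  refine ((hFc.analyticAt w).analyticOrderNatAt_eq_iff ho).2
    ⟨fun z => (z + c - 1) * g (z + c), (by fun_prop : AnalyticAt ℂ (fun z => z + c - 1) w).mul hg',
      mul_ne_zero (sub_ne_zero.2 hw) hg0, ?_⟩
  have hc : Tendsto (fun z => z + c) (𝓝 w) (𝓝 (w + c)) :=
    (continuous_id.add continuous_const).tendsto w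
  filter_upwards [hc.eventually hfg, hc.eventually (isOpen_ne.mem_nhds hw)] with z hz hz1
  rw [hFf _ hz1, hz, smul_eq_mul]
  ring

end

/-- Equation (3.9) of Dixit–Gupta–Vatwani: in the strip `-1/2 ≤ σ ≤ 3/2`, `t ≥ 2`,
`ζ_K'(s)/ζ_K(s) = ∑_{ρ : |t - Im ρ| ≤ 1} 1/(s - ρ) + O(log t)`, where the sum is over
the non-trivial zeros `ρ` of `ζ_K` with `|t - Im ρ| ≤ 1`, counted with multiplicity.
The multiplicity is given by the function `mult`, characterised by the factorisation
`ζK(s) = (s - ρ)^{mult ρ} g(s)` with `g` analytic and non-vanishing at `ρ`. -/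
theorem log_deriv_dedekind_zeta_near_zeros
    (K : Type*) [Field K] [NumberField K] (ζK : ℂ → ℂ)
    (hζ_an : ∀ s : ℂ, s ≠ 1 → DifferentiableAt ℂ ζK s)
    (hζ_ser : ∀ s : ℂ, 1 < s.re →
      HasSum (fun I : {I : Ideal (𝓞 K) // I ≠ ⊥} =>
        ((Ideal.absNorm I.1 : ℕ) : ℂ) ^ (-s)) (ζK s))
    (hζ_pole : ∃ A : ℂ, A ≠ 0 ∧
      Tendsto (fun s : ℂ => (s - 1) * ζK s) (𝓝[≠] (1 : ℂ)) (𝓝 A))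
    (mult : ℂ → ℕ)
    (hmult : ∀ ρ : ℂ, 0 < ρ.re → ρ.re < 1 → ζK ρ = 0 →
      ∃ g : ℂ → ℂ, AnalyticAt ℂ g ρ ∧ g ρ ≠ 0 ∧
        ∀ᶠ s in 𝓝 ρ, ζK s = (s - ρ) ^ (mult ρ) * g s) :
    ∃ C : ℝ, 0 < C ∧ ∀ σ t : ℝ, σ ∈ Set.Icc (-(1/2) : ℝ) (3/2) → 2 ≤ t →
      ζK (σ + t * I) ≠ 0 →
      ‖deriv ζK (σ + t * I) / ζK (σ + t * I) -
          ∑' ρ : {ρ : ℂ // ζK ρ = 0 ∧ 0 < ρ.re ∧ ρ.re < 1 ∧ |t - ρ.im| ≤ 1},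
            (mult ρ.1 : ℂ) / ((σ + t * I) - ρ.1)‖
        ≤ C * Real.log t := by
  obtain ⟨F, hF, hF1, hFζ⟩ := exists_entire_eq_sub_mul hζ_an hζ_pole
  obtain ⟨x, E, hx2, hE, hb⟩ := exists_norm_entire_le_exp_log hζ_an hζ_ser hF hFζ
  have hl2 : 0 < Real.log 2 := Real.log_pos one_lt_two
  have hr : 0 < 4 * (x + 1) := by linarith
  refine ⟨8 * E / (4 * (x + 1)) + E / Real.log 2 + 1 / Real.log 2, by positivity,
    fun σ t hσ ht hs0 => ?_⟩
  have hlt : Real.log 2 ≤ Real.log t := Real.log_le_log two_pos ht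
  obtain ⟨hF0, hbt⟩ := hb t ht
  set c : ℂ := x + t * I with hc
  set s : ℂ := σ + t * I with hs
  have hcre : c.re = x := by simp [hc]
  have hcim : c.im = t := by simp [hc]
  have hsim : s.im = t := by simp [hs]
  obtain ⟨Z, hZ, hZcard, hZb⟩ := norm_logDeriv_sub_sum_le (F := fun z => F (z + c)) (by fun_prop)
    (mul_pos hE (hl2.trans_le hlt)) hr (by simpa using hF0) (by simpa using hbt)
  have hne1 : ∀ z : ℂ, 1 ≤ z.im → z ≠ 1 := fun z hz h => by
    rw [h, Complex.one_im] at hz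
    linarith
  have hs1 : s ≠ 1 := hne1 s (by linarith)
  have hs1' : s - 1 ≠ 0 := sub_ne_zero.2 hs1
  have hFs : F s ≠ 0 := by rw [hFζ s hs1]; exact mul_ne_zero hs1' hs0
  have hlog : deriv F s / F s = 1 / (s - 1) + deriv ζK s / ζK s := by
    have hd : HasDerivAt (fun w => (w - 1) * ζK w) (1 * ζK s + (s - 1) * deriv ζK s) s :=
      ((hasDerivAt_id s).sub_const 1).mul (hζ_an s hs1).hasDerivAt
    have he : F =ᶠ[𝓝 s] fun w => (w - 1) * ζK w := by
      filter_upwards [isOpen_ne.mem_nhds hs1] with w hw using hFζ w hw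
    rw [he.deriv_eq, hd.deriv, hFζ s hs1]
    field_simp
  have hsc : ‖s - c‖ ≤ 4 * (x + 1) / 4 := by
    have e : s - c = ((σ - x : ℝ) : ℂ) := by rw [hs, hc]; push_cast; ring
    rw [e, Complex.norm_real, Real.norm_eq_abs, abs_le]
    constructor <;> linarith [hσ.1, hσ.2]
  have hmain := hZb (s - c) hsc (by simpa using hFs)
  rw [deriv_comp_add_const, sub_add_cancel, hlog] at hmain
  have him : ∀ w : ℂ, t - (w + c).im = -w.im := fun w => by
    rw [Complex.add_im, hcim]; ring
  have hZmult : ∀ w ∈ Z, |w.im| ≤ 1 → ζK (w + c) = 0 ∧ (0 < (w + c).re ∧ (w + c).re < 1) ∧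
      analyticOrderNatAt (fun z => F (z + c)) w = mult (w + c) := by
    intro w hw hwi
    have h1 : 1 ≤ (w + c).im := by
      rw [Complex.add_im, hcim]
      linarith [(abs_le.1 hwi).1]
    have hw1 := hne1 _ h1
    have h2 : F (w + c) = 0 := ((hZ w).1 hw).2
    rw [hFζ _ hw1] at h2
    have h3 : ζK (w + c) = 0 := (mul_eq_zero.1 h2).resolve_left (sub_ne_zero.2 hw1)
    have h4 := dedekindZeta_zero_re_mem_Ioo hζ_an hζ_ser hF hF1 hFζ h3 (by linarith)
    obtain ⟨g, hg, hg0, hfg⟩ := hmult _ h4.1 h4.2 h3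
    exact ⟨h3, h4, analyticOrderNatAt_comp_add_eq_of_eventually_eq hF hF1 hFζ hw1 hg hg0 hfg⟩
  have hW : ∀ ρ, ρ ∈ (Z.filter fun w => |w.im| ≤ 1).image (· + c) ↔
      ζK ρ = 0 ∧ 0 < ρ.re ∧ ρ.re < 1 ∧ |t - ρ.im| ≤ 1 := by
    intro ρ
    rw [Finset.mem_image]
    constructor
    · rintro ⟨w, hw, rfl⟩
      rw [Finset.mem_filter] at hw
      obtain ⟨h1, h2, -⟩ := hZmult w hw.1 hw.2
      exact ⟨h1, h2.1, h2.2, by rw [him, abs_neg]; exact hw.2⟩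
    · rintro ⟨h0, h1, h2, h3⟩
      have h4 : |(ρ - c).im| ≤ 1 := by rwa [Complex.sub_im, hcim, abs_sub_comm]
      have h5 : |(ρ - c).re| ≤ x := by
        rw [Complex.sub_re, hcre, abs_le]
        constructor <;> linarith
      have h6 : ρ ≠ 1 := fun h => by rw [h, Complex.one_re] at h2; exact h2.false
      refine ⟨ρ - c, Finset.mem_filter.2 ⟨(hZ _).2 ⟨?_, ?_⟩, h4⟩, sub_add_cancel _ _⟩
      · linarith [Complex.norm_le_abs_re_add_abs_im (ρ - c)]
      · rw [sub_add_cancel, hFζ ρ h6, h0, mul_zero]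
  rw [tsum_subtype_eq_sum (fun ρ => (mult ρ : ℂ) / (s - ρ)) _ hW,
    Finset.sum_image fun a _ b _ h => add_right_cancel h]
  have hwin : ∑ w ∈ Z with |w.im| ≤ 1, (mult (w + c) : ℂ) / (s - (w + c)) =
      ∑ w ∈ Z with |w.im| ≤ 1,
        (analyticOrderNatAt (fun z => F (z + c)) w : ℂ) / (s - c - w) := by
    refine Finset.sum_congr rfl fun w hw => ?_
    rw [Finset.mem_filter] at hw
    rw [(hZmult w hw.1 hw.2).2.2]
    congr 1
    ring
  rw [hwin]
  rw [← Finset.sum_filter_add_sum_filter_not Z (fun w => |w.im| ≤ 1)] at hmain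
  have hfar : ‖∑ w ∈ Z with ¬ |w.im| ≤ 1,
      (analyticOrderNatAt (fun z => F (z + c)) w : ℂ) / (s - c - w)‖ ≤
        E * Real.log t / Real.log 2 := by
    refine (norm_sum_div_sub_le fun w hw => ?_).trans
      ((Finset.sum_le_sum_of_subset_of_nonneg (Finset.filter_subset _ _)
        fun _ _ _ => Nat.cast_nonneg _).trans hZcard)
    have h1 := Complex.abs_im_le_norm (s - c - w)
    rw [Complex.sub_im, Complex.sub_im, hsim, hcim, sub_self, zero_sub, abs_neg] at h1
    exact (not_le.1 (Finset.mem_filter.1 hw).2).le.trans h1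
  have hpole : ‖1 / (s - 1)‖ ≤ 1 := by
    have h1 := (le_abs_self _).trans (Complex.abs_im_le_norm (s - 1))
    rw [Complex.sub_im, hsim, Complex.one_im, sub_zero] at h1
    rw [norm_div, norm_one]
    exact (div_le_one (by linarith)).2 (by linarith)
  have hone : 1 ≤ 1 / Real.log 2 * Real.log t := by
    rw [one_div_mul_eq_div, le_div_iff₀ hl2, one_mul]
    exact hlt
  set P := ∑ w ∈ Z with |w.im| ≤ 1,
    (analyticOrderNatAt (fun z => F (z + c)) w : ℂ) / (s - c - w)
  set Q := ∑ w ∈ Z with ¬ |w.im| ≤ 1,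
    (analyticOrderNatAt (fun z => F (z + c)) w : ℂ) / (s - c - w)
  calc ‖deriv ζK s / ζK s - P‖
      = ‖(1 / (s - 1) + deriv ζK s / ζK s - (P + Q)) + Q - 1 / (s - 1)‖ := by congr 1; ring
    _ ≤ 8 * (E * Real.log t) / (4 * (x + 1)) + E * Real.log t / Real.log 2 + 1 :=
        (norm_sub_le _ _).trans (add_le_add ((norm_add_le _ _).trans (add_le_add hmain hfar)) hpole)
    _ ≤ 8 * (E * Real.log t) / (4 * (x + 1)) + E * Real.log t / Real.log 2 +
        1 / Real.log 2 * Real.log t := by gcongr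
    _ = _ := by ring
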